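/- Let n ≥ 3 be an integer and let τ = e^{iπ/n}, so that d = τ + τ⁻¹ = 2cos(π/n). Then the Temperley–Lieb category TL(τ) has exactly one nonzero proper ideal, namely the ideal Neg of negligible morphisms. -/

import Mathlib

/-!
Common definitions: the Temperley–Lieb category over a field `K` with loop
parameter `d`.

An `(m,n)`-Temperley–Lieb diagram is a noncrossing perfect matching of `m`
marked points on the top edge and `n` marked points on the bottom edge of a
rectangle.  We encode it as a fixed-point-free involution of
`Fin m ⊕ Fin n` (`Sum.inl i` is the `i`-th top point, `Sum.inr j` the `j`-th
bottom point) which is noncrossing with respect to the boundary order of the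
points (top points from left to right, then bottom points from right to left).
-/

open scoped Classical

namespace TL

/-- The position of a marked point in the linear boundary order of the
rectangle: top points `0, …, m-1` from left to right, then bottom points
from right to left. -/
def bIdx (m n : ℕ) : Fin m ⊕ Fin n → ℕ
  | Sum.inl i => (i : ℕ)
  | Sum.inr j => m + (n - 1 - (j : ℕ))

/-- An `(m,n)`-Temperley–Lieb diagram: a noncrossing perfect matching
(= fixed-point-free involution) of the `m` top points and `n` bottom points. -/
structure Diagram (m n : ℕ) where
  pair : Fin m ⊕ Fin n → Fin m ⊕ Fin n
  involutive : Function.Involutive pair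
  fixedPointFree : ∀ x, pair x ≠ x
  noncrossing : ∀ x y, ¬ (bIdx m n x < bIdx m n y ∧ bIdx m n y < bIdx m n (pair x) ∧
      bIdx m n (pair x) < bIdx m n (pair y))

noncomputable instance (m n : ℕ) : Fintype (Diagram m n) :=
  Fintype.ofInjective (fun D => D.pair)
    (fun a b h => by cases a; cases b; simpa using h)

/-- `Hom K m n` is the `K`-vector space of morphisms from `m` to `n`:
the free vector space on the set of `(m,n)`-TL diagrams, realized as the
space of `K`-valued functions on the (finite) set of diagrams. -/
abbrev Hom (K : Type) [Field K] (m n : ℕ) : Type := Diagram m n → K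

variable {K : Type} [Field K]

/-- The basis vector of `Hom K m n` corresponding to a single diagram. -/
noncomputable def single {m n : ℕ} (p : Diagram m n) : Hom K m n :=
  fun c => if c = p then 1 else 0

/-! ### Composition -/

/-- The marked points of the picture obtained by stacking an `(l,m)`-diagram
on top of an `(m,n)`-diagram: `l` top points, `m` middle points, `n` bottom
points. -/
abbrev Pt (l m n : ℕ) := Fin l ⊕ (Fin m ⊕ Fin n)

/-- One strand of the stacked picture: either a strand of the top diagram `a`
(on the `l` top and `m` middle points) or a strand of the bottom diagram `b`
(on the `m` middle and `n` bottom points). -/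
def Step {l m n : ℕ} (a : Diagram l m) (b : Diagram m n) : Pt l m n → Pt l m n → Prop :=
  fun x y =>
    (∃ u : Fin l ⊕ Fin m, Sum.map id Sum.inl u = x ∧ Sum.map id Sum.inl (a.pair u) = y) ∨
    (∃ u : Fin m ⊕ Fin n, Sum.inr u = x ∧ Sum.inr (b.pair u) = y)

/-- Connectivity in the stacked picture: two marked points are connected if
they are joined by a path of strands. -/
def Conn {l m n : ℕ} (a : Diagram l m) (b : Diagram m n) : Pt l m n → Pt l m n → Prop :=
  Relation.EqvGen (Step a b)

/-- The points of the middle layer whose connected component stays entirely in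
the middle layer; these components are exactly the closed loops produced when
stacking. -/
def ClosedMid {l m n : ℕ} (a : Diagram l m) (b : Diagram m n) : Set (Pt l m n) :=
  {x | (∃ j : Fin m, x = Sum.inr (Sum.inl j)) ∧
    ∀ y, Conn a b x y → ∃ j : Fin m, y = Sum.inr (Sum.inl j)}

/-- The number of closed loops produced when stacking `a` on top of `b`:
the number of connected components consisting entirely of middle points. -/
noncomputable def numLoops {l m n : ℕ} (a : Diagram l m) (b : Diagram m n) : ℕ :=
  Nat.card (Quotient (⟨fun x y : ClosedMid a b => Conn a b x.1 y.1,
    ⟨fun _ => Relation.EqvGen.refl _, fun h => Relation.EqvGen.symm _ _ h,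
      fun h h' => Relation.EqvGen.trans _ _ _ h h'⟩⟩ : Setoid (ClosedMid a b)))

/-- Composition of two diagrams `b ∘ a` (stack `a` on top of `b`, delete the
`r` closed loops, multiply by `d ^ r`), expressed as an element of
`Hom K l n`: the result is `d ^ r` times the unique `(l,n)`-diagram inducing
the same pairing of the outer points as the connectivity of the stacked
picture. -/
noncomputable def compD (d : K) {l m n : ℕ} (b : Diagram m n) (a : Diagram l m) :
    Hom K l n :=
  fun c =>
    if ∀ x : Fin l ⊕ Fin n,
        Conn a b (Sum.map id Sum.inr x) (Sum.map id Sum.inr (c.pair x))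
    then d ^ numLoops a b else 0

/-- Composition `b ∘ a : Hom K l n` of `b : Hom K m n` with `a : Hom K l m`
(bilinear extension of composition of diagrams). -/
noncomputable def comp (d : K) {l m n : ℕ} (b : Hom K m n) (a : Hom K l m) :
    Hom K l n :=
  fun c => ∑ p : Diagram m n, ∑ q : Diagram l m, b p * a q * compD d p q c

/-! ### Tensor product -/

/-- Relabelling of the marked points of a horizontal juxtaposition of an
`(m,n)`-diagram (placed on the left) and an `(m',n')`-diagram (on the right). -/
def tEquiv (m n m' n' : ℕ) :
    (Fin (m + m') ⊕ Fin (n + n')) ≃ ((Fin m ⊕ Fin n) ⊕ (Fin m' ⊕ Fin n')) :=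
  (Equiv.sumCongr finSumFinEquiv.symm finSumFinEquiv.symm).trans
    (Equiv.sumSumSumComm _ _ _ _)

/-- The pairing of the horizontal juxtaposition of two diagrams. -/
def tensorPair {m n m' n' : ℕ} (a : Diagram m n) (b : Diagram m' n') :
    Fin (m + m') ⊕ Fin (n + n') → Fin (m + m') ⊕ Fin (n + n') :=
  fun x => (tEquiv m n m' n').symm (Sum.map a.pair b.pair (tEquiv m n m' n' x))

/-- The tensor product (horizontal juxtaposition) of two diagrams, as an
element of `Hom K (m+m') (n+n')`: the basis vector of the unique diagram whose
pairing is the juxtaposed pairing. -/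
noncomputable def tensorD {m n m' n' : ℕ} (a : Diagram m n) (b : Diagram m' n') :
    Hom K (m + m') (n + n') :=
  fun c => if c.pair = tensorPair a b then 1 else 0

/-- The tensor product of morphisms (bilinear extension of horizontal
juxtaposition of diagrams). -/
noncomputable def tensor {m n m' n' : ℕ} (x : Hom K m n) (y : Hom K m' n') :
    Hom K (m + m') (n + n') :=
  fun c => ∑ p : Diagram m n, ∑ q : Diagram m' n', x p * y q * tensorD p q c

/-! ### Identity, cup and cap -/

/-- The identity diagram `1_n`: `n` vertical strands. -/
def idD (n : ℕ) : Diagram n n where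
  pair := Sum.elim Sum.inr Sum.inl
  involutive := by rintro (i | i) <;> rfl
  fixedPointFree := by rintro (i | i) <;> simp
  noncrossing := by
    rintro (i | i) (j | j) <;>
      · simp only [Sum.elim_inl, Sum.elim_inr, bIdx]
        have hi := i.isLt; have hj := j.isLt; omega

/-- The identity morphism `1_n ∈ T_n`. -/
noncomputable def idHom (K : Type) [Field K] (n : ℕ) : Hom K n n :=
  fun c => if c = idD n then 1 else 0

/-- The cap `∩`: the unique `(0,2)`-TL diagram. -/
def capD : Diagram 0 2 where
  pair := fun x => match x with
    | Sum.inl i => i.elim0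
    | Sum.inr j => Sum.inr ⟨1 - (j : ℕ), by omega⟩
  involutive := by intro x; revert x; decide
  fixedPointFree := by decide
  noncrossing := by decide

/-- The cup `∪`: the unique `(2,0)`-TL diagram. -/
def cupD : Diagram 2 0 where
  pair := fun x => match x with
    | Sum.inl j => Sum.inl ⟨1 - (j : ℕ), by omega⟩
    | Sum.inr i => i.elim0
  involutive := by intro x; revert x; decide
  fixedPointFree := by decide
  noncrossing := by decide

/-- The cap `∩` as a morphism in `Hom K 0 2`. -/
noncomputable def capHom (K : Type) [Field K] : Hom K 0 2 :=
  fun c => if c = capD then 1 else 0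

/-- The cup `∪` as a morphism in `Hom K 2 0`. -/
noncomputable def cupHom (K : Type) [Field K] : Hom K 2 0 :=
  fun c => if c = cupD then 1 else 0

/-! ### The Markov trace -/

/-- The strands of the picture obtained from an `(n,n)`-diagram `p` by closing
it up: joining, for each `i`, the `i`-th top point to the `i`-th bottom point
(by nested arcs passing to the right of the rectangle). -/
def closeStep {n : ℕ} (p : Diagram n n) : (Fin n ⊕ Fin n) → (Fin n ⊕ Fin n) → Prop :=
  fun x y => p.pair x = y ∨ Sum.elim Sum.inr Sum.inl x = y

/-- The number `c(p)` of closed loops of the closure of an `(n,n)`-diagram. -/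
noncomputable def trLoops {n : ℕ} (p : Diagram n n) : ℕ :=
  Nat.card (Quotient (Relation.EqvGen.setoid (closeStep p)))

/-- The Markov trace `Tr_n : T_n → K`, sending a diagram `p` to
`d ^ c(p)`. -/
noncomputable def Tr (d : K) {n : ℕ} (x : Hom K n n) : K :=
  ∑ p : Diagram n n, x p * d ^ trLoops p

/-! ### Conditional expectations -/

/-- The conditional expectation `ε_n : T_{n+1} → T_n`,
`a ↦ (1_n ⊗ ∪) ∘ (a ⊗ 1_1) ∘ (1_n ⊗ ∩)` (closing up the last strand). -/
noncomputable def eps (d : K) (n : ℕ) (a : Hom K (n + 1) (n + 1)) : Hom K n n :=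
  let u : Hom K n (n + 2) := tensor (idHom K n) (capHom K)
  let v : Hom K (n + 2) (n + 2) := @tensor K _ (n + 1) (n + 1) 1 1 a (idHom K 1)
  let w : Hom K (n + 2) n := tensor (idHom K n) (cupHom K)
  comp d w (comp d v u)

/-- The iterated conditional expectation `ε_{n,n+m} = ε_n ∘ ε_{n+1} ∘ ⋯ ∘ ε_{n+m-1} :
T_{n+m} → T_n`. -/
noncomputable def epsIter (d : K) (n : ℕ) : (m : ℕ) → Hom K (n + m) (n + m) → Hom K n n
  | 0, a => a
  | m + 1, a => epsIter d n m (eps d (n + m) a)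

/-! ### Tensor powers of cup and cap -/

/-- `∩^{⊗k} ∈ Hom(0, 2k)`. -/
noncomputable def capPow (K : Type) [Field K] : (k : ℕ) → Hom K 0 (2 * k)
  | 0 => idHom K 0
  | k + 1 => tensor (capPow K k) (capHom K)

/-- `∪^{⊗k} ∈ Hom(2k, 0)`. -/
noncomputable def cupPow (K : Type) [Field K] : (k : ℕ) → Hom K (2 * k) 0
  | 0 => idHom K 0
  | k + 1 => tensor (cupPow K k) (cupHom K)

/-! ### Ideals -/

/-- An ideal of the Temperley–Lieb category over `(K, d)`: a family of vector
subspaces `J m n ⊆ Hom K m n` closed under composition with arbitrary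
morphisms on either side and under tensor product with arbitrary morphisms on
either side. -/
structure IsIdeal (d : K) (J : ∀ m n : ℕ, Set (Hom K m n)) : Prop where
  zero_mem : ∀ m n : ℕ, (0 : Hom K m n) ∈ J m n
  add_mem : ∀ (m n : ℕ), ∀ x ∈ J m n, ∀ y ∈ J m n, x + y ∈ J m n
  smul_mem : ∀ (m n : ℕ) (c : K), ∀ x ∈ J m n, c • x ∈ J m n
  comp_mem_left : ∀ {l m n : ℕ} (b : Hom K m n) (a : Hom K l m),
    a ∈ J l m → comp d b a ∈ J l n
  comp_mem_right : ∀ {l m n : ℕ} (b : Hom K m n) (a : Hom K l m),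
    b ∈ J m n → comp d b a ∈ J l n
  tensor_mem_left : ∀ {m n m' n' : ℕ} (x : Hom K m n) (y : Hom K m' n'),
    x ∈ J m n → tensor x y ∈ J (m + m') (n + n')
  tensor_mem_right : ∀ {m n m' n' : ℕ} (x : Hom K m n) (y : Hom K m' n'),
    y ∈ J m' n' → tensor x y ∈ J (m + m') (n + n')

/-- An ideal is nonzero if some `J m n` contains a nonzero morphism. -/
def IdealNonzero (J : ∀ m n : ℕ, Set (Hom K m n)) : Prop :=
  ∃ (m n : ℕ) (x : Hom K m n), x ∈ J m n ∧ x ≠ 0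

/-- An ideal is proper if it does not contain all morphisms. -/
def IdealProper (J : ∀ m n : ℕ, Set (Hom K m n)) : Prop :=
  ∃ m n : ℕ, J m n ≠ Set.univ

/-- The negligible morphisms: `a ∈ Hom(m,n)` with `Tr_m (b ∘ a) = 0` for all
`b ∈ Hom(n,m)`. -/
def Negl (d : K) (m n : ℕ) : Set (Hom K m n) :=
  {a | ∀ b : Hom K n m, Tr d (comp d b a) = 0}

/-- The ideal generated by a morphism `x ∈ Hom K a b`: the smallest ideal
containing `x`, i.e. the intersection of all ideals containing `x`. -/
def genIdeal (d : K) {a b : ℕ} (x : Hom K a b) (m n : ℕ) : Set (Hom K m n) :=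
  {y | ∀ J : ∀ m' n' : ℕ, Set (Hom K m' n'), IsIdeal d J → x ∈ J a b → y ∈ J m n}

/-! ### Jones–Wenzl idempotents -/

/-- The diagram `E_i ∈ T_n` (here `i` is 0-indexed, `i + 1 < n`): it joins the
`i`-th and `(i+1)`-st top points, the `i`-th and `(i+1)`-st bottom points, and
joins the `j`-th top point vertically to the `j`-th bottom point for all other
`j`; encoded as a pairing function. -/
def eiPair (n i : ℕ) : Fin n ⊕ Fin n → Fin n ⊕ Fin n
  | Sum.inl j =>
      if (j : ℕ) = i then
        Sum.inl ⟨((j : ℕ) + 1) % n, Nat.mod_lt _ (Nat.lt_of_le_of_lt (Nat.zero_le _) j.isLt)⟩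
      else if (j : ℕ) = i + 1 then
        Sum.inl ⟨(j : ℕ) - 1, Nat.lt_of_le_of_lt (Nat.sub_le _ _) j.isLt⟩
      else Sum.inr j
  | Sum.inr j =>
      if (j : ℕ) = i then
        Sum.inr ⟨((j : ℕ) + 1) % n, Nat.mod_lt _ (Nat.lt_of_le_of_lt (Nat.zero_le _) j.isLt)⟩
      else if (j : ℕ) = i + 1 then
        Sum.inr ⟨(j : ℕ) - 1, Nat.lt_of_le_of_lt (Nat.sub_le _ _) j.isLt⟩
      else Sum.inl j

/-- The morphism `E_i ∈ T_n` (0-indexed `i`). -/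
noncomputable def EHom (K : Type) [Field K] (n i : ℕ) : Hom K n n :=
  fun c => if c.pair = eiPair n i then 1 else 0

/-- A Jones–Wenzl idempotent in `T_n`: a nonzero idempotent `p` with
`E_i ∘ p = p ∘ E_i = 0` for all `i` (1-indexed `1 ≤ i ≤ n-1`; here `i` is
0-indexed, so `i + 2 ≤ n`). -/
def IsJonesWenzl (d : K) (n : ℕ) (p : Hom K n n) : Prop :=
  p ≠ 0 ∧ comp d p p = p ∧
    ∀ i : ℕ, i + 2 ≤ n → comp d (EHom K n i) p = 0 ∧ comp d p (EHom K n i) = 0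

/-- The quantum integers `[k] ∈ K`: `[0] = 0`, `[1] = 1`,
`[k+1] = d·[k] − [k−1]`. -/
def qInt (d : K) : ℕ → K
  | 0 => 0
  | 1 => 1
  | k + 2 => d * qInt d (k + 1) - qInt d k

/-! ### Noncrossing matchings and surgery -/

/-- `π` is a noncrossing perfect matching of `P` for the linear order given by `pos`. -/
structure NCInv {P : Type} (pos : P → ℕ) (π : P → P) : Prop where
  invol : ∀ x, π (π x) = x
  ne : ∀ x, π x ≠ x
  nc : ∀ x y, ¬ (pos x < pos y ∧ pos y < pos (π x) ∧ pos (π x) < pos (π y))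

/-- Reconnect a matching so that `u` is matched to `v` (and the former partners with
each other). -/
noncomputable def surg {P : Type} (π : P → P) (u v : P) : P → P := fun x =>
  if x = u then v else if x = v then u else if x = π u then π v else
    if x = π v then π u else π x

/-- The weight of a single arc, recorded at its left end. -/
noncomputable def lw {P : Type} (τ : K) (pos : P → ℕ) (π : P → P) (f : P → Bool) (x : P) : K :=
  if pos x < pos (π x) then (if f x = f (π x) then 0 else if f x then τ else 1) else 1

/-- The weight of a labelling of a matching. -/
noncomputable def Wt {P : Type} [Fintype P] (τ : K) (pos : P → ℕ) (π : P → P) (f : P → Bool) : K :=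
  ∏ x, lw τ pos π f x

theorem NCInv.between {P : Type} {pos : P → ℕ} (hpos : Function.Injective pos) {π : P → P}
    (h : NCInv pos π) (x y : P) (h1 : pos x < pos y) (h2 : pos y < pos (π x)) :
    pos x < pos (π y) ∧ pos (π y) < pos (π x) := by
  have e1 := h.nc x y
  have e2 := h.nc (π y) x
  have e3 : pos (π y) ≠ pos x := fun e => by
    have := hpos e; rw [← this, h.invol] at h2; omega
  have e4 : pos (π y) ≠ pos (π x) := fun e => by
    have := hpos e; have := congrArg π this; rw [h.invol, h.invol] at this; subst this; omega
  rw [h.invol] at e2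
  omega

theorem NCInv.of_between {P : Type} {pos : P → ℕ} {π : P → P} (h1 : ∀ x, π (π x) = x)
    (h2 : ∀ x, π x ≠ x)
    (h : ∀ x y, pos x < pos y → pos y < pos (π x) → pos (π y) < pos (π x)) :
    NCInv pos π :=
  ⟨h1, h2, fun x y ⟨a, b, c⟩ => by have := h x y a b; omega⟩

section Surgery

variable {P : Type} {pos : P → ℕ} {π : P → P} {u v : P}

theorem surg_distinct (h : NCInv pos π) (huv : pos u < pos v) (hne : π u ≠ v)
    : u ≠ v ∧ π u ≠ u ∧ π u ≠ v ∧ π v ≠ u ∧ π v ≠ v ∧ π u ≠ π v := by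
  have huv' : u ≠ v := fun e => by subst e; omega
  refine ⟨huv', h.ne u, hne, fun e => hne (by rw [← e, h.invol]), h.ne v, fun e => huv' ?_⟩
  have := congrArg π e
  rwa [h.invol, h.invol] at this

theorem surg_u : surg π u v u = v := by simp [surg]

theorem surg_v (h : NCInv pos π) (huv : pos u < pos v) (hne : π u ≠ v) : surg π u v v = u := by
  obtain ⟨h1, h2, h3, h4, h5, h6⟩ := surg_distinct h huv hne
  simp [surg, h1.symm]

theorem surg_a (h : NCInv pos π) (huv : pos u < pos v) (hne : π u ≠ v)
    : surg π u v (π u) = π v := by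
  obtain ⟨h1, h2, h3, h4, h5, h6⟩ := surg_distinct h huv hne
  simp [surg, h2, h3]

theorem surg_b (h : NCInv pos π) (huv : pos u < pos v) (hne : π u ≠ v)
    : surg π u v (π v) = π u := by
  obtain ⟨h1, h2, h3, h4, h5, h6⟩ := surg_distinct h huv hne
  simp [surg, h4, h5, h6.symm]

theorem surg_other {x : P} (h1 : x ≠ u) (h2 : x ≠ v) (h3 : x ≠ π u) (h4 : x ≠ π v) :
    surg π u v x = π x := by
  simp [surg, h1, h2, h3, h4]

theorem other_image (h : NCInv pos π)
    {x : P} (h1 : x ≠ u) (h2 : x ≠ v) (h3 : x ≠ π u) (h4 : x ≠ π v) :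
    π x ≠ u ∧ π x ≠ v ∧ π x ≠ π u ∧ π x ≠ π v := by
  have inj : Function.Injective π := fun a b e => by
    have := congrArg π e; rwa [h.invol, h.invol] at this
  exact ⟨fun e => h3 (by rw [← e, h.invol]), fun e => h4 (by rw [← e, h.invol]),
    fun e => h1 (inj e), fun e => h2 (inj e)⟩

theorem surg_cases (h : NCInv pos π) (huv : pos u < pos v) (hne : π u ≠ v)
    {Q : P → P → Prop} (h1 : Q u v) (h2 : Q v u) (h3 : Q (π u) (π v))
    (h4 : Q (π v) (π u)) (h5 : ∀ x, x ≠ u → x ≠ v → x ≠ π u → x ≠ π v → Q x (π x)) (x : P) :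
    Q x (surg π u v x) := by
  by_cases e1 : x = u
  · subst e1; rwa [surg_u]
  by_cases e2 : x = v
  · subst e2; rwa [surg_v h huv hne]
  by_cases e3 : x = π u
  · subst e3; rwa [surg_a h huv hne]
  by_cases e4 : x = π v
  · subst e4; rwa [surg_b h huv hne]
  rw [surg_other e1 e2 e3 e4]; exact h5 x e1 e2 e3 e4

theorem surg_outside (hpos : Function.Injective pos) (h : NCInv pos π) (huv : pos u < pos v)
    (hne : π u ≠ v)
    (hb : ∀ x, pos u < pos x → pos x < pos v → pos u < pos (π x) ∧ pos (π x) < pos v) :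
    (pos (π u) < pos u ∨ pos v < pos (π u)) ∧ (pos (π v) < pos u ∨ pos v < pos (π v)) := by
  obtain ⟨h1, h2, h3, h4, h5, h6⟩ := surg_distinct h huv hne
  have a1 := hb (π u)
  have a2 := hb (π v)
  rw [h.invol] at a1 a2
  have b1 := hpos.ne h2
  have b2 := hpos.ne h3
  have b3 := hpos.ne h4
  have b4 := hpos.ne h5
  omega

theorem surg_nc (hpos : Function.Injective pos) (h : NCInv pos π) (huv : pos u < pos v)
    (hne : π u ≠ v)
    (hb : ∀ x, pos u < pos x → pos x < pos v → pos u < pos (π x) ∧ pos (π x) < pos v)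
    : NCInv pos (surg π u v) := by
  obtain ⟨h1, h2, h3, h4, h5, h6⟩ := surg_distinct h huv hne
  obtain ⟨o1, o2⟩ := surg_outside hpos h huv hne hb
  refine NCInv.of_between ?_ ?_ ?_
  · refine surg_cases h huv hne (Q := fun x y => surg π u v y = x) ?_ ?_ ?_ ?_ ?_
    · exact surg_v h huv hne
    · exact surg_u
    · exact surg_b h huv hne
    · exact surg_a h huv hne
    · intro x e1 e2 e3 e4
      obtain ⟨g1, g2, g3, g4⟩ := other_image h e1 e2 e3 e4
      rw [surg_other g1 g2 g3 g4, h.invol]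
  · exact surg_cases h huv hne (Q := fun x y => y ≠ x) h1.symm h1 h6.symm h6
      (fun x _ _ _ _ => h.ne x)
  · have key := h.between hpos
    have ku := key u
    have kv := key v
    have ka := key (π u)
    have kb := key (π v)
    rw [h.invol] at ka kb
    have vu := ku v
    have vb := ku (π v)
    have av := ka v
    have ab := ka (π v)
    have uv := kv u
    have ua := kv (π u)
    have bu := kb u
    have ba := kb (π u)
    rw [h.invol] at vb ab ua ba
    have p1 := hpos.ne h1
    have p2 := hpos.ne h2
    have p3 := hpos.ne h3
    have p4 := hpos.ne h4
    have p5 := hpos.ne h5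
    have p6 := hpos.ne h6
    intro x y
    revert y
    refine surg_cases h huv hne (Q := fun x y => ∀ z, pos x < pos z → pos z < pos y →
      pos (surg π u v z) < pos y) ?_ ?_ ?_ ?_ ?_ x
    · refine surg_cases h huv hne (Q := fun x y => pos u < pos x → pos x < pos v → pos y < pos v)
        ?_ ?_ ?_ ?_ ?_
      · omega
      · omega
      · omega
      · omega
      · intro z e1 e2 e3 e4
        have := hb z; omega
    · omega
    · refine surg_cases h huv hne (Q := fun x y => pos (π u) < pos x → pos x < pos (π v) →
        pos y < pos (π v)) ?_ ?_ ?_ ?_ ?_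
      · omega
      · omega
      · omega
      · omega
      · intro z e1 e2 e3 e4
        have := hb z
        have := hb (π z)
        obtain ⟨g1, g2, g3, g4⟩ := other_image h e1 e2 e3 e4
        have := hpos.ne e1
        have := hpos.ne e2
        have := hpos.ne e3
        have := hpos.ne e4
        have := hpos.ne g1
        have := hpos.ne g2
        have := hpos.ne g3
        have := hpos.ne g4
        have := ku z
        have := kv z
        have := ka z
        have := kb z
        have m1 := ku (π z)
        have m2 := kv (π z)
        have m3 := ka (π z)
        have m4 := kb (π z)
        rw [h.invol] at *
        omega
    · refine surg_cases h huv hne (Q := fun x y => pos (π v) < pos x → pos x < pos (π u) →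
        pos y < pos (π u)) ?_ ?_ ?_ ?_ ?_
      · omega
      · omega
      · omega
      · omega
      · intro z e1 e2 e3 e4
        have := hb z
        have := hb (π z)
        obtain ⟨g1, g2, g3, g4⟩ := other_image h e1 e2 e3 e4
        have := hpos.ne e1
        have := hpos.ne e2
        have := hpos.ne e3
        have := hpos.ne e4
        have := hpos.ne g1
        have := hpos.ne g2
        have := hpos.ne g3
        have := hpos.ne g4
        have := ku z
        have := kv z
        have := ka z
        have := kb z
        have m1 := ku (π z)
        have m2 := kv (π z)
        have m3 := ka (π z)
        have m4 := kb (π z)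
        rw [h.invol] at *
        omega
    · intro x f1 f2 f3 f4
      have kx := key x
      have kx' := key (π x)
      rw [h.invol] at kx'
      have q1 := kx u
      have q2 := kx v
      have q3 := kx (π u)
      have q4 := kx (π v)
      rw [h.invol] at q3 q4
      have := hb x
      have hbx := hb (π x)
      rw [h.invol] at hbx
      obtain ⟨g1, g2, g3, g4⟩ := other_image h f1 f2 f3 f4
      have := hpos.ne f1
      have := hpos.ne f2
      have := hpos.ne f3
      have := hpos.ne f4
      have := hpos.ne g1
      have := hpos.ne g2
      have := hpos.ne g3
      have := hpos.ne g4
      refine surg_cases h huv hne (Q := fun z y => pos x < pos z → pos z < pos (π x) →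
        pos y < pos (π x)) ?_ ?_ ?_ ?_ ?_
      · omega
      · omega
      · omega
      · omega
      · intro z _ _ _ _
        have := kx z; omega
end Surgery

section SurgeryWeight

variable {P : Type} {pos : P → ℕ} {π : P → P} {u v : P}

theorem prod_four [Fintype P] {u v a b : P} (h1 : u ≠ v) (h2 : a ≠ u) (h3 : a ≠ v)
    (h4 : b ≠ u) (h5 : b ≠ v) (h6 : a ≠ b) (F : P → K) :
    ∏ x, F x = (F u * F v * F a * F b) * ∏ x ∈ ({u, v, a, b} : Finset P)ᶜ, F x := by
  rw [← Finset.prod_mul_prod_compl ({u, v, a, b} : Finset P)]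
  congr 1
  rw [Finset.prod_insert, Finset.prod_insert, Finset.prod_insert, Finset.prod_singleton]
  · ring
  all_goals simp [h1, h2.symm, h3.symm, h4.symm, h5.symm, h6]

theorem Wt_surg (hpos : Function.Injective pos) (h : NCInv pos π) (huv : pos u < pos v)
    (hne : π u ≠ v)
    (hb : ∀ x, pos u < pos x → pos x < pos v → pos u < pos (π x) ∧ pos (π x) < pos v)
    [Fintype P] (τ : K) (hτ : τ ≠ 0) (f f₁ : P → Bool)
    (hf : ∀ x, x ≠ u → x ≠ v → f₁ x = f x)
    (fu : f u = true) (fv : f v = false) (gu : f₁ u = false) (gv : f₁ v = true) :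
    Wt τ pos (surg π u v) f + τ⁻¹ * Wt τ pos (surg π u v) f₁ =
      (τ + τ⁻¹) * (Wt τ pos π f + τ⁻¹ * Wt τ pos π f₁) := by
  obtain ⟨h1, h2, h3, h4, h5, h6⟩ := surg_distinct h huv hne
  obtain ⟨o1, o2⟩ := surg_outside hpos h huv hne hb
  unfold Wt
  rw [prod_four h1 h2 h3 h4 h5 h6 (lw τ pos (surg π u v) f),
    prod_four h1 h2 h3 h4 h5 h6 (lw τ pos (surg π u v) f₁),
    prod_four h1 h2 h3 h4 h5 h6 (lw τ pos π f),
    prod_four h1 h2 h3 h4 h5 h6 (lw τ pos π f₁)]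
  have r : ∀ x ∈ ({u, v, π u, π v} : Finset P)ᶜ, lw τ pos (surg π u v) f x = lw τ pos π f x ∧
      lw τ pos (surg π u v) f₁ x = lw τ pos π f x ∧ lw τ pos π f₁ x = lw τ pos π f x := by
    intro x hx
    simp only [Finset.mem_compl, Finset.mem_insert, Finset.mem_singleton, not_or] at hx
    obtain ⟨e1, e2, e3, e4⟩ := hx
    obtain ⟨g1, g2, g3, g4⟩ := other_image h e1 e2 e3 e4
    simp only [lw, surg_other e1 e2 e3 e4, hf x e1 e2, hf _ g1 g2, and_self]
  rw [Finset.prod_congr rfl fun x hx => (r x hx).1,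
    Finset.prod_congr rfl fun x hx => (r x hx).2.1,
    Finset.prod_congr rfl fun x hx => (r x hx).2.2]
  generalize ∏ x ∈ ({u, v, π u, π v} : Finset P)ᶜ, lw τ pos π f x = R
  have n6 := hpos.ne h6
  have c : (pos (π u) < pos u ∧ pos v < pos (π v)) ∨
      (pos (π v) < pos (π u) ∧ pos (π u) < pos u) ∨
      (pos v < pos (π v) ∧ pos (π v) < pos (π u)) := by
    have a1 := h.nc u v
    have a5 := h.nc (π v) u
    have a8 := h.nc (π u) (π v)
    simp only [h.invol] at a1 a5 a8
    rcases o1 with o1 | o1 <;> rcases o2 with o2 | o2 <;> omega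
  simp only [lw, surg_u, surg_v h huv hne, surg_a h huv hne, surg_b h huv hne, h.invol, fu, fv, gu,
    gv, hf _ h2 h3, hf _ h4 h5]
  generalize pos u = pu at *
  generalize pos v = pv at *
  generalize pos (π u) = pa at *
  generalize pos (π v) = pb at *
  have hh : τ * τ⁻¹ = 1 := mul_inv_cancel₀ hτ
  generalize τ⁻¹ = σ at *
  have huv' : ¬ pv < pu := by omega
  clear n6 o1 o2 r hb
  rcases c with c | c | c
  · have q0 : pa < pb := by omega
    have q1 : ¬ pb < pa := by omega
    have q2 : pa < pu := by omega
    have q3 : ¬ pu < pa := by omega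
    have q4 : ¬ pb < pv := by omega
    have q5 : pv < pb := by omega
    simp only [huv, huv', q0, q1, q2, q3, q4, q5, if_true, if_false]
    cases f (π u) <;> cases f (π v) <;> simp <;> grind
  · have q0 : ¬ pa < pb := by omega
    have q1 : pb < pa := by omega
    have q2 : pa < pu := by omega
    have q3 : ¬ pu < pa := by omega
    have q4 : pb < pv := by omega
    have q5 : ¬ pv < pb := by omega
    simp only [huv, huv', q0, q1, q2, q3, q4, q5, if_true, if_false]
    cases f (π u) <;> cases f (π v) <;> simp <;> grind
  · have q0 : ¬ pa < pb := by omega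
    have q1 : pb < pa := by omega
    have q2 : ¬ pa < pu := by omega
    have q3 : pu < pa := by omega
    have q4 : ¬ pb < pv := by omega
    have q5 : pv < pb := by omega
    simp only [huv, huv', q0, q1, q2, q3, q4, q5, if_true, if_false]
    cases f (π u) <;> cases f (π v) <;> simp <;> grind
end SurgeryWeight

section Connectivity

/-- The equivalence classes of `r` that are contained in `M`. -/
def classesIn {X : Type} (r : X → X → Prop) (M : Set X) : Set (Set X) :=
  {S | ∃ x, S = {y | r x y} ∧ S ⊆ M}

/-- The number of equivalence classes of `r` contained in `M`. -/
noncomputable def classCount {X : Type} (r : X → X → Prop) (M : Set X) : ℕ := (classesIn r M).ncard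

theorem classCount_isolate {X : Type} [Finite X] {r r' : X → X → Prop} (hr : Equivalence r)
    (hr' : Equivalence r') {z a : X} {M : Set X} (hz : z ∈ M) (h1 : ∀ x y, r' x y → r x y)
    (h2 : ∀ x y, x ≠ z → y ≠ z → r x y → r' x y) (h3 : ∀ y, r' z y → y = z)
    (ha : a ≠ z) (hza : r z a) : classCount r' M = classCount r M + 1 := by
  have cl : ∀ x, x ≠ z → {y | r' x y} = {y | r x y} \ {z} := by
    intro x hx
    ext y
    simp only [Set.mem_ofPred_eq, Set.mem_sdiff, Set.mem_singleton_iff]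
    constructor
    · intro h
      refine ⟨h1 _ _ h, fun e => hx ?_⟩
      subst e
      exact h3 _ (hr'.symm h)
    · rintro ⟨h, hy⟩
      exact h2 _ _ hx hy h
  have rep : ∀ x, ∃ x', x' ≠ z ∧ r x x' := by
    intro x
    by_cases hx : x = z
    · subst hx; exact ⟨a, ha, hza⟩
    · exact ⟨x, hx, hr.refl x⟩
  have cle : ∀ x x', r x x' → {y | r x y} = {y | r x' y} := by
    intro x x' h
    ext y
    exact ⟨fun g => hr.trans (hr.symm h) g, fun g => hr.trans h g⟩
  have e : classesIn r' M = insert {z} ((fun S : Set X => S \ {z}) '' classesIn r M) := by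
    ext S
    constructor
    · rintro ⟨x, rfl, hS⟩
      by_cases hx : x = z
      · subst hx
        left
        ext y
        simp only [Set.mem_ofPred_eq, Set.mem_singleton_iff]
        exact ⟨fun h => h3 y h, fun h => h ▸ hr'.refl _⟩
      · right
        refine ⟨{y | r x y}, ⟨x, rfl, ?_⟩, (cl x hx).symm⟩
        intro y hy
        by_cases e : y = z
        · subst e; exact hz
        · apply hS
          rw [cl x hx]
          exact ⟨hy, e⟩
    · rintro (rfl | ⟨_, ⟨x, rfl, hS⟩, rfl⟩)
      · refine ⟨z, ?_, by simpa using hz⟩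
        ext y
        simp only [Set.mem_ofPred_eq, Set.mem_singleton_iff]
        exact ⟨fun h => h ▸ hr'.refl _, fun h => h3 y h⟩
      · obtain ⟨x', hx', hxx⟩ := rep x
        refine ⟨x', ?_, fun y hy => hS hy.1⟩
        rw [cl x' hx', cle x x' hxx]
  unfold classCount
  rw [e, Set.ncard_insert_of_notMem, Set.InjOn.ncard_image]
  · rintro S ⟨x, rfl, _⟩ T ⟨y, rfl, _⟩ hST
    obtain ⟨x', hx', hxx⟩ := rep x
    have : x' ∈ {y' | r y y'} \ {z} := by
      rw [← show _ = {y' | r y y'} \ {z} from hST]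
      exact ⟨hxx, hx'⟩
    exact (cle x x' hxx).trans (cle y x' this.1).symm
  · rintro ⟨S, _, hS⟩
    have : z ∈ S \ {z} := by rw [show S \ {z} = {z} from hS]; rfl
    exact this.2 rfl

/-- Two points of `X` are related if an arc of `π` joins points above them. -/
def StepR {P X : Type} (pr : P → X) (π : P → P) (x y : X) : Prop := ∃ p, pr p = x ∧ pr (π p) = y

/-- Connectivity of the picture obtained from the matching `π` by gluing along `pr`. -/
def ConnR {P X : Type} (pr : P → X) (π : P → P) : X → X → Prop := Relation.EqvGen (StepR pr π)

theorem eqvGen_equiv {X : Type} (r : X → X → Prop) : Equivalence (Relation.EqvGen r) :=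
  ⟨fun _ => .refl _, fun h => .symm _ _ h, fun h g => .trans _ _ _ h g⟩

theorem eqvGen_lift {X Y : Type} {r : X → X → Prop} {s : Y → Y → Prop} (hs : Equivalence s)
    (f : X → Y) (h : ∀ x y, r x y → s (f x) (f y)) {x y : X} (hxy : Relation.EqvGen r x y) :
    s (f x) (f y) := by
  induction hxy with
  | rel x y g => exact h x y g
  | refl x => exact hs.refl _
  | symm x y _ ih => exact hs.symm ih
  | trans x y z _ _ ih1 ih2 => exact hs.trans ih1 ih2

theorem connR_equiv {P X : Type} (pr : P → X) (π : P → P) : Equivalence (ConnR pr π) :=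
  eqvGen_equiv _

theorem connR_step {P X : Type} (pr : P → X) (π : P → P) (p : P) : ConnR pr π (pr p) (pr (π p)) :=
  .rel _ _ ⟨p, rfl, rfl⟩

variable {P X : Type} {pos : P → ℕ} {π : P → P} {u v : P} {pr : P → X}

theorem connR_surg_le (h : NCInv pos π) (huv : pos u < pos v) (hne : π u ≠ v) (hpr : pr u = pr v)
    (x y : X) (hxy : ConnR pr (surg π u v) x y) : ConnR pr π x y := by
  have E := connR_equiv pr π
  refine eqvGen_lift E id ?_ hxy
  rintro x y ⟨p, rfl, rfl⟩
  refine surg_cases h huv hne (Q := fun p q => ConnR pr π (pr p) (pr q)) ?_ ?_ ?_ ?_ ?_ p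
  · rw [hpr]; exact E.refl _
  · rw [hpr]; exact E.refl _
  · exact E.trans (E.symm (connR_step pr π u)) (hpr ▸ connR_step pr π v)
  · exact E.trans (E.symm (connR_step pr π v)) (hpr ▸ connR_step pr π u)
  · intro x _ _ _ _; exact connR_step pr π x

theorem connR_surg_of_ne (h : NCInv pos π) (huv : pos u < pos v) (hne : π u ≠ v) (hpr : pr u = pr v)
    (hz : ∀ p, pr p = pr v → p = u ∨ p = v)
    (x y : X) (hx : x ≠ pr v) (hy : y ≠ pr v) (hxy : ConnR pr π x y) :
    ConnR pr (surg π u v) x y := by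
  obtain ⟨h1, h2, h3, h4, h5, h6⟩ := surg_distinct h huv hne
  have E := connR_equiv pr (surg π u v)
  have n : ∀ p, p ≠ u → p ≠ v → pr p ≠ pr v := fun p a b c => (hz p c).elim a b
  have key := eqvGen_lift E (fun x => if x = pr v then pr (π u) else x) ?_ hxy
  · simpa [hx, hy] using key
  rintro _ _ ⟨p, rfl, rfl⟩
  have sa : ConnR pr (surg π u v) (pr (π u)) (pr (π v)) := by
    have := connR_step pr (surg π u v) (π u)
    rwa [surg_a h huv hne] at this
  by_cases e1 : p = u
  · subst e1
    simp only [hpr, if_true, n _ h2 h3, if_false]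
    exact E.refl _
  by_cases e2 : p = v
  · subst e2
    simp only [if_true, n _ h4 h5, if_false]
    exact sa
  by_cases e3 : p = π u
  · subst e3
    simp only [h.invol, hpr, if_true, n _ h2 h3, if_false]
    exact E.refl _
  by_cases e4 : p = π v
  · subst e4
    simp only [h.invol, if_true, n _ h4 h5, if_false]
    exact E.symm sa
  obtain ⟨g1, g2, g3, g4⟩ := other_image h e1 e2 e3 e4
  simp only [n _ e1 e2, n _ g1 g2, if_false]
  have := connR_step pr (surg π u v) p
  rwa [surg_other e1 e2 e3 e4] at this

theorem connR_surg_isolated (h : NCInv pos π) (huv : pos u < pos v) (hne : π u ≠ v)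
    (hpr : pr u = pr v) (hz : ∀ p, pr p = pr v → p = u ∨ p = v)
    (y : X) (hxy : ConnR pr (surg π u v) (pr v) y) : y = pr v := by
  obtain ⟨h1, h2, h3, h4, h5, h6⟩ := surg_distinct h huv hne
  have n : ∀ p, p ≠ u → p ≠ v → pr p ≠ pr v := fun p a b c => (hz p c).elim a b
  have key : (pr v = pr v) = (y = pr v) := eqvGen_lift (s := Eq) ⟨fun _ => rfl, Eq.symm, Eq.trans⟩
    (fun x => x = pr v) ?_ hxy
  · exact key ▸ rfl
  rintro _ _ ⟨p, rfl, rfl⟩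
  refine surg_cases h huv hne (Q := fun p q => (pr p = pr v) = (pr q = pr v)) ?_ ?_ ?_ ?_ ?_ p
  · simp [hpr]
  · simp [hpr]
  · simp [n _ h2 h3, n _ h4 h5]
  · simp [n _ h2 h3, n _ h4 h5]
  · intro x e1 e2 e3 e4
    obtain ⟨g1, g2, g3, g4⟩ := other_image h e1 e2 e3 e4
    simp [n _ e1 e2, n _ g1 g2]

theorem classCount_surg (h : NCInv pos π) (huv : pos u < pos v) (hne : π u ≠ v) (hpr : pr u = pr v)
    (hz : ∀ p, pr p = pr v → p = u ∨ p = v) [Finite X] {M : Set X} (hM : pr v ∈ M) :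
    classCount (ConnR pr (surg π u v)) M = classCount (ConnR pr π) M + 1 := by
  obtain ⟨h1, h2, h3, h4, h5, h6⟩ := surg_distinct h huv hne
  exact classCount_isolate (connR_equiv _ _) (connR_equiv _ _) hM (connR_surg_le h huv hne hpr)
    (connR_surg_of_ne h huv hne hpr hz) (connR_surg_isolated h huv hne hpr hz)
    (a := pr (π u)) (fun c => (hz _ c).elim h2 h3) (hpr ▸ connR_step pr π u)
end Connectivity

section Gluing

/-- The data of a picture in which the points `u i` and `v i` are to be glued, while the
points `o x` remain as outer points. -/
structure Gluing {P X O : Type} {m : ℕ} (pos : P → ℕ) (pr : P → X) (u v : Fin m → P) (o : O → P) :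
    Prop where
  pos_inj : Function.Injective pos
  bij : Function.Bijective (Sum.elim o (Sum.elim u v))
  lt : ∀ i, pos (u i) < pos (v i)
  nest : ∀ i j, j < i → pos (u i) < pos (u j) ∧ pos (v j) < pos (v i)
  between : ∀ i p, pos (u i) < pos p → pos p < pos (v i) → ∃ j, j < i ∧ (p = u j ∨ p = v j)
  glued : ∀ i, pr (u i) = pr (v i)
  fib : ∀ i p, pr p = pr (v i) → p = u i ∨ p = v i
  fib_outer : ∀ x p, pr p = pr (o x) → p = o x

/-- The partition function of a picture, summing over the labels of the glued points. -/
noncomputable def glueSum {P : Type} [Fintype P] {m : ℕ} (τ : K) (pos : P → ℕ) (π : P → P)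
    (lab : (Fin m → Bool) → P → Bool) : K :=
  ∑ g : Fin m → Bool, (∏ i, if g i then 1 else τ⁻¹) * Wt τ pos π (lab g)

variable {P X O : Type} {m : ℕ} {pos : P → ℕ} {pr : P → X} {u v : Fin m → P} {o : O → P}

theorem Gluing.u_inj (G : Gluing pos pr u v o) : Function.Injective u := fun i j e => by
  have := G.bij.1 (a₁ := Sum.inr (Sum.inl i)) (a₂ := Sum.inr (Sum.inl j)) e
  simpa using this

theorem Gluing.v_inj (G : Gluing pos pr u v o) : Function.Injective v := fun i j e => by
  have := G.bij.1 (a₁ := Sum.inr (Sum.inr i)) (a₂ := Sum.inr (Sum.inr j)) e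
  simpa using this

theorem Gluing.o_inj (G : Gluing pos pr u v o) : Function.Injective o := fun i j e => by
  have := G.bij.1 (a₁ := Sum.inl i) (a₂ := Sum.inl j) e
  simpa using this

theorem Gluing.u_ne_v (G : Gluing pos pr u v o) (i j) : u i ≠ v j := fun e => by
  have := G.bij.1 (a₁ := Sum.inr (Sum.inl i)) (a₂ := Sum.inr (Sum.inr j)) e
  simp at this

theorem Gluing.o_ne_u (G : Gluing pos pr u v o) (x i) : o x ≠ u i := fun e => by
  have := G.bij.1 (a₁ := Sum.inl x) (a₂ := Sum.inr (Sum.inl i)) e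
  simp at this

theorem Gluing.o_ne_v (G : Gluing pos pr u v o) (x i) : o x ≠ v i := fun e => by
  have := G.bij.1 (a₁ := Sum.inl x) (a₂ := Sum.inr (Sum.inr i)) e
  simp at this

theorem Gluing.cases (G : Gluing pos pr u v o)
    (p : P) : (∃ x, p = o x) ∨ (∃ i, p = u i) ∨ ∃ i, p = v i := by
  obtain ⟨x | i | i, rfl⟩ := G.bij.2 p
  · exact .inl ⟨x, rfl⟩
  · exact .inr (.inl ⟨i, rfl⟩)
  · exact .inr (.inr ⟨i, rfl⟩)

theorem glueSum_surg (G : Gluing pos pr u v o)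
    [Fintype P] [CharZero K] {τ : K} (hτ : τ ≠ 0) {π : P → P} (h : NCInv pos π)
    (k : Fin m) (hne : π (u k) ≠ v k)
    (hb : ∀ x, pos (u k) < pos x → pos x < pos (v k) →
      pos (u k) < pos (π x) ∧ pos (π x) < pos (v k))
    (f : O → Bool) (lab : (Fin m → Bool) → P → Bool) (lu : ∀ g i, lab g (u i) = g i)
    (lv : ∀ g i, lab g (v i) = !g i) (lo : ∀ g x, lab g (o x) = f x) :
    glueSum τ pos (surg π (u k) (v k)) lab = (τ + τ⁻¹) * glueSum τ pos π lab := by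
  have inv : Function.Involutive (fun g : Fin m → Bool => Function.update g k (!g k)) := by
    intro g; simp
  have flip : ∀ F : (Fin m → Bool) → K,
      2 * ∑ g, F g = ∑ g, (F g + F (Function.update g k (!g k))) := by
    intro F
    rw [Finset.sum_add_distrib, two_mul]
    congr 1
    exact (Equiv.sum_comp inv.toPerm F).symm
  have key : ∀ g : Fin m → Bool, g k = true → ∀ π' : P → P,
      (∏ i, if g i then 1 else τ⁻¹) * Wt τ pos π' (lab g) +
      (∏ i, if (Function.update g k false) i then 1 else τ⁻¹) *
        Wt τ pos π' (lab (Function.update g k false)) =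
      (∏ i ∈ {k}ᶜ, if g i then 1 else τ⁻¹) * (Wt τ pos π' (lab g) +
        τ⁻¹ * Wt τ pos π' (lab (Function.update g k false))) := by
    intro g hg π'
    rw [Fintype.prod_eq_mul_prod_compl k, Fintype.prod_eq_mul_prod_compl k]
    have : ∏ i ∈ {k}ᶜ, (if (Function.update g k false) i then (1 : K) else τ⁻¹) =
        ∏ i ∈ {k}ᶜ, if g i then 1 else τ⁻¹ := by
      refine Finset.prod_congr rfl fun i hi => ?_
      have : i ≠ k := by simpa using hi
      rw [Function.update_of_ne this]
    rw [this]
    simp [hg]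
    ring
  have key2 : ∀ g : Fin m → Bool, g k = true →
      (∏ i, if g i then 1 else τ⁻¹) * Wt τ pos (surg π (u k) (v k)) (lab g) +
      (∏ i, if (Function.update g k false) i then 1 else τ⁻¹) *
        Wt τ pos (surg π (u k) (v k)) (lab (Function.update g k false)) =
      (τ + τ⁻¹) * ((∏ i, if g i then 1 else τ⁻¹) * Wt τ pos π (lab g) +
      (∏ i, if (Function.update g k false) i then 1 else τ⁻¹) *
        Wt τ pos π (lab (Function.update g k false))) := by
    intro g hg
    rw [key g hg, key g hg, Wt_surg G.pos_inj h (G.lt k) hne hb τ hτ]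
    · ring
    · intro x hxu hxv
      rcases G.cases x with ⟨y, rfl⟩ | ⟨i, rfl⟩ | ⟨i, rfl⟩
      · rw [lo, lo]
      · rw [lu, lu, Function.update_of_ne fun e => hxu (congrArg u e)]
      · rw [lv, lv, Function.update_of_ne fun e => hxv (congrArg v e)]
    · rw [lu, hg]
    · rw [lv, hg]; rfl
    · rw [lu]; simp
    · rw [lv]; simp
  have two : (2 : K) ≠ 0 := two_ne_zero
  apply mul_left_cancel₀ two
  rw [mul_left_comm]
  unfold glueSum
  rw [flip, flip, Finset.mul_sum]
  refine Finset.sum_congr rfl fun g _ => ?_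
  by_cases hg : g k = true
  · have := key2 g hg
    simpa [hg] using this
  · have hg' : g k = false := by simpa using hg
    have := key2 (Function.update g k true) (by simp)
    have e : Function.update g k false = g := by rw [← hg']; simp
    simp only [Function.update_idem, e] at this
    simp only [hg', Bool.not_false]
    rw [add_comm, this]
    ring

theorem exists_glued_upto (G : Gluing pos pr u v o)
    [Fintype P] [Finite X] [CharZero K] {τ : K} (hτ : τ ≠ 0) {π : P → P}
    (h : NCInv pos π) (k : ℕ) (hk : k ≤ m) :
    ∃ ρ : P → P, NCInv pos ρ ∧ (∀ i : Fin m, (i : ℕ) < k → ρ (u i) = v i) ∧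
      (∀ x y, ConnR pr π (pr (o x)) (pr (o y)) ↔ ConnR pr ρ (pr (o x)) (pr (o y))) ∧
      ∀ (f : O → Bool) (lab : (Fin m → Bool) → P → Bool), (∀ g i, lab g (u i) = g i) →
        (∀ g i, lab g (v i) = !g i) → (∀ g x, lab g (o x) = f x) →
        glueSum τ pos π lab * (τ + τ⁻¹) ^ classCount (ConnR pr ρ) (Set.range fun i => pr (v i)) =
          glueSum τ pos ρ lab *
            (τ + τ⁻¹) ^ classCount (ConnR pr π) (Set.range fun i => pr (v i)) := by
  induction k with
  | zero => exact ⟨π, h, by simp, fun _ _ => Iff.rfl, fun _ _ _ _ _ => rfl⟩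
  | succ k ih =>
    obtain ⟨ρ, hρ, h1, h2, h3⟩ := ih (by omega)
    let k' : Fin m := ⟨k, hk⟩
    by_cases hne : ρ (u k') = v k'
    · refine ⟨ρ, hρ, fun i hi => ?_, h2, h3⟩
      rcases Nat.lt_succ_iff_lt_or_eq.1 hi with hi | hi
      · exact h1 i hi
      · rw [show i = k' from Fin.ext hi, hne]
    · have hb : ∀ x, pos (u k') < pos x → pos x < pos (v k') →
          pos (u k') < pos (ρ x) ∧ pos (ρ x) < pos (v k') := by
        intro x a b
        obtain ⟨j, hj, rfl | rfl⟩ := G.between k' x a b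
        · rw [h1 j hj]
          have := G.nest k' j hj
          have := G.lt j
          omega
        · rw [← h1 j hj, hρ.invol]
          have := G.nest k' j hj
          have := G.lt j
          omega
      have hno : ∀ x, pr (o x) ≠ pr (v k') := fun x e => G.o_ne_v x k' (G.fib_outer x _ e.symm).symm
      refine ⟨surg ρ (u k') (v k'), surg_nc G.pos_inj hρ (G.lt k') hne hb, fun i hi => ?_,
        fun x y => ?_, fun f lab lu lv lo => ?_⟩
      · rcases Nat.lt_succ_iff_lt_or_eq.1 hi with hi | hi
        · rw [surg_other, h1 i hi]
          · exact fun e => by have := G.u_inj e; subst this; simp [k'] at hi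
          · exact G.u_ne_v _ _
          · intro e
            have := h1 i hi
            rw [e, hρ.invol] at this
            exact G.u_ne_v _ _ this
          · intro e
            have := h1 i hi
            rw [e, hρ.invol] at this
            have := G.v_inj this; subst this; simp [k'] at hi
        · rw [show i = k' from Fin.ext hi, surg_u]
      · rw [h2]
        exact ⟨connR_surg_of_ne hρ (G.lt k') hne (G.glued k') (G.fib k') _ _ (hno x) (hno y),
          connR_surg_le hρ (G.lt k') hne (G.glued k') _ _⟩
      · rw [classCount_surg hρ (G.lt k') hne (G.glued k') (G.fib k') (Set.mem_range_self (f := fun i => pr (v i)) k'),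
          glueSum_surg G hτ hρ k' hne hb f lab lu lv lo, pow_succ, ← mul_assoc,
          h3 f lab lu lv lo]
        ring

section Final

variable {ρ : P → P}

theorem glued_isolated (G : Gluing pos pr u v o) (hρ : NCInv pos ρ) (h1 : ∀ i, ρ (u i) = v i)
    (i : Fin m) (y : X) (hy : ConnR pr ρ (pr (v i)) y) : y = pr (v i) := by
  have key : (pr (v i) = pr (v i)) = (y = pr (v i)) := eqvGen_lift (s := Eq)
    ⟨fun _ => rfl, Eq.symm, Eq.trans⟩ (fun x => x = pr (v i)) ?_ hy
  · exact key ▸ rfl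
  have aux : ∀ p, pr p = pr (v i) → pr (ρ p) = pr (v i) := by
    intro p e
    rcases G.fib i p e with rfl | rfl
    · rw [h1]
    · rw [← h1, hρ.invol, G.glued, h1]
  rintro _ _ ⟨p, rfl, rfl⟩
  refine propext ⟨aux p, fun e => ?_⟩
  have := aux _ e
  rwa [hρ.invol] at this

theorem glued_classCount (G : Gluing pos pr u v o) (hρ : NCInv pos ρ) (h1 : ∀ i, ρ (u i) = v i)
    : classCount (ConnR pr ρ) (Set.range fun i => pr (v i)) = m := by
  have inj : Function.Injective fun i => ({pr (v i)} : Set X) := by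
    intro i j e
    have e' : pr (v i) = pr (v j) := by simpa using e
    rcases G.fib j _ e' with e'' | e''
    · exact absurd e''.symm (G.u_ne_v _ _)
    · exact G.v_inj e''
  have : classesIn (ConnR pr ρ) (Set.range fun i => pr (v i)) =
      (fun i => ({pr (v i)} : Set X)) '' Set.univ := by
    ext S
    constructor
    · rintro ⟨x, rfl, hS⟩
      obtain ⟨i, rfl⟩ := hS ((connR_equiv pr ρ).refl x)
      refine ⟨i, trivial, ?_⟩
      ext y
      exact ⟨fun e => (show y = pr (v i) from e) ▸ (connR_equiv pr ρ).refl _,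
        fun e => glued_isolated G hρ h1 i y e⟩
    · rintro ⟨i, _, rfl⟩
      refine ⟨pr (v i), ?_, by rintro _ rfl; exact ⟨i, rfl⟩⟩
      ext y
      exact ⟨fun e => (show y = pr (v i) from e) ▸ (connR_equiv pr ρ).refl _,
        fun e => glued_isolated G hρ h1 i y e⟩
  rw [classCount, this, Set.ncard_image_of_injective _ inj, Set.ncard_univ, Nat.card_eq_fintype_card,
    Fintype.card_fin]

theorem glued_outer (G : Gluing pos pr u v o) (hρ : NCInv pos ρ) (h1 : ∀ i, ρ (u i) = v i)
    : ∃ σ : O → O, (∀ x, ρ (o x) = o (σ x)) ∧ NCInv (pos ∘ o) σ := by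
  have : ∀ x, ∃ y, ρ (o x) = o y := by
    intro x
    rcases G.cases (ρ (o x)) with ⟨y, e⟩ | ⟨i, e⟩ | ⟨i, e⟩
    · exact ⟨y, e⟩
    · have := congrArg ρ e
      rw [hρ.invol, h1] at this
      exact absurd this (G.o_ne_v _ _)
    · have := congrArg ρ e
      rw [hρ.invol, ← h1, hρ.invol] at this
      exact absurd this (G.o_ne_u _ _)
  choose σ hσ using this
  refine ⟨σ, hσ, fun x => G.o_inj ?_, fun x e => hρ.ne (o x) ?_, fun x y => ?_⟩
  · rw [← hσ, ← hσ, hρ.invol]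
  · rw [hσ, e]
  · have := hρ.nc (o x) (o y)
    rwa [hσ, hσ] at this

theorem glued_glueSum (G : Gluing pos pr u v o) (hρ : NCInv pos ρ) (h1 : ∀ i, ρ (u i) = v i)
    [Fintype P] [Fintype O] {τ : K} {σ : O → O}
    (hσ : ∀ x, ρ (o x) = o (σ x)) (f : O → Bool) (lab : (Fin m → Bool) → P → Bool)
    (lu : ∀ g i, lab g (u i) = g i) (lv : ∀ g i, lab g (v i) = !g i)
    (lo : ∀ g x, lab g (o x) = f x) :
    glueSum τ pos ρ lab = (τ + τ⁻¹) ^ m * Wt τ (pos ∘ o) σ f := by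
  have e : ∀ g, (∏ i, if g i then 1 else τ⁻¹) * Wt τ pos ρ (lab g) =
      (∏ i, if g i then τ else τ⁻¹) * Wt τ (pos ∘ o) σ f := by
    intro g
    unfold Wt
    rw [← (Equiv.ofBijective _ G.bij).prod_comp, Fintype.prod_sum_type, Fintype.prod_sum_type]
    simp only [Equiv.ofBijective_apply, Sum.elim_inl, Sum.elim_inr]
    have e1 : ∀ x, lw τ pos ρ (lab g) (o x) = lw τ (pos ∘ o) σ f x := by
      intro x
      simp [lw, hσ, lo]
    have e2 : ∀ i, lw τ pos ρ (lab g) (u i) = if g i then τ else 1 := by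
      intro i
      simp [lw, h1, lu, lv, G.lt]
    have e3 : ∀ i, lw τ pos ρ (lab g) (v i) = 1 := by
      intro i
      rw [lw, ← h1, hρ.invol, h1, if_neg]
      have := G.lt i
      omega
    simp only [e1, e2, e3, Finset.prod_const_one, mul_one]
    rw [mul_comm (∏ x, lw τ (pos ∘ o) σ f x), ← mul_assoc, ← Finset.prod_mul_distrib]
    congr 1
    refine Finset.prod_congr rfl fun i _ => ?_
    cases g i <;> simp
  unfold glueSum
  simp only [e]
  rw [← Finset.sum_mul]
  congr 1
  have := Finset.prod_univ_sum (fun _ : Fin m => (Finset.univ : Finset Bool))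
    (fun _ b => if b then τ else τ⁻¹)
  rw [Fintype.piFinset_univ] at this
  rw [← this]
  simp

theorem glued_conn (G : Gluing pos pr u v o) (hρ : NCInv pos ρ)
    {σ : O → O} (hσ : ∀ x, ρ (o x) = o (σ x)) (x y : O)
    (hxy : ConnR pr ρ (pr (o x)) (pr (o y))) : y = x ∨ y = σ x := by
  have σσ : ∀ x, σ (σ x) = x := fun x => G.o_inj (by rw [← hσ, ← hσ, hρ.invol])
  let A : X → Prop := fun z => z = pr (o x) ∨ z = pr (o (σ x))
  have key : A (pr (o x)) = A (pr (o y)) := eqvGen_lift (s := Eq)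
    ⟨fun _ => rfl, Eq.symm, Eq.trans⟩ A ?_ hxy
  · have : A (pr (o y)) := key ▸ Or.inl rfl
    rcases this with e | e
    · exact .inl (G.o_inj (G.fib_outer _ _ e))
    · exact .inr (G.o_inj (G.fib_outer _ _ e))
  have aux : ∀ p, A (pr p) → A (pr (ρ p)) := by
    rintro p (e | e)
    · rw [G.fib_outer _ _ e, hσ]; exact .inr rfl
    · rw [G.fib_outer _ _ e, hσ, σσ]; exact .inl rfl
  rintro _ _ ⟨p, rfl, rfl⟩
  refine propext ⟨aux p, fun e => ?_⟩
  have := aux _ e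
  rwa [hρ.invol] at this
end Final

/-- Gluing a noncrossing picture: the outer points are paired by a noncrossing matching, which is
determined by connectivity, and the partition function is multiplicative. -/
theorem exists_glued (G : Gluing pos pr u v o)
    [Fintype P] [Fintype O] [Finite X] [CharZero K] {τ : K} (hτ : τ ≠ 0)
    (hd : τ + τ⁻¹ ≠ 0) {π : P → P} (h : NCInv pos π) :
    ∃ σ : O → O, NCInv (pos ∘ o) σ ∧
      (∀ x y, ConnR pr π (pr (o x)) (pr (o y)) ↔ y = x ∨ y = σ x) ∧
      ∀ (f : O → Bool) (lab : (Fin m → Bool) → P → Bool), (∀ g i, lab g (u i) = g i) →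
        (∀ g i, lab g (v i) = !g i) → (∀ g x, lab g (o x) = f x) →
        glueSum τ pos π lab =
          (τ + τ⁻¹) ^ classCount (ConnR pr π) (Set.range fun i => pr (v i)) *
            Wt τ (pos ∘ o) σ f := by
  obtain ⟨ρ, hρ, h1, h2, h3⟩ := exists_glued_upto G hτ h m le_rfl
  have h1' : ∀ i, ρ (u i) = v i := fun i => h1 i i.isLt
  obtain ⟨σ, hσ, hnc⟩ := glued_outer G hρ h1'
  refine ⟨σ, hnc, fun x y => ?_, fun f lab lu lv lo => ?_⟩
  · rw [h2]
    refine ⟨glued_conn G hρ hσ x y, ?_⟩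
    rintro (rfl | rfl)
    · exact (connR_equiv _ _).refl _
    · rw [← hσ]; exact connR_step _ _ _
  · have := h3 f lab lu lv lo
    rw [glued_classCount G hρ h1', glued_glueSum G hρ h1' hσ f lab lu lv lo] at this
    apply mul_right_cancel₀ (pow_ne_zero m hd)
    rw [this]
    ring
end Gluing

/-! ### The vertex model -/

theorem bIdx_injective (m n : ℕ) : Function.Injective (bIdx m n) := by
  rintro (i | i) (j | j) h <;> simp only [bIdx] at h
  · rw [Fin.ext h]
  · omega
  · omega
  · rw [show i = j from Fin.ext (by omega)]

theorem Diagram.ncInv {m n : ℕ} (p : Diagram m n) : NCInv (bIdx m n) p.pair :=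
  ⟨p.involutive, p.fixedPointFree, p.noncrossing⟩

theorem Diagram.ext_pair {m n : ℕ} {p q : Diagram m n} (h : p.pair = q.pair) : p = q := by
  cases p; cases q; simpa using h

/-- The product of `τ⁻¹` over the labels `false` of a word. -/
noncomputable def fac (τ : K) {m : ℕ} (s : Fin m → Bool) : K := ∏ i, if s i then 1 else τ⁻¹

/-- The matrix entry of a diagram in the vertex model. -/
noncomputable def wt (τ : K) {m n : ℕ} (p : Diagram m n) (s : Fin m → Bool) (t : Fin n → Bool) : K :=
  fac τ s * Wt τ (bIdx m n) p.pair (Sum.elim (fun i => !s i) t)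

/-- The matrix entry of a morphism in the vertex model. -/
noncomputable def mat (τ : K) {m n : ℕ} (x : Hom K m n) (s : Fin m → Bool) (t : Fin n → Bool) : K :=
  ∑ p, x p * wt τ p s t

theorem lw_congr {P Q : Type} {τ : K} {pos : P → ℕ} {pos' : Q → ℕ} {π : P → P} {π' : Q → Q}
    {f : P → Bool} {f' : Q → Bool} {x : P} {y : Q}
    (h1 : pos x < pos (π x) ↔ pos' y < pos' (π' y)) (h2 : f x = f' y) (h3 : f (π x) = f' (π' y)) :
    lw τ pos π f x = lw τ pos' π' f' y := by
  simp only [lw, h1, h2, h3]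

theorem Wt_congr_pos {P : Type} [Fintype P] {τ : K} {pos pos' : P → ℕ}
    (h : ∀ x y, pos x < pos y ↔ pos' x < pos' y) (π : P → P) (f : P → Bool) :
    Wt τ pos π f = Wt τ pos' π f := by
  simp only [Wt, lw, h]

theorem NCInv.congr_pos {P : Type} {pos pos' : P → ℕ}
    (h : ∀ x y, pos x < pos y ↔ pos' x < pos' y) {π : P → P} (hπ : NCInv pos π) : NCInv pos' π :=
  ⟨hπ.invol, hπ.ne, by simpa only [h] using hπ.nc⟩

theorem card_quotient_eq_classCount {X : Type} {r : X → X → Prop} (hr : Equivalence r) {M A : Set X}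
    (hA : ∀ x, x ∈ A ↔ x ∈ M ∧ ∀ y, r x y → y ∈ M) (s : Setoid A)
    (hs : ∀ x y, s x y ↔ r x.1 y.1) : Nat.card (Quotient s) = classCount r M := by
  have hcl : ∀ x : A, {y | r x.1 y} ∈ classesIn r M := fun x => ⟨x.1, rfl, ((hA _).1 x.2).2⟩
  refine Nat.card_eq_of_bijective (β := classesIn r M)
    (Quotient.lift (s := s) (fun x : A => (⟨{y | r x.1 y}, hcl x⟩ : classesIn r M)) ?_) ⟨?_, ?_⟩
  · intro x y h
    have h' : r x.1 y.1 := (hs x y).1 h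
    apply Subtype.ext
    ext z
    exact ⟨fun g => hr.trans (hr.symm h') g, fun g => hr.trans h' g⟩
  · intro x y
    refine Quotient.inductionOn₂ x y fun x y h => Quotient.sound ?_
    have h' : {z | r x.1 z} = {z | r y.1 z} := congrArg Subtype.val h
    refine (hs x y).2 (hr.symm ?_)
    have : x.1 ∈ {z | r x.1 z} := hr.refl _
    rw [h'] at this
    exact this
  · rintro ⟨_, x, rfl, hS⟩
    exact ⟨Quotient.mk s ⟨x, (hA x).2 ⟨hS (hr.refl x), hS⟩⟩, rfl⟩

section Comp

/-- The height function for stacking pictures. -/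
def stackPos (l m n : ℕ) : (Fin l ⊕ Fin m) ⊕ (Fin m ⊕ Fin n) → ℕ :=
  Sum.elim (bIdx l m) (fun y => l + m + bIdx m n y)

/-- The projection identifying the middle points of a stacked picture. -/
def stackPr (l m n : ℕ) : (Fin l ⊕ Fin m) ⊕ (Fin m ⊕ Fin n) → Pt l m n :=
  Sum.elim (Sum.map id Sum.inl) Sum.inr

theorem bIdx_lt (m n : ℕ) (x : Fin m ⊕ Fin n) : bIdx m n x < m + n := by
  rcases x with i | i <;> simp only [bIdx] <;> omega

theorem stack_gluing (l m n : ℕ) : Gluing (stackPos l m n) (stackPr l m n)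
    (fun i : Fin m => Sum.inl (Sum.inr i)) (fun i => Sum.inr (Sum.inl i))
    (Sum.elim (fun i : Fin l => Sum.inl (Sum.inl i)) (fun j : Fin n => Sum.inr (Sum.inr j))) where
  pos_inj := by
    rintro (x | x) (y | y) h <;> simp only [stackPos, Sum.elim_inl, Sum.elim_inr] at h
    · rw [bIdx_injective _ _ h]
    · have := bIdx_lt l m x; omega
    · have := bIdx_lt l m y; omega
    · rw [bIdx_injective m n (by omega : bIdx m n x = bIdx m n y)]
  bij := by
    constructor
    · rintro ((x | x) | x | x) ((y | y) | y | y) h <;> simp_all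
    · rintro ((x | x) | x | x)
      · exact ⟨.inl (.inl x), rfl⟩
      · exact ⟨.inr (.inl x), rfl⟩
      · exact ⟨.inr (.inr x), rfl⟩
      · exact ⟨.inl (.inr x), rfl⟩
  lt i := by simp only [stackPos, Sum.elim_inl, Sum.elim_inr, bIdx]; omega
  nest i j h := by
    have : (j : ℕ) < i := h
    simp only [stackPos, Sum.elim_inl, Sum.elim_inr, bIdx]; omega
  between i p h1 h2 := by
    rcases p with (x | x) | x | x <;> simp only [stackPos, Sum.elim_inl, Sum.elim_inr, bIdx] at h1 h2
    · omega
    · exact ⟨x, show (x : ℕ) < i by omega, .inl rfl⟩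
    · exact ⟨x, show (x : ℕ) < i by omega, .inr rfl⟩
    · omega
  glued i := rfl
  fib i p h := by
    rcases p with (x | x) | x | x <;> simp_all [stackPr]
  fib_outer x p h := by
    rcases p with (y | y) | y | y <;> rcases x with x | x <;> simp_all [stackPr]

theorem stack_ncInv {l m n : ℕ} (a : Diagram l m) (b : Diagram m n) :
    NCInv (stackPos l m n) (Sum.map a.pair b.pair) where
  invol := by rintro (x | x) <;> simp [a.ncInv.invol, b.ncInv.invol]
  ne := by rintro (x | x) <;> simp [a.ncInv.ne, b.ncInv.ne]
  nc := by
    rintro (x | x) (y | y) <;> simp only [stackPos, Sum.map_inl, Sum.map_inr, Sum.elim_inl,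
      Sum.elim_inr]
    · exact a.ncInv.nc x y
    · have := bIdx_lt l m (a.pair x); omega
    · have := bIdx_lt l m y; omega
    · have := b.ncInv.nc x y; omega

theorem stack_conn {l m n : ℕ} (a : Diagram l m) (b : Diagram m n) :
    ConnR (stackPr l m n) (Sum.map a.pair b.pair) = Conn a b := by
  have : StepR (stackPr l m n) (Sum.map a.pair b.pair) = Step a b := by
    funext x y
    refine propext ⟨?_, ?_⟩
    · rintro ⟨p | p, h1, h2⟩
      · exact .inl ⟨p, h1, h2⟩
      · exact .inr ⟨p, h1, h2⟩
    · rintro (⟨p, h1, h2⟩ | ⟨p, h1, h2⟩)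
      · exact ⟨.inl p, h1, h2⟩
      · exact ⟨.inr p, h1, h2⟩
  rw [ConnR, this, Conn]

theorem numLoops_eq {l m n : ℕ} (a : Diagram l m) (b : Diagram m n) :
    numLoops a b = classCount (Conn a b)
      (Set.range fun i : Fin m => stackPr l m n (Sum.inr (Sum.inl i))) := by
  refine card_quotient_eq_classCount (eqvGen_equiv _) (A := ClosedMid a b) (fun x => ?_) _
    fun x y => Iff.rfl
  have e : ∀ y, (y ∈ Set.range fun i : Fin m => stackPr l m n (Sum.inr (Sum.inl i))) ↔
      ∃ j : Fin m, y = Sum.inr (Sum.inl j) := by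
    intro y
    exact ⟨fun ⟨i, h⟩ => ⟨i, h.symm⟩, fun ⟨i, h⟩ => ⟨i, h.symm⟩⟩
  simp only [e]
  rfl

/-- Composition of diagrams, together with multiplicativity of the vertex model. -/
theorem exists_compD [CharZero K] {τ : K} (hτ : τ ≠ 0) (hd : τ + τ⁻¹ ≠ 0) {l m n : ℕ}
    (a : Diagram l m) (b : Diagram m n) : ∃ c : Diagram l n,
      (∀ q, compD (τ + τ⁻¹) b a q = if q = c then (τ + τ⁻¹) ^ numLoops a b else 0) ∧
      ∀ s t, ∑ g, wt τ a s g * wt τ b g t = (τ + τ⁻¹) ^ numLoops a b * wt τ c s t := by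
  obtain ⟨σ, h1, h2, h3⟩ := exists_glued (stack_gluing l m n) hτ hd (stack_ncInv a b)
  have hpos : ∀ x y, ((stackPos l m n) ∘ (Sum.elim (fun i : Fin l => Sum.inl (Sum.inl i))
      (fun j : Fin n => Sum.inr (Sum.inr j)))) x < ((stackPos l m n) ∘
      (Sum.elim (fun i : Fin l => Sum.inl (Sum.inl i))
      (fun j : Fin n => Sum.inr (Sum.inr j)))) y ↔ bIdx l n x < bIdx l n y := by
    rintro (x | x) (y | y) <;> simp only [Function.comp, stackPos, Sum.elim_inl, Sum.elim_inr, bIdx] <;>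
      omega
  have hσ := h1.congr_pos hpos
  refine ⟨⟨σ, hσ.invol, hσ.ne, hσ.nc⟩, fun q => ?_, fun s t => ?_⟩
  · unfold compD
    congr 1
    refine propext ⟨fun h => Diagram.ext_pair (funext fun x => ?_), ?_⟩
    · have := h x
      rw [← stack_conn] at this
      have e : ∀ x : Fin l ⊕ Fin n, (Sum.map id Sum.inr x : Pt l m n) = stackPr l m n
          (Sum.elim (fun i : Fin l => Sum.inl (Sum.inl i)) (fun j : Fin n => Sum.inr (Sum.inr j)) x) := by
        rintro (x | x) <;> rfl
      rw [e, e, h2] at this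
      exact this.resolve_left (q.fixedPointFree x)
    · rintro rfl x
      rw [← stack_conn]
      have := (h2 x (σ x)).2 (.inr rfl)
      rcases x with x | x <;> rcases h : σ _ with y | y <;> rw [h] at this <;> simp only [h] <;>
        exact this
  · have := h3 (Sum.elim (fun i => !s i) t)
      (fun g => Sum.elim (Sum.elim (fun i => !s i) g) (Sum.elim (fun i => !g i) t))
      (fun _ _ => rfl) (fun _ _ => rfl) (by rintro g (x | x) <;> rfl)
    rw [Wt_congr_pos hpos, stack_conn, ← numLoops_eq] at this
    have e : ∀ g : Fin m → Bool, wt τ a s g * wt τ b g t = fac τ s * ((∏ i, if g i then 1 else τ⁻¹) *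
        Wt τ (stackPos l m n) (Sum.map a.pair b.pair)
          (Sum.elim (Sum.elim (fun i => !s i) g) (Sum.elim (fun i => !g i) t))) := by
      intro g
      have : Wt τ (stackPos l m n) (Sum.map a.pair b.pair)
          (Sum.elim (Sum.elim (fun i => !s i) g) (Sum.elim (fun i => !g i) t)) =
          Wt τ (bIdx l m) a.pair (Sum.elim (fun i => !s i) g) *
          Wt τ (bIdx m n) b.pair (Sum.elim (fun i => !g i) t) := by
        unfold Wt
        rw [Fintype.prod_sum_type]
        congr 1
        refine Finset.prod_congr rfl fun x _ => ?_
        exact lw_congr (by simp [stackPos]) rfl rfl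
      rw [this, wt, wt]
      simp only [fac]
      ring
    rw [Finset.sum_congr rfl fun g _ => e g, ← Finset.mul_sum]
    rw [glueSum] at this
    rw [this, wt]
    ring

theorem mat_comp [CharZero K] {τ : K} (hτ : τ ≠ 0) (hd : τ + τ⁻¹ ≠ 0) {l m n : ℕ}
    (b : Hom K m n) (a : Hom K l m) (s t) :
    mat τ (comp (τ + τ⁻¹) b a) s t = ∑ g, mat τ a s g * mat τ b g t := by
  have key : ∀ (p : Diagram m n) (q : Diagram l m),
      ∑ c, compD (τ + τ⁻¹) p q c * wt τ c s t = ∑ g, wt τ q s g * wt τ p g t := by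
    intro p q
    obtain ⟨c, h1, h2⟩ := exists_compD hτ hd q p
    simp [h1, h2]
  simp only [mat, comp, Finset.sum_mul, Finset.mul_sum]
  rw [Finset.sum_comm]
  have e : ∀ p : Diagram m n, ∑ c, ∑ q, b p * a q * compD (τ + τ⁻¹) p q c * wt τ c s t =
      ∑ q, ∑ g, a q * wt τ q s g * (b p * wt τ p g t) := by
    intro p
    rw [Finset.sum_comm]
    refine Finset.sum_congr rfl fun q _ => ?_
    calc _ = b p * a q * ∑ c, compD (τ + τ⁻¹) p q c * wt τ c s t := by
          rw [Finset.mul_sum]; exact Finset.sum_congr rfl fun _ _ => by ring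
      _ = _ := by
          rw [key, Finset.mul_sum]; exact Finset.sum_congr rfl fun _ _ => by ring
  rw [Finset.sum_congr rfl fun p _ => e p]
  rw [Finset.sum_congr rfl fun p _ => Finset.sum_comm]
  rw [Finset.sum_comm]
end Comp

section Tensor

/-- The height function of a juxtaposed picture. -/
def juxtPos (m n m' n' : ℕ) (z : (Fin m ⊕ Fin n) ⊕ (Fin m' ⊕ Fin n')) : ℕ :=
  bIdx (m + m') (n + n') ((tEquiv m n m' n').symm z)

theorem juxtPos_inr (m n m' n' : ℕ) (y : Fin m' ⊕ Fin n') :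
    juxtPos m n m' n' (Sum.inr y) = m + bIdx m' n' y := by
  rcases y with j | j
  · simp [juxtPos, tEquiv, bIdx]
  · simp [juxtPos, tEquiv, bIdx]; omega

theorem juxtPos_inl_lt (m n m' n' : ℕ) (x y : Fin m ⊕ Fin n) :
    juxtPos m n m' n' (Sum.inl x) < juxtPos m n m' n' (Sum.inl y) ↔ bIdx m n x < bIdx m n y := by
  rcases x with i | i <;> rcases y with j | j <;> simp [juxtPos, tEquiv, bIdx] <;> omega

theorem juxtPos_inl_outside (m n m' n' : ℕ) (x : Fin m ⊕ Fin n) :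
    juxtPos m n m' n' (Sum.inl x) < m ∨ m + m' + n' ≤ juxtPos m n m' n' (Sum.inl x) := by
  rcases x with i | i <;> simp [juxtPos, tEquiv, bIdx]; omega

theorem juxt_ncInv {m n m' n' : ℕ} (a : Diagram m n) (b : Diagram m' n') :
    NCInv (juxtPos m n m' n') (Sum.map a.pair b.pair) where
  invol := by rintro (x | x) <;> simp [a.ncInv.invol, b.ncInv.invol]
  ne := by rintro (x | x) <;> simp [a.ncInv.ne, b.ncInv.ne]
  nc := by
    rintro (x | x) (y | y) <;> simp only [Sum.map_inl, Sum.map_inr]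
    · simpa only [juxtPos_inl_lt] using a.ncInv.nc x y
    · have := bIdx_lt m' n' y
      have := bIdx_lt m' n' (b.pair y)
      have := juxtPos_inl_outside m n m' n' (a.pair x)
      rw [juxtPos_inr, juxtPos_inr]
      omega
    · have := bIdx_lt m' n' x
      have := bIdx_lt m' n' (b.pair x)
      have := juxtPos_inl_outside m n m' n' y
      rw [juxtPos_inr, juxtPos_inr]
      omega
    · have := b.ncInv.nc x y
      simp only [juxtPos_inr]
      omega

theorem fac_append (τ : K) {m m' : ℕ} (s : Fin m → Bool) (s' : Fin m' → Bool) :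
    fac τ (Fin.append s s') = fac τ s * fac τ s' := by
  simp [fac, Fin.prod_univ_add]

theorem exists_tensorD (τ : K) {m n m' n' : ℕ} (a : Diagram m n) (b : Diagram m' n') :
    ∃ c : Diagram (m + m') (n + n'), c.pair = tensorPair a b ∧ ∀ s s' t t',
      wt τ c (Fin.append s s') (Fin.append t t') = wt τ a s t * wt τ b s' t' := by
  have h := juxt_ncInv a b
  let e := tEquiv m n m' n'
  have hp : ∀ x, bIdx (m + m') (n + n') x = juxtPos m n m' n' (e x) := by
    intro x; simp [juxtPos, e]
  refine ⟨⟨tensorPair a b, fun x => ?_, fun x hx => ?_, fun x y => ?_⟩, rfl, fun s s' t t' => ?_⟩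
  · simp [tensorPair, h.invol]
  · apply h.ne (e x)
    rw [tensorPair, Equiv.symm_apply_eq] at hx
    exact hx
  · have := h.nc (e x) (e y)
    simpa [hp, tensorPair, e] using this
  · unfold wt
    rw [fac_append]
    have : Wt τ (bIdx (m + m') (n + n')) (tensorPair a b)
        (Sum.elim (fun i => !Fin.append s s' i) (Fin.append t t')) =
        Wt τ (bIdx m n) a.pair (Sum.elim (fun i => !s i) t) *
        Wt τ (bIdx m' n') b.pair (Sum.elim (fun i => !s' i) t') := by
      have l1 : ∀ x, (Sum.elim (fun i => !Fin.append s s' i) (Fin.append t t'))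
          (e.symm (Sum.inl x)) = Sum.elim (fun i => !s i) t x := by
        rintro (x | x) <;> simp [e, tEquiv]
      have l2 : ∀ x, (Sum.elim (fun i => !Fin.append s s' i) (Fin.append t t'))
          (e.symm (Sum.inr x)) = Sum.elim (fun i => !s' i) t' x := by
        rintro (x | x) <;> simp [e, tEquiv]
      have tp : ∀ z, tensorPair a b (e.symm z) = e.symm (Sum.map a.pair b.pair z) := by
        intro z; simp [tensorPair, e]
      unfold Wt
      rw [← e.symm.prod_comp, Fintype.prod_sum_type]
      congr 1
      · refine Finset.prod_congr rfl fun x _ => lw_congr ?_ (l1 x) ?_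
        · rw [tp]; exact juxtPos_inl_lt _ _ _ _ _ _
        · rw [tp]; exact l1 _
      · refine Finset.prod_congr rfl fun x _ => lw_congr ?_ (l2 x) ?_
        · rw [tp]
          have h1 := juxtPos_inr m n m' n' x
          have h2 := juxtPos_inr m n m' n' (b.pair x)
          simp only [juxtPos] at h1 h2
          simp only [Sum.map_inr, e]
          omega
        · rw [tp]; exact l2 _
    dsimp only
    rw [this]
    ring

theorem mat_tensor (τ : K) {m n m' n' : ℕ} (x : Hom K m n) (y : Hom K m' n') (s s' t t') :
    mat τ (tensor x y) (Fin.append s s') (Fin.append t t') = mat τ x s t * mat τ y s' t' := by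
  have key : ∀ (p : Diagram m n) (q : Diagram m' n'),
      ∑ c, tensorD p q c * wt τ c (Fin.append s s') (Fin.append t t') =
        wt τ p s t * wt τ q s' t' := by
    intro p q
    obtain ⟨c, h1, h2⟩ := exists_tensorD τ p q
    have : ∀ q', (q'.pair = tensorPair p q) = (q' = c) := by
      intro q'
      rw [← h1]
      exact propext ⟨Diagram.ext_pair, fun e => e ▸ rfl⟩
    simp [tensorD, this, h2]
  simp only [mat, tensor, Finset.sum_mul, Finset.mul_sum]
  rw [Finset.sum_comm]
  refine (Finset.sum_congr rfl fun p _ => ?_).trans Finset.sum_comm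
  rw [Finset.sum_comm]
  refine Finset.sum_congr rfl fun q _ => ?_
  calc _ = x p * y q * ∑ c, tensorD p q c * wt τ c (Fin.append s s') (Fin.append t t') := by
        rw [Finset.mul_sum]; exact Finset.sum_congr rfl fun _ _ => by ring
    _ = _ := by rw [key]; ring
end Tensor

section Trace

/-- The projection identifying top and bottom points. -/
def closePr (n : ℕ) : Fin n ⊕ Fin n → Fin n := Sum.elim id id

theorem close_gluing (n : ℕ) : Gluing (bIdx n n) (closePr n)
    (fun i : Fin n => Sum.inl i.rev) (fun i => Sum.inr i.rev) (Empty.elim : Empty → Fin n ⊕ Fin n) where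
  pos_inj := bIdx_injective n n
  bij := by
    constructor
    · rintro (⟨⟨⟩⟩ | x | x) (⟨⟨⟩⟩ | y | y) h <;> simp_all
    · rintro (x | x)
      · exact ⟨.inr (.inl x.rev), by simp⟩
      · exact ⟨.inr (.inr x.rev), by simp⟩
  lt i := by simp only [bIdx, Fin.val_rev]; omega
  nest i j h := by
    have : (j : ℕ) < i := h
    simp only [bIdx, Fin.val_rev]; omega
  between i p h1 h2 := by
    rcases p with x | x <;> simp only [bIdx, Fin.val_rev] at h1 h2
    · exact ⟨x.rev, show (x.rev : ℕ) < i by simp only [Fin.val_rev]; omega, by simp⟩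
    · exact ⟨x.rev, show (x.rev : ℕ) < i by simp only [Fin.val_rev]; omega, by simp⟩
  glued i := rfl
  fib i p h := by
    rcases p with x | x <;> simp_all [closePr]
  fib_outer x := x.elim

theorem trLoops_eq {n : ℕ} (p : Diagram n n) :
    trLoops p = classCount (ConnR (closePr n) p.pair)
      (Set.range fun i : Fin n => closePr n (Sum.inr i.rev)) := by
  have hM : (Set.range fun i : Fin n => closePr n (Sum.inr i.rev)) = Set.univ :=
    Set.eq_univ_of_forall fun i => ⟨i.rev, by simp [closePr]⟩
  rw [hM, ← card_quotient_eq_classCount (connR_equiv (closePr n) p.pair) (A := Set.univ) (by simp)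
    ⟨fun x y => ConnR (closePr n) p.pair x.1 y.1, ⟨fun _ => (connR_equiv _ _).refl _,
      fun h => (connR_equiv _ _).symm h, fun h g => (connR_equiv _ _).trans h g⟩⟩ (fun _ _ => Iff.rfl),
    trLoops]
  have E := connR_equiv (closePr n) p.pair
  have E' := eqvGen_equiv (closeStep p)
  have l : ∀ x, Relation.EqvGen (closeStep p) (Sum.inl (closePr n x)) x := by
    rintro (x | x)
    · exact E'.refl _
    · exact .rel _ _ (.inr rfl)
  have up : ∀ i j, ConnR (closePr n) p.pair i j →
      Relation.EqvGen (closeStep p) (Sum.inl i) (Sum.inl j) := by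
    refine fun i j h => eqvGen_lift E' Sum.inl ?_ h
    rintro _ _ ⟨x, rfl, rfl⟩
    exact E'.trans (l x) (E'.trans (.rel _ _ (.inl rfl)) (E'.symm (l _)))
  have down : ∀ x y, Relation.EqvGen (closeStep p) x y →
      ConnR (closePr n) p.pair (closePr n x) (closePr n y) := by
    refine fun x y h => eqvGen_lift E (closePr n) ?_ h
    rintro x _ (rfl | rfl)
    · exact connR_step _ _ _
    · rcases x with x | x <;> exact E.refl _
  refine Nat.card_eq_of_bijective (Quotient.lift (fun x => Quotient.mk _ ⟨closePr n x, trivial⟩)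
    fun x y h => Quotient.sound (down x y h)) ⟨?_, ?_⟩
  · rintro ⟨x⟩ ⟨y⟩ h
    exact Quotient.sound (E'.trans (E'.symm (l x)) (E'.trans (up _ _ (Quotient.exact h)) (l y)))
  · rintro ⟨i, hi⟩
    exact ⟨Quotient.mk _ (Sum.inl i), rfl⟩
/-- The weight of a closing strand bundle with labels `w`. -/
noncomputable def traceWt (τ : K) {n : ℕ} (w : Fin n → Bool) : K := ∏ i, if w i then τ⁻¹ else τ

theorem trLoops_formula [CharZero K] {τ : K} (hτ : τ ≠ 0) (hd : τ + τ⁻¹ ≠ 0) {n : ℕ}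
    (p : Diagram n n) : (τ + τ⁻¹) ^ trLoops p = ∑ w, traceWt τ w * wt τ p w w := by
  obtain ⟨σ, -, -, h⟩ := exists_glued (close_gluing n) hτ hd p.ncInv
  have := h Empty.elim (fun g => Sum.elim (fun i => g i.rev) (fun i => !g i.rev))
    (fun g i => by simp) (fun g i => by simp) (fun _ x => x.elim)
  rw [← trLoops_eq, Wt, Finset.univ_eq_empty, Finset.prod_empty, mul_one] at this
  rw [← this, glueSum]
  refine Finset.sum_bij' (fun g _ i => !g i.rev) (fun w _ i => !w i.rev) (by simp) (by simp)
    (by simp) (by simp) fun g _ => ?_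
  simp only [traceWt, wt, fac, Bool.not_not]
  rw [← mul_assoc, ← Finset.prod_mul_distrib]
  congr 1
  rw [← Equiv.prod_comp Fin.revPerm]
  refine Finset.prod_congr rfl fun i _ => ?_
  cases g i <;> simp [Fin.revPerm_apply] <;> cases h : g i.rev <;> simp [hτ]

theorem Tr_formula [CharZero K] {τ : K} (hτ : τ ≠ 0) (hd : τ + τ⁻¹ ≠ 0) {n : ℕ}
    (x : Hom K n n) : Tr (τ + τ⁻¹) x = ∑ w, traceWt τ w * mat τ x w w := by
  simp only [Tr, trLoops_formula hτ hd, mat, Finset.mul_sum]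
  rw [Finset.sum_comm]
  exact Finset.sum_congr rfl fun _ _ => Finset.sum_congr rfl fun _ _ => by ring
end Trace

/-! ### Faithfulness of the vertex model -/

section Faithful
variable {P : Type} {pos : P → ℕ} {π ρ : P → P}

/-- The labelling marking the right endpoints of a matching. -/
noncomputable def closer (pos : P → ℕ) (π : P → P) (x : P) : Bool := decide (pos (π x) < pos x)

theorem NCInv.closer_pair (hpos : Function.Injective pos) (h : NCInv pos π) (x : P) :
    closer pos π (π x) = !closer pos π x := by
  have : pos (π x) ≠ pos x := fun e => h.ne x (hpos e)
  simp only [closer, h.invol]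
  rcases lt_or_gt_of_ne this with g | g <;> simp [g, g.le]

theorem NCInv.Wt_closer [Fintype P] (τ : K) (hpos : Function.Injective pos) (h : NCInv pos π) :
    Wt τ pos π (closer pos π) = 1 := by
  refine Finset.prod_eq_one fun x _ => ?_
  unfold lw
  split_ifs with h1 h2 h3
  · rw [h.closer_pair hpos] at h2
    cases h4 : closer pos π x <;> simp [h4] at h2
  · simp only [closer, decide_eq_true_eq] at h3
    omega
  · rfl
  · rfl

theorem ne_of_Wt_ne_zero [Fintype P] {τ : K} {f : P → Bool} (hpos : Function.Injective pos)
    (h : NCInv pos π) (hw : Wt τ pos π f ≠ 0) (x : P) : f (π x) = !f x := by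
  have key : ∀ x, pos x < pos (π x) → f (π x) = !f x := by
    intro x hx
    have := Finset.prod_ne_zero_iff.1 hw x (Finset.mem_univ _)
    rw [lw, if_pos hx] at this
    cases h1 : f x <;> cases h2 : f (π x) <;> simp_all
  rcases lt_or_gt_of_ne (fun e => h.ne x (hpos e) : pos (π x) ≠ pos x) with g | g
  · have := key (π x) (by rwa [h.invol])
    rw [h.invol] at this
    simp [this]
  · exact key x g

/-- The sum of the positions of the right endpoints. -/
noncomputable def potential [Fintype P] (pos : P → ℕ) (π : P → P) : ℤ :=
  ∑ x, pos x * (if closer pos π x then 1 else 0)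

theorem closer_eq_of_Wt_ne_zero [Fintype P] {τ : K} (hpos : Function.Injective pos)
    (hρ : NCInv pos ρ) (hw : Wt τ pos ρ (closer pos π) ≠ 0)
    (hE : potential pos ρ ≤ potential pos π) : closer pos ρ = closer pos π := by
  let a : P → ℤ := fun x => if closer pos ρ x then 1 else 0
  let b : P → ℤ := fun x => if closer pos π x then 1 else 0
  have ha : ∀ x, a (ρ x) = 1 - a x := by
    intro x
    simp only [a, hρ.closer_pair hpos]
    cases closer pos ρ x <;> simp
  have hb : ∀ x, b (ρ x) = 1 - b x := by
    intro x
    simp only [b, ne_of_Wt_ne_zero hpos hρ hw]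
    cases closer pos π x <;> simp
  have h1 : ∑ x, (pos x : ℤ) * (a x - b x) ≤ 0 := by
    simp only [mul_sub, Finset.sum_sub_distrib]
    simpa [potential, a, b] using hE
  have h2 : ∑ x, (pos (ρ x) : ℤ) * (a (ρ x) - b (ρ x)) = ∑ x, (pos x : ℤ) * (a x - b x) :=
    Equiv.sum_comp (⟨ρ, ρ, hρ.invol, hρ.invol⟩ : P ≃ P) fun x => (pos x : ℤ) * (a x - b x)
  have h3 : ∀ x, 0 ≤ ((pos x : ℤ) - pos (ρ x)) * (a x - b x) := by
    intro x
    simp only [a, b, closer, decide_eq_true_eq]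
    split_ifs <;> simp <;> omega
  have h4 : ∑ x, ((pos x : ℤ) - pos (ρ x)) * (a x - b x) ≤ 0 := by
    have : ∀ x, ((pos x : ℤ) - pos (ρ x)) * (a x - b x) =
        pos x * (a x - b x) + pos (ρ x) * (a (ρ x) - b (ρ x)) := by
      intro x; rw [ha, hb]; ring
    rw [Finset.sum_congr rfl fun x _ => this x, Finset.sum_add_distrib, h2]
    omega
  have h5 := (Finset.sum_eq_zero_iff_of_nonneg fun x _ => h3 x).1
    (le_antisymm h4 (Finset.sum_nonneg fun x _ => h3 x))
  funext x
  have h6 := h5 x (Finset.mem_univ _)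
  have h7 : (pos x : ℤ) - pos (ρ x) ≠ 0 := fun e => hρ.ne x (hpos (by omega))
  have h8 := (mul_eq_zero.1 h6).resolve_left h7
  simp only [a, b] at h8
  cases h9 : closer pos ρ x <;> cases h10 : closer pos π x <;> simp [h9, h10] at h8 ⊢

theorem eq_of_closer_eq (hpos : Function.Injective pos) (hπ : NCInv pos π) (hρ : NCInv pos ρ)
    (h : closer pos ρ = closer pos π) : π = ρ := by
  have step : ∀ (π ρ : P → P), NCInv pos π → NCInv pos ρ → closer pos ρ = closer pos π → ∀ x,
      closer pos π x = true → (∀ y, pos y < pos x → closer pos π y = true → π y = ρ y) →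
      ¬ pos (π x) < pos (ρ x) := by
    intro π ρ hπ hρ h x hx ih hlt
    have hρx : pos (ρ x) < pos x := by rw [← h] at hx; simpa [closer] using hx
    have h1 := hπ.between hpos (π x) (ρ x) hlt (by rwa [hπ.invol])
    rw [hπ.invol] at h1
    have h2 : closer pos π (π (ρ x)) = true := by
      rw [hπ.closer_pair hpos, ← h, hρ.closer_pair hpos, h, hx]; rfl
    have h3 := ih _ h1.2 h2
    rw [hπ.invol] at h3
    have h4 : x = π (ρ x) := by
      have := congrArg ρ h3
      simpa only [hρ.invol] using this
    rw [← h4] at h1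
    exact lt_irrefl _ h1.2
  have main : ∀ N x, pos x = N → closer pos π x = true → π x = ρ x := by
    intro N
    induction N using Nat.strong_induction_on with
    | _ N ih =>
      intro x hN hx
      refine hpos (le_antisymm ?_ ?_) <;> refine not_lt.1 ?_
      · refine step ρ π hρ hπ h.symm x (by rwa [h]) fun y hy hy' => ?_
        exact (ih _ (hN ▸ hy) y rfl (by rwa [← h])).symm
      · exact step π ρ hπ hρ h x hx fun y hy hy' => ih _ (hN ▸ hy) y rfl hy'
  funext x
  cases hx : closer pos π x with
  | true => exact main _ x rfl hx
  | false =>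
    have h1 := main _ (π x) rfl (by rw [hπ.closer_pair hpos, hx]; rfl)
    rw [hπ.invol] at h1
    have := congrArg ρ h1
    rw [hρ.invol] at this
    exact this.symm

end Faithful

theorem fac_ne_zero {τ : K} (hτ : τ ≠ 0) {m : ℕ} (s : Fin m → Bool) : fac τ s ≠ 0 := by
  refine Finset.prod_ne_zero_iff.2 fun i _ => ?_
  split_ifs <;> simp [hτ]

theorem mat_eq_zero {τ : K} (hτ : τ ≠ 0) {m n : ℕ} {x : Hom K m n} (h : ∀ s t, mat τ x s t = 0) :
    x = 0 := by
  by_contra hx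
  have hne : (Finset.univ.filter fun p => x p ≠ 0).Nonempty := by
    obtain ⟨p, hp⟩ := Function.ne_iff.1 hx
    exact ⟨p, by simpa using hp⟩
  obtain ⟨p, hp, hmax⟩ := Finset.exists_max_image _ (fun p => potential (bIdx m n) p.pair) hne
  have h1 := h (fun i => !closer (bIdx m n) p.pair (Sum.inl i))
    (fun j => closer (bIdx m n) p.pair (Sum.inr j))
  rw [mat, Finset.sum_eq_single p] at h1
  · simp only [wt, Bool.not_not] at h1
    have : (Sum.elim (fun i => closer (bIdx m n) p.pair (Sum.inl i))
        (fun j => closer (bIdx m n) p.pair (Sum.inr j))) = closer (bIdx m n) p.pair := by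
      funext x; rcases x with x | x <;> rfl
    rw [this, p.ncInv.Wt_closer τ (bIdx_injective m n), mul_one] at h1
    exact (mul_ne_zero (by simpa using hp) (fac_ne_zero hτ _)) h1
  · intro q _ hq
    by_contra hne'
    have hq0 : x q ≠ 0 := left_ne_zero_of_mul hne'
    have hw := right_ne_zero_of_mul (right_ne_zero_of_mul hne')
    simp only [Bool.not_not] at hw
    have : (Sum.elim (fun i => closer (bIdx m n) p.pair (Sum.inl i))
        (fun j => closer (bIdx m n) p.pair (Sum.inr j))) = closer (bIdx m n) p.pair := by
      funext x; rcases x with x | x <;> rfl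
    rw [this] at hw
    have hc := closer_eq_of_Wt_ne_zero (bIdx_injective m n) q.ncInv hw
      (hmax q (by simpa using hq0))
    exact hq (Diagram.ext_pair (eq_of_closer_eq (bIdx_injective m n) p.ncInv q.ncInv hc).symm)
  · simp

theorem mat_sub (τ : K) {m n : ℕ} (x y : Hom K m n) (s t) :
    mat τ (x - y) s t = mat τ x s t - mat τ y s t := by
  simp [mat, sub_mul, Finset.sum_sub_distrib]

theorem mat_ext {τ : K} (hτ : τ ≠ 0) {m n : ℕ} {x y : Hom K m n}
    (h : ∀ s t, mat τ x s t = mat τ y s t) : x = y :=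
  sub_eq_zero.1 (mat_eq_zero hτ fun s t => by rw [mat_sub, h, sub_self])

/-- The charge of a labelling. -/
def charge {m : ℕ} (s : Fin m → Bool) : ℤ := ∑ i, if s i then -1 else 1

/-- Conservation of charge across a diagram. -/
theorem charge_eq_of_mat_ne_zero {τ : K} {m n : ℕ} {x : Hom K m n} {s t}
    (h : mat τ x s t ≠ 0) : charge s = charge t := by
  obtain ⟨p, -, hp⟩ := Finset.exists_ne_zero_of_sum_ne_zero h
  have hw := right_ne_zero_of_mul (right_ne_zero_of_mul hp)
  have key := ne_of_Wt_ne_zero (bIdx_injective m n) p.ncInv hw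
  have h1 : ∑ x, (if (Sum.elim (fun i => !s i) t) x then -1 else 1 : ℤ) = 0 := by
    refine Finset.sum_involution (fun x _ => p.pair x) (fun x _ => ?_)
      (fun x _ _ => p.fixedPointFree x) (fun _ _ => Finset.mem_univ _) (fun x _ => p.involutive x)
    rw [key]
    cases (Sum.elim (fun i => !s i) t) x <;> simp
  rw [Fintype.sum_sum_type] at h1
  have h2 : (∑ i, if (Sum.elim (fun i => !s i) t) (Sum.inl i) then -1 else 1 : ℤ) + charge s = 0 := by
    rw [charge, ← Finset.sum_add_distrib]
    refine Finset.sum_eq_zero fun i _ => ?_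
    cases h : s i <;> simp [h]
  have h3 : (∑ i, if (Sum.elim (fun i => !s i) t) (Sum.inr i) then -1 else 1 : ℤ) = charge t := rfl
  omega

theorem traceWt_eq_zpow {τ : K} (hτ : τ ≠ 0) {m : ℕ} (s : Fin m → Bool) :
    traceWt τ s = τ ^ charge s := by
  induction m with
  | zero => simp [traceWt, charge]
  | succ m ih =>
    have h1 := ih (fun i => s i.succ)
    simp only [traceWt, charge] at h1 ⊢
    rw [Fin.prod_univ_succ, Fin.sum_univ_succ, h1, zpow_add₀ hτ]
    cases s 0 <;> simp

/-! ### Words and matrix entries indexed by words -/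

/-- The words of length `m` in two letters. -/
noncomputable def words (m : ℕ) : Finset (List Bool) :=
  (Finset.univ : Finset (Fin m → Bool)).image List.ofFn

@[simp] theorem mem_words {m : ℕ} {w : List Bool} : w ∈ words m ↔ w.length = m := by
  simp only [words, Finset.mem_image, Finset.mem_univ, true_and]
  constructor
  · rintro ⟨g, rfl⟩; simp
  · rintro rfl; exact ⟨w.get, List.ofFn_get w⟩

theorem sum_words {M : Type} [AddCommMonoid M] (m : ℕ) (F : List Bool → M) :
    ∑ w ∈ words m, F w = ∑ g : Fin m → Bool, F (List.ofFn g) :=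
  Finset.sum_image fun _ _ _ _ h => List.ofFn_injective h

theorem sum_words_zero {M : Type} [AddCommMonoid M] (F : List Bool → M) :
    ∑ w ∈ words 0, F w = F [] := by
  simp [sum_words]

theorem sum_words_append {M : Type} [AddCommMonoid M] (a b : ℕ) (F : List Bool → M) :
    ∑ w ∈ words (a + b), F w = ∑ p ∈ words a, ∑ s ∈ words b, F (p ++ s) := by
  rw [← Finset.sum_product']
  refine Finset.sum_bij' (fun w _ => (w.take a, w.drop a)) (fun q _ => q.1 ++ q.2) ?_ ?_ ?_ ?_ ?_
  · intro w hw
    simp only [mem_words] at hw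
    simp [hw]
  · rintro ⟨p, s⟩ h
    simp only [Finset.mem_product, mem_words] at h
    simp [h]
  · intro w _; simp
  · rintro ⟨p, s⟩ h
    simp only [Finset.mem_product, mem_words] at h
    simp [← h.1]
  · intro w _; simp

theorem sum_words_one {M : Type} [AddCommMonoid M] (F : List Bool → M) :
    ∑ w ∈ words 1, F w = F [true] + F [false] := by
  have : words 1 = {[true], [false]} := by
    ext w
    simp only [mem_words, Finset.mem_insert, Finset.mem_singleton]
    rcases w with _ | ⟨a, _ | ⟨b, w⟩⟩ <;> simp
  rw [this, Finset.sum_pair (by simp)]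

theorem sum_words_succ {M : Type} [AddCommMonoid M] (m : ℕ) (F : List Bool → M) :
    ∑ w ∈ words (m + 1), F w =
      ∑ w ∈ words m, F (true :: w) + ∑ w ∈ words m, F (false :: w) := by
  rw [add_comm m 1, sum_words_append, sum_words_one]
  rfl

theorem sum_words_succ' {M : Type} [AddCommMonoid M] (m : ℕ) (F : List Bool → M) :
    ∑ w ∈ words (m + 1), F w =
      ∑ w ∈ words m, (F (w ++ [true]) + F (w ++ [false])) := by
  rw [sum_words_append]
  exact Finset.sum_congr rfl fun _ _ => sum_words_one _

/-- The word `w` as a labelling of `m` points. -/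
def lab (m : ℕ) (w : List Bool) : Fin m → Bool := fun i => w.getD i false

@[simp] theorem lab_ofFn {m : ℕ} (g : Fin m → Bool) : lab m (List.ofFn g) = g := by
  funext i; simp [lab]

theorem lab_append {m m' : ℕ} {u u' : List Bool} (h : u.length = m) :
    lab (m + m') (u ++ u') = Fin.append (lab m u) (lab m' u') := by
  funext i
  refine Fin.addCases (fun i => ?_) (fun i => ?_) i
  · simp only [lab, Fin.append_left, Fin.val_castAdd]
    exact List.getD_append _ _ _ _ (by omega)
  · simp only [lab, Fin.append_right, Fin.val_natAdd]
    rw [List.getD_append_right _ _ _ _ (by omega)]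
    congr 1; omega

theorem lab_injOn {m : ℕ} {u v : List Bool} (hu : u.length = m) (hv : v.length = m) :
    lab m u = lab m v ↔ u = v := by
  refine ⟨fun h => List.ext_getElem (by omega) fun i h1 h2 => ?_, fun h => h ▸ rfl⟩
  have := congrFun h ⟨i, by omega⟩
  simpa [lab, h1, h2] using this

/-- The matrix entry of a morphism at a pair of words. -/
noncomputable def lm (τ : K) {m n : ℕ} (x : Hom K m n) (u v : List Bool) : K :=
  mat τ x (lab m u) (lab n v)

theorem lm_ext {τ : K} (hτ : τ ≠ 0) {m n : ℕ} {x y : Hom K m n}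
    (h : ∀ u v, u.length = m → v.length = n → lm τ x u v = lm τ y u v) : x = y := by
  refine mat_ext hτ fun s t => ?_
  have := h (List.ofFn s) (List.ofFn t) (by simp) (by simp)
  simpa [lm] using this

theorem lm_add (τ : K) {m n : ℕ} (x y : Hom K m n) (u v) :
    lm τ (x + y) u v = lm τ x u v + lm τ y u v := by
  simp [lm, mat, add_mul, Finset.sum_add_distrib]

theorem lm_smul (τ : K) {m n : ℕ} (c : K) (x : Hom K m n) (u v) :
    lm τ (c • x) u v = c * lm τ x u v := by
  simp [lm, mat, Finset.mul_sum, mul_assoc]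

theorem lm_zero (τ : K) {m n : ℕ} (u v) : lm τ (0 : Hom K m n) u v = 0 := by
  simp [lm, mat]

theorem lm_comp [CharZero K] {τ : K} (hτ : τ ≠ 0) (hd : τ + τ⁻¹ ≠ 0) {l m n : ℕ}
    (b : Hom K m n) (a : Hom K l m) (u v) :
    lm τ (comp (τ + τ⁻¹) b a) u v = ∑ g ∈ words m, lm τ a u g * lm τ b g v := by
  rw [lm, mat_comp hτ hd, sum_words]
  simp [lm]

theorem lm_tensor (τ : K) {m n m' n' : ℕ} (x : Hom K m n) (y : Hom K m' n') {u u' v v'}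
    (hu : u.length = m) (hv : v.length = n) :
    lm τ (tensor x y) (u ++ u') (v ++ v') = lm τ x u v * lm τ y u' v' := by
  rw [lm, lab_append hu, lab_append hv, mat_tensor]
  rfl

theorem mat_single (τ : K) {m n : ℕ} (p : Diagram m n) (s t) : mat τ (single p) s t = wt τ p s t := by
  simp [mat, single]

theorem lm_id {τ : K} (hτ : τ ≠ 0) {n : ℕ} {u v : List Bool} (hu : u.length = n)
    (hv : v.length = n) : lm τ (idHom K n) u v = if u = v then 1 else 0 := by
  have key : ∀ s t, mat τ (idHom K n) s t = if s = t then 1 else 0 := by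
    intro s t
    have : mat τ (idHom K n) s t = wt τ (idD n) s t := mat_single τ _ s t
    rw [this, wt, Wt, Fintype.prod_sum_type]
    have h2 : ∏ i : Fin n, lw τ (bIdx n n) (idD n).pair (Sum.elim (fun i => !s i) t) (Sum.inr i) = 1 := by
      refine Finset.prod_eq_one fun i _ => ?_
      rw [lw, if_neg]
      simp only [idD, bIdx, Sum.elim_inr]
      omega
    rw [h2, mul_one, fac, ← Finset.prod_mul_distrib]
    have h3 : ∀ i, ((if s i then 1 else τ⁻¹) *
        lw τ (bIdx n n) (idD n).pair (Sum.elim (fun i => !s i) t) (Sum.inl i)) =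
        if s i = t i then 1 else 0 := by
      intro i
      have h4 : bIdx n n (Sum.inl i) < bIdx n n (Sum.inr i) := by simp only [bIdx]; omega
      have h5 : lw τ (bIdx n n) (idD n).pair (Sum.elim (fun i => !s i) t) (Sum.inl i) =
          if (!s i) = t i then 0 else if !s i then τ else 1 := if_pos h4
      rw [h5]
      cases s i <;> cases t i <;> simp [hτ]
    rw [Finset.prod_congr rfl fun i _ => h3 i]
    split_ifs with h
    · simp [h]
    · obtain ⟨i, hi⟩ := Function.ne_iff.1 h
      exact Finset.prod_eq_zero (Finset.mem_univ i) (if_neg hi)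
  rw [lm, key]
  simp only [lab_injOn hu hv]

/-- The entries of the cap. -/
def capw (τ : K) (a b : Bool) : K := if a = b then 0 else if a then 1 else τ

/-- The entries of the cup. -/
def cupw (τ : K) (a b : Bool) : K := if a = b then 0 else if a then τ⁻¹ else 1

theorem lm_cap (τ : K) (a b : Bool) (u) : lm τ (capHom K) u [a, b] = capw τ a b := by
  have : lm τ (capHom K) u [a, b] = wt τ capD (lab 0 u) (lab 2 [a, b]) := mat_single τ _ _ _
  rw [this, wt, Wt, Fintype.prod_sum_type, Fin.prod_univ_two]
  simp [fac, lw, capD, bIdx, lab, capw]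
  cases a <;> cases b <;> simp

theorem lm_cup {τ : K} (hτ : τ ≠ 0) (a b : Bool) (v) : lm τ (cupHom K) [a, b] v = cupw τ a b := by
  have : lm τ (cupHom K) [a, b] v = wt τ cupD (lab 2 [a, b]) (lab 0 v) := mat_single τ _ _ _
  rw [this, wt, Wt, Fintype.prod_sum_type, Fin.prod_univ_two]
  simp [fac, lw, cupD, bIdx, lab, cupw]
  cases a <;> cases b <;> simp [hτ]

/-- The charge of a word. -/
def chg (w : List Bool) : ℤ := (w.count false : ℤ) - w.count true

theorem charge_lab {m : ℕ} {w : List Bool} (h : w.length = m) : charge (lab m w) = chg w := by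
  induction w generalizing m with
  | nil => subst h; simp [charge, chg]
  | cons a w ih =>
    obtain rfl : m = w.length + 1 := by simpa using h.symm
    have := ih rfl
    simp only [charge, Fin.sum_univ_succ] at this ⊢
    have e : ∀ i : Fin w.length, lab (w.length + 1) (a :: w) i.succ = lab w.length w i := by
      intro i; simp [lab]
    simp only [e, this]
    simp only [lab, chg, Fin.val_zero, List.getD_cons_zero]
    cases a <;> simp <;> ring

theorem chg_eq_of_lm_ne_zero {τ : K} {m n : ℕ} {x : Hom K m n} {u v} (hu : u.length = m)
    (hv : v.length = n) (h : lm τ x u v ≠ 0) : chg u = chg v := by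
  rw [← charge_lab hu, ← charge_lab hv]
  exact charge_eq_of_mat_ne_zero h

theorem Tr_eq [CharZero K] {τ : K} (hτ : τ ≠ 0) (hd : τ + τ⁻¹ ≠ 0) {n : ℕ}
    (x : Hom K n n) : Tr (τ + τ⁻¹) x = ∑ w ∈ words n, τ ^ chg w * lm τ x w w := by
  rw [Tr_formula hτ hd, sum_words]
  refine Finset.sum_congr rfl fun g _ => ?_
  rw [traceWt_eq_zpow hτ, ← charge_lab (m := n) (by simp), lm]
  simp

/-! ### Ideals in terms of matrix entries -/

/-- The ideal of all morphisms. -/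
def full (K : Type) [Field K] : ∀ m n : ℕ, Set (Hom K m n) := fun _ _ => Set.univ

theorem isIdeal_full (d : K) : IsIdeal d (full K) := by
  constructor <;> intros <;> trivial

/-- The vector `x` (indexed by words) is that of a morphism in `J 0 k`. -/
def JL (τ : K) (J : ∀ m n : ℕ, Set (Hom K m n)) (k : ℕ) (x : List Bool → K) : Prop :=
  ∃ h ∈ J 0 k, ∀ u v, u.length = 0 → v.length = k → lm τ h u v = x v

section Closure
variable {τ : K} {J : ∀ m n : ℕ, Set (Hom K m n)}

theorem JL.congr {k : ℕ} {x y : List Bool → K} (h : JL τ J k x) (e : ∀ w, w.length = k → x w = y w) :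
    JL τ J k y := by
  obtain ⟨g, hg, h⟩ := h
  exact ⟨g, hg, fun u v hu hv => (h u v hu hv).trans (e v hv)⟩

theorem JL.cast {k k' : ℕ} {x : List Bool → K} (h : JL τ J k x) (e : k = k') : JL τ J k' x := e ▸ h

theorem JL.mono {J' : ∀ m n : ℕ, Set (Hom K m n)} (hJ : ∀ m n, J m n ⊆ J' m n) {k : ℕ}
    {x : List Bool → K} (h : JL τ J k x) : JL τ J' k x := by
  obtain ⟨g, hg, h⟩ := h
  exact ⟨g, hJ _ _ hg, h⟩

theorem JL.to_full {k : ℕ} {x : List Bool → K} (h : JL τ J k x) : JL τ (full K) k x :=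
  h.mono fun _ _ _ _ => trivial

theorem JL.add {d : K} (hJ : IsIdeal d J) {k : ℕ} {x y : List Bool → K} (hx : JL τ J k x)
    (hy : JL τ J k y) : JL τ J k fun w => x w + y w := by
  obtain ⟨g, hg, h⟩ := hx
  obtain ⟨g', hg', h'⟩ := hy
  exact ⟨g + g', hJ.add_mem _ _ _ hg _ hg',
    fun u v hu hv => by rw [lm_add, h u v hu hv, h' u v hu hv]⟩

theorem JL.smul {d : K} (hJ : IsIdeal d J) {k : ℕ} {x : List Bool → K} (c : K) (hx : JL τ J k x) :
    JL τ J k fun w => c * x w := by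
  obtain ⟨g, hg, h⟩ := hx
  exact ⟨c • g, hJ.smul_mem _ _ c _ hg, fun u v hu hv => by rw [lm_smul, h u v hu hv]⟩

theorem JL.zero {d : K} (hJ : IsIdeal d J) (k : ℕ) : JL τ J k fun _ => 0 :=
  ⟨0, hJ.zero_mem _ _, fun u v _ _ => lm_zero τ u v⟩

theorem JL.sum {d : K} (hJ : IsIdeal d J) {k : ℕ} {ι : Type} (s : Finset ι) {x : ι → List Bool → K}
    (hx : ∀ i ∈ s, JL τ J k (x i)) : JL τ J k fun w => ∑ i ∈ s, x i w := by
  induction s using Finset.induction_on with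
  | empty => simpa using JL.zero hJ k
  | insert a s ha ih =>
    refine ((hx a (by simp)).add hJ (ih fun i hi => hx i (by simp [hi]))).congr fun w _ => ?_
    rw [Finset.sum_insert ha]

/-- Juxtaposition of two vectors. -/
def juxtF (k : ℕ) (x y : List Bool → K) (w : List Bool) : K := x (w.take k) * y (w.drop k)

theorem juxtF_append {k : ℕ} (x y : List Bool → K) {p : List Bool} (s) (hp : p.length = k) :
    juxtF k x y (p ++ s) = x p * y s := by
  simp [juxtF, ← hp]

theorem JL.juxt_left {d : K} (hJ : IsIdeal d J) {k l : ℕ} {x y : List Bool → K} (hx : JL τ J k x)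
    (hy : JL τ (full K) l y) : JL τ J (k + l) (juxtF k x y) := by
  obtain ⟨g, hg, h⟩ := hx
  obtain ⟨g', -, h'⟩ := hy
  refine ⟨tensor g g', hJ.tensor_mem_left g g' hg, fun u v hu hv => ?_⟩
  obtain rfl : u = [] := List.length_eq_zero_iff.1 hu
  have := lm_tensor τ g g' (u := []) (u' := []) (v := v.take k) (v' := v.drop k) rfl (by simp [hv])
  rw [List.take_append_drop] at this
  exact this.trans (by rw [h _ _ rfl (by simp [hv]), h' _ _ rfl (by simp [hv])]; rfl)

theorem JL.juxt_right {d : K} (hJ : IsIdeal d J) {k l : ℕ} {x y : List Bool → K}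
    (hx : JL τ (full K) k x) (hy : JL τ J l y) : JL τ J (k + l) (juxtF k x y) := by
  obtain ⟨g, -, h⟩ := hx
  obtain ⟨g', hg', h'⟩ := hy
  refine ⟨tensor g g', hJ.tensor_mem_right g g' hg', fun u v hu hv => ?_⟩
  obtain rfl : u = [] := List.length_eq_zero_iff.1 hu
  have := lm_tensor τ g g' (u := []) (u' := []) (v := v.take k) (v' := v.drop k) rfl (by simp [hv])
  rw [List.take_append_drop] at this
  exact this.trans (by rw [h _ _ rfl (by simp [hv]), h' _ _ rfl (by simp [hv])]; rfl)

theorem sum_delta_right {m : ℕ} {q : List Bool} (hq : q.length = m) (F : List Bool → K) :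
    ∑ p ∈ words m, F p * (if p = q then 1 else 0) = F q := by
  rw [Finset.sum_eq_single q]
  · simp
  · intro b _ hb; simp [hb]
  · intro h; simp [hq] at h

theorem sum_words_two {M : Type} [AddCommMonoid M] (F : List Bool → M) :
    ∑ w ∈ words 2, F w = F [true, true] + F [true, false] + (F [false, true] + F [false, false]) := by
  rw [show (2 : ℕ) = 1 + 1 from rfl, sum_words_succ, sum_words_one, sum_words_one]

theorem exists_cup_op (hτ : τ ≠ 0) (i j : ℕ) : ∃ D : Hom K (i + 2 + j) (i + j),
    ∀ p b c s p' s', p.length = i → s.length = j → p'.length = i → s'.length = j →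
      lm τ D (p ++ [b, c] ++ s) (p' ++ s') =
        (if p = p' then 1 else 0) * cupw τ b c * (if s = s' then 1 else 0) := by
  refine ⟨tensor (tensor (idHom K i) (cupHom K)) (idHom K j), ?_⟩
  intro p b c s p' s' hp hs hp' hs'
  have h1 := lm_tensor τ (tensor (idHom K i) (cupHom K)) (idHom K j) (u := p ++ [b, c]) (u' := s)
    (v := p' ++ []) (v' := s') (by simp [hp]) (by simp [hp'])
  rw [lm_tensor τ _ _ hp hp', lm_cup hτ, lm_id hτ hp hp', lm_id hτ hs hs', List.append_nil] at h1
  exact h1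

theorem exists_cap_op (hτ : τ ≠ 0) (i j : ℕ) : ∃ D : Hom K (i + j) (i + 2 + j),
    ∀ p b c s p' s', p.length = i → s.length = j → p'.length = i → s'.length = j →
      lm τ D (p' ++ s') (p ++ [b, c] ++ s) =
        (if p' = p then 1 else 0) * capw τ b c * (if s' = s then 1 else 0) := by
  refine ⟨tensor (tensor (idHom K i) (capHom K)) (idHom K j), ?_⟩
  intro p b c s p' s' hp hs hp' hs'
  have h1 := lm_tensor τ (tensor (idHom K i) (capHom K)) (idHom K j) (v := p ++ [b, c]) (v' := s)
    (u := p' ++ []) (u' := s') (by simp [hp']) (by simp [hp])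
  rw [lm_tensor τ _ _ hp' hp, lm_cap, lm_id hτ hp' hp, lm_id hτ hs' hs, List.append_nil] at h1
  exact h1

theorem sum_cup_op {i j : ℕ} {D : List Bool → K} (x : List Bool → K) {p' s' : List Bool}
    (hp' : p'.length = i) (hs' : s'.length = j)
    (hD : ∀ p b c s, p.length = i → s.length = j → D (p ++ [b, c] ++ s) =
        (if p = p' then 1 else 0) * cupw τ b c * (if s = s' then 1 else 0)) :
    ∑ w ∈ words (i + 2 + j), x w * D w =
      x (p' ++ false :: true :: s') + τ⁻¹ * x (p' ++ true :: false :: s') := by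
  rw [sum_words_append, sum_words_append]
  have e : ∀ p ∈ words i, ∑ r ∈ words 2, ∑ s ∈ words j, x (p ++ r ++ s) * D (p ++ r ++ s) =
      (x (p ++ false :: true :: s') + τ⁻¹ * x (p ++ true :: false :: s')) *
        (if p = p' then 1 else 0) := by
    intro p hp
    have e' : ∀ b c, ∑ s ∈ words j, x (p ++ [b, c] ++ s) * D (p ++ [b, c] ++ s) =
        x (p ++ [b, c] ++ s') * ((if p = p' then 1 else 0) * cupw τ b c) := by
      intro b c
      rw [← sum_delta_right hs' fun s =>
        x (p ++ [b, c] ++ s) * ((if p = p' then 1 else 0) * cupw τ b c)]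
      refine Finset.sum_congr rfl fun s hs => ?_
      rw [hD p b c s (mem_words.1 hp) (mem_words.1 hs)]
      ring
    rw [sum_words_two, e', e', e', e']
    by_cases hpp : p = p'
    · simp [cupw, hpp]
      ring
    · simp [hpp]
  rw [Finset.sum_congr rfl e, sum_delta_right hp']

/-- Contraction of a vector at positions `i`, `i + 1`. -/
def ctrF (τ : K) (i : ℕ) (x : List Bool → K) (w : List Bool) : K :=
  x (w.take i ++ false :: true :: w.drop i) + τ⁻¹ * x (w.take i ++ true :: false :: w.drop i)

theorem ctrF_append {i : ℕ} (x : List Bool → K) {p : List Bool} (s) (hp : p.length = i) :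
    ctrF τ i x (p ++ s) = x (p ++ false :: true :: s) + τ⁻¹ * x (p ++ true :: false :: s) := by
  simp [ctrF, ← hp]

theorem forall_append {i j : ℕ} {Q : List Bool → Prop}
    (h : ∀ p s : List Bool, p.length = i → s.length = j → Q (p ++ s)) (w : List Bool)
    (hw : w.length = i + j) : Q w := by
  have := h (w.take i) (w.drop i) (by simp [hw]) (by simp [hw])
  rwa [List.take_append_drop] at this

theorem JL.ctr [CharZero K] (hτ : τ ≠ 0) (hd : τ + τ⁻¹ ≠ 0) (hJ : IsIdeal (τ + τ⁻¹) J) (i j : ℕ)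
    {x : List Bool → K} (hx : JL τ J (i + 2 + j) x) : JL τ J (i + j) (ctrF τ i x) := by
  obtain ⟨g, hg, h⟩ := hx
  obtain ⟨D, hD⟩ := exists_cup_op hτ i j
  refine ⟨comp (τ + τ⁻¹) D g, hJ.comp_mem_left _ _ hg, fun u v hu => ?_⟩
  revert v
  refine forall_append fun p s hp hs => ?_
  rw [lm_comp hτ hd, ctrF_append x s hp, ← sum_cup_op (D := fun w => lm τ D w (p ++ s)) x hp hs
    fun q b c r hq hr => hD q b c r p s hq hr hp hs]
  exact Finset.sum_congr rfl fun w hw => by rw [h u w hu (mem_words.1 hw)]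

/-- Insertion of a cap at positions `i`, `i + 1`. -/
def insF (τ : K) (i : ℕ) (x : List Bool → K) (w : List Bool) : K :=
  capw τ (w.getD i false) (w.getD (i + 1) false) * x (w.take i ++ w.drop (i + 2))

theorem insF_append {i : ℕ} (x : List Bool → K) {p : List Bool} (b c s) (hp : p.length = i) :
    insF τ i x (p ++ b :: c :: s) = capw τ b c * x (p ++ s) := by
  subst hp
  simp [insF]

theorem forall_append_two {i j : ℕ} {Q : List Bool → Prop}
    (h : ∀ (p : List Bool) (b c : Bool) (s : List Bool), p.length = i → s.length = j →
      Q (p ++ b :: c :: s)) (w : List Bool)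
    (hw : w.length = i + 2 + j) : Q w := by
  refine forall_append (i := i) (j := 2 + j) (fun p s hp hs => ?_) w (by omega)
  obtain ⟨b, c, s, rfl⟩ : ∃ b c r, s = b :: c :: r := by
    rcases s with _ | ⟨b, _ | ⟨c, s⟩⟩
    · simp at hs; omega
    · simp at hs; omega
    · exact ⟨b, c, s, rfl⟩
  exact h p b c s hp (by simp at hs; omega)

theorem JL.ins [CharZero K] (hτ : τ ≠ 0) (hd : τ + τ⁻¹ ≠ 0) (hJ : IsIdeal (τ + τ⁻¹) J) (i j : ℕ)
    {x : List Bool → K} (hx : JL τ J (i + j) x) : JL τ J (i + 2 + j) (insF τ i x) := by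
  obtain ⟨g, hg, h⟩ := hx
  obtain ⟨D, hD⟩ := exists_cap_op hτ i j
  refine ⟨comp (τ + τ⁻¹) D g, hJ.comp_mem_left _ _ hg, fun u v hu => ?_⟩
  revert v
  refine forall_append_two fun p b c s hp hs => ?_
  rw [lm_comp hτ hd, insF_append x b c s hp, sum_words_append,
    ← sum_delta_right hp fun p' => capw τ b c * x (p' ++ s)]
  refine Finset.sum_congr rfl fun p' hp' => ?_
  rw [← sum_delta_right hs fun s' => capw τ b c * x (p' ++ s') * if p' = p then 1 else 0]
  refine Finset.sum_congr rfl fun s' hs' => ?_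
  have := hD p b c s p' s' hp hs (mem_words.1 hp') (mem_words.1 hs')
  rw [List.append_assoc] at this
  rw [h u _ hu (by simp [mem_words.1 hp', mem_words.1 hs'])]
  refine (congrArg (fun z => x (p' ++ s') * z) this).trans ?_
  ring

/-- The reversed and flipped word. -/
def bar (u : List Bool) : List Bool := (u.map not).reverse

@[simp] theorem bar_length (u : List Bool) : (bar u).length = u.length := by simp [bar]

@[simp] theorem bar_bar (u : List Bool) : bar (bar u) = u := by
  simp [bar, List.map_reverse, Function.comp_def]

/-- The weight of a bundle of nested contractions. -/
def kap (τ : K) (u : List Bool) : K := τ⁻¹ ^ u.count true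

/-- Contraction of `2 * c` letters starting at position `i` by nested cups. -/
noncomputable def mctrF (τ : K) (c i : ℕ) (x : List Bool → K) (w : List Bool) : K :=
  ∑ u ∈ words c, kap τ u * x (w.take i ++ (u ++ (bar u ++ w.drop i)))

theorem mctrF_append {c i : ℕ} (x : List Bool → K) {p : List Bool} (s) (hp : p.length = i) :
    mctrF τ c i x (p ++ s) = ∑ u ∈ words c, kap τ u * x (p ++ (u ++ (bar u ++ s))) := by
  simp [mctrF, ← hp]

theorem mctrF_succ (c i : ℕ) (x : List Bool → K) {p : List Bool} (s) (hp : p.length = i) :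
    mctrF τ (c + 1) i x (p ++ s) = mctrF τ c i (ctrF τ (i + c) x) (p ++ s) := by
  rw [mctrF_append _ _ hp, mctrF_append _ _ hp, sum_words_succ']
  refine Finset.sum_congr rfl fun u hu => ?_
  have hl : (p ++ u).length = i + c := by simp [hp, mem_words.1 hu]
  have := ctrF_append (τ := τ) x (bar u ++ s) hl
  rw [List.append_assoc] at this
  rw [this]
  simp [bar, kap, pow_succ]
  ring

theorem JL.mctr [CharZero K] (hτ : τ ≠ 0) (hd : τ + τ⁻¹ ≠ 0) (hJ : IsIdeal (τ + τ⁻¹) J)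
    (c i j : ℕ) {x : List Bool → K} (hx : JL τ J (i + (c + c) + j) x) :
    JL τ J (i + j) (mctrF τ c i x) := by
  induction c generalizing x with
  | zero =>
    refine (hx.cast (by omega)).congr fun w _ => ?_
    simp [mctrF, sum_words_zero, kap, bar]
  | succ c ih =>
    have h1 := JL.ctr hτ hd hJ (i + c) (c + j) (hx.cast (by omega))
    refine (ih (h1.cast (by omega))).congr ?_
    exact forall_append fun p s hp hs => (mctrF_succ c i x s hp).symm

end Closure

/-! ### Inversions and Gaussian binomials -/

/-- The number of inversions of a word. -/
def inv : List Bool → ℕ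
  | [] => 0
  | true :: w => inv w
  | false :: w => w.count true + inv w

theorem inv_append (p s : List Bool) :
    inv (p ++ s) = inv p + inv s + p.count false * s.count true := by
  induction p with
  | nil => simp [inv]
  | cons a p ih =>
    cases a <;> (simp [inv, ih]; try ring)

theorem inv_replicate (a : Bool) (k : ℕ) : inv (List.replicate k a) = 0 := by
  induction k with
  | zero => rfl
  | succ k ih => cases a <;> simp [List.replicate_succ, inv, ih, List.count_replicate]

theorem count_bar (a : Bool) (u : List Bool) : (bar u).count a = u.count (!a) := by
  simp only [bar, List.count_reverse]
  induction u with
  | nil => rfl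
  | cons b u ih => cases a <;> cases b <;> simp_all

theorem bar_cons (a : Bool) (u : List Bool) : bar (a :: u) = bar u ++ [!a] := by simp [bar]

theorem inv_bar (u : List Bool) : inv (bar u) = inv u := by
  induction u with
  | nil => rfl
  | cons a u ih => cases a <;> (simp [bar_cons, inv_append, inv, ih, count_bar]; try ring)

/-- The sorted rearrangement of a word. -/
def srt (w : List Bool) : List Bool :=
  List.replicate (w.count true) true ++ List.replicate (w.count false) false

/-- Exchanging adjacent letters multiplies `x` by `σ`. -/
def Adj (σ : K) (N : ℕ) (x : List Bool → K) : Prop :=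
  ∀ p s : List Bool, p.length + s.length + 2 = N →
    x (p ++ false :: true :: s) = σ * x (p ++ true :: false :: s)

theorem Adj.move {σ : K} {N : ℕ} {x : List Bool → K} (h : Adj σ N x) (a : ℕ) (p r : List Bool)
    (hN : p.length + a + r.length + 1 = N) :
    x (p ++ false :: (List.replicate a true ++ r)) =
      σ ^ a * x (p ++ (List.replicate a true ++ false :: r)) := by
  induction a generalizing p with
  | zero => simp
  | succ a ih =>
    have h1 := h p (List.replicate a true ++ r) (by simp; omega)
    have h2 := ih (p ++ [true]) (by simp; omega)
    simp only [List.append_assoc, List.singleton_append] at h2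
    rw [List.replicate_succ, List.cons_append, h1, h2, pow_succ']
    simp [mul_assoc]

theorem Adj.eq_srt {σ : K} (w : List Bool) : ∀ {N : ℕ} {x : List Bool → K}, Adj σ N x →
    w.length = N → x w = σ ^ inv w * x (srt w) := by
  induction w with
  | nil => intro N x h hw; simp [inv, srt]
  | cons a w ih =>
    intro N x h hw
    obtain ⟨N, rfl⟩ : ∃ M, N = M + 1 := ⟨w.length, by simpa using hw.symm⟩
    have h1 : Adj σ N fun v => x (a :: v) := by
      intro p s hps
      exact h (a :: p) s (by simp; omega)
    have h2 := ih h1 (by simpa using hw)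
    rw [h2]
    cases a with
    | true => simp [inv, srt, List.replicate_succ]
    | false =>
      have hl : w.count true + w.count false = w.length := List.count_true_add_count_false w
      have h3 := h.move (w.count true) [] (List.replicate (w.count false) false)
        (by simp at hw ⊢; omega)
      simp only [List.nil_append] at h3
      simp only [srt, inv, List.count_cons_self, List.replicate_succ]
      rw [h3]
      simp [pow_add, mul_comm, mul_left_comm, mul_assoc]

/-- Gaussian binomial coefficients. -/
def gb (ω : K) : ℕ → ℕ → K
  | 0, 0 => 1
  | 0, _ + 1 => 0
  | _ + 1, 0 => 1
  | N + 1, i + 1 => gb ω N i + ω ^ (i + 1) * gb ω N (i + 1)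

theorem gb_zero (ω : K) (N : ℕ) : gb ω N 0 = 1 := by cases N <;> rfl

theorem sum_inv (ω : K) (N i : ℕ) :
    ∑ u ∈ words N, (if u.count true = i then ω ^ inv u else 0) = gb ω N i := by
  induction N generalizing i with
  | zero => cases i <;> simp [sum_words_zero, gb, inv]
  | succ N ih =>
    rw [sum_words_succ]
    cases i with
    | zero =>
      have := ih 0
      simp only [inv, List.count_cons_self, Nat.add_eq_zero_iff, one_ne_zero, and_false, if_false,
        Finset.sum_const_zero, zero_add, gb]
      rw [gb_zero] at this
      rw [← this]
      refine Finset.sum_congr rfl fun u _ => ?_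
      by_cases hu : u.count true = 0 <;> simp [hu]
    | succ i =>
      rw [gb, ← ih i, ← ih (i + 1), Finset.mul_sum]
      congr 1
      · refine Finset.sum_congr rfl fun u _ => ?_
        simp [inv]
      · refine Finset.sum_congr rfl fun u _ => ?_
        by_cases hu : u.count true = i + 1 <;> simp [hu, inv, pow_add]

theorem gb_step (ω : K) (N b : ℕ) :
    ω ^ b * (1 - ω ^ (b + 1)) * gb ω N (b + 1) = (ω ^ b - ω ^ N) * gb ω N b := by
  induction N generalizing b with
  | zero => cases b <;> simp [gb]
  | succ N ih =>
    cases b with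
    | zero =>
      have := ih 0
      rw [gb_zero] at this ⊢
      rw [gb, gb_zero]
      linear_combination ω * this
    | succ c =>
      have h1 := ih c
      have h2 := ih (c + 1)
      rw [gb, gb]
      linear_combination ω ^ (c + 2) * h2 + ω * h1

theorem gb_eq_zero (ω : K) {N i : ℕ} (h : N < i) : gb ω N i = 0 := by
  induction N generalizing i with
  | zero => cases i <;> simp_all [gb]
  | succ N ih =>
    obtain ⟨i, rfl⟩ : ∃ j, i = j + 1 := ⟨i - 1, by omega⟩
    rw [gb, ih (by omega), ih (by omega)]; simp

theorem gb_self (ω : K) (N : ℕ) : gb ω N N = 1 := by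
  induction N with
  | zero => rfl
  | succ N ih => rw [gb, ih, gb_eq_zero ω (Nat.lt_succ_self N)]; simp

theorem gb_congr {ω : K} {n : ℕ} (hω : IsPrimitiveRoot ω n) (hn : 0 < n) {M M' : ℕ}
    (h : ω ^ M = ω ^ M') (b : ℕ) (hb : b < n) : gb ω M b = gb ω M' b := by
  induction b with
  | zero => rw [gb_zero, gb_zero]
  | succ b ih =>
    have h1 := gb_step ω M b
    have h2 := gb_step ω M' b
    rw [ih (by omega), h, ← h2] at h1
    have h3 : ω ^ (b + 1) ≠ 1 := hω.pow_ne_one_of_pos_of_lt (by omega) hb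
    refine mul_left_cancel₀ (mul_ne_zero (pow_ne_zero _ (hω.ne_zero hn.ne')) ?_) h1
    exact sub_ne_zero.2 h3.symm

theorem gb_nat {ω : K} {n : ℕ} (hω : IsPrimitiveRoot ω n) (hn : 0 < n) (M : ℕ) :
    ∃ k : ℕ, gb ω M n = k := by
  obtain ⟨a, rfl⟩ : ∃ a, n = a + 1 := ⟨n - 1, by omega⟩
  induction M with
  | zero => exact ⟨0, by simp [gb]⟩
  | succ M ih =>
    obtain ⟨k, hk⟩ := ih
    have h1 : gb ω M a = gb ω (M % (a + 1)) a :=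
      gb_congr hω hn (by rw [← pow_mod_orderOf ω M, ← hω.eq_orderOf]) a (by omega)
    rw [gb, hk, hω.pow_eq_one, h1]
    rcases (Nat.lt_succ_iff.1 (Nat.mod_lt M hn)).lt_or_eq with h2 | h2
    · exact ⟨k, by rw [gb_eq_zero ω h2]; simp⟩
    · exact ⟨k + 1, by rw [h2, gb_self]; push_cast; ring⟩

theorem eq_of_gb [CharZero K] {τ : K} {n N : ℕ} (hn : 0 < n) (hτ : τ ^ n = -1)
    (hω : IsPrimitiveRoot ((-τ⁻¹) ^ 2) n) (hN : 1 ≤ N)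
    (h : ∀ i ≤ N, gb ((-τ⁻¹) ^ 2) N i * (-τ⁻¹) ^ (i * i) = τ ^ i) : N + 1 = n := by
  have hτ0 : τ ≠ 0 := by
    rintro rfl
    rw [zero_pow hn.ne'] at hτ
    simp at hτ
  have h1 := gb_step ((-τ⁻¹) ^ 2) N 0
  have h2 := h 1 hN
  rw [gb_zero] at h1
  have h3 : ((-τ⁻¹) ^ 2) ^ (N + 1) = 1 := by
    have h5 : gb ((-τ⁻¹) ^ 2) N 1 = - τ ^ 2 := by
      have h7 : τ⁻¹ * τ = 1 := inv_mul_cancel₀ hτ0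
      simp only [mul_one, pow_one] at h2
      linear_combination -τ * h2 - gb ((-τ⁻¹) ^ 2) N 1 * h7
    simp only [zero_add, h5, pow_zero, one_mul, pow_one, mul_one] at h1
    rw [pow_succ]
    have h6 : ((-τ⁻¹) ^ 2) ^ N = τ ^ 2 := by
      have h8 : (-τ⁻¹) ^ 2 * τ ^ 2 = 1 := by field_simp
      linear_combination h1 - h8
    rw [h6]; field_simp
  have h4 : n ∣ N + 1 := hω.dvd_of_pow_eq_one _ h3
  by_contra hne
  have hle : n ≤ N := by
    have := Nat.le_of_dvd (by omega) h4
    omega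
  have h5 := h n hle
  obtain ⟨k, hk⟩ := gb_nat hω hn N
  have h6 : (-τ⁻¹) ^ (n * n) = 1 := by
    rw [pow_mul, neg_pow, inv_pow, hτ]
    rcases Nat.even_or_odd n with he | ho
    · simp [he.neg_one_pow]
    · simp [ho.neg_one_pow]
  rw [hk, h6, hτ, mul_one] at h5
  have h7 : ((k + 1 : ℕ) : K) = 0 := by push_cast; rw [h5]; ring
  exact absurd h7 (Nat.cast_ne_zero.2 (by omega))

/-! ### The lowest nonzero degree of an ideal -/

section Lowest
variable {τ : K} {J : ∀ m n : ℕ, Set (Hom K m n)}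

/-- `J 0 k` vanishes. -/
def ZeroAt (τ : K) (J : ∀ m n : ℕ, Set (Hom K m n)) (k : ℕ) : Prop :=
  ∀ x, JL τ J k x → ∀ w, w.length = k → x w = 0

theorem JL.chg_eq_zero {k : ℕ} {x : List Bool → K} (hx : JL τ J k x) {w : List Bool}
    (hw : w.length = k) (h : x w ≠ 0) : chg w = 0 := by
  obtain ⟨g, -, hg⟩ := hx
  rw [← hg [] w rfl hw] at h
  simpa [chg] using (chg_eq_of_lm_ne_zero (u := []) rfl hw h).symm

theorem JL.adj [CharZero K] (hτ : τ ≠ 0) (hd : τ + τ⁻¹ ≠ 0) (hJ : IsIdeal (τ + τ⁻¹) J) {k : ℕ}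
    {x : List Bool → K} (hx : JL τ J k x) (hz : ∀ m, m + 2 = k → ZeroAt τ J m) :
    Adj (-τ⁻¹) k x := by
  intro p s hps
  have h1 := JL.ctr hτ hd hJ p.length s.length (hx.cast (by omega))
  have h2 := hz _ (by omega) _ h1 (p ++ s) (by simp)
  rw [ctrF_append x s rfl] at h2
  linear_combination h2

theorem count_of_chg {N : ℕ} {w : List Bool} (hw : w.length = N + N) (hc : chg w = 0) :
    w.count true = N ∧ w.count false = N := by
  have hl : w.count true + w.count false = w.length := List.count_true_add_count_false w
  simp only [chg] at hc
  omega

theorem Adj.eq_base {σ : K} {N : ℕ} {x : List Bool → K} (h : Adj σ (N + N) x) {w : List Bool}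
    (hw : w.length = N + N) (hc : chg w = 0) :
    x w = σ ^ inv w * x (List.replicate N true ++ List.replicate N false) := by
  rw [h.eq_srt w hw, srt, (count_of_chg hw hc).1, (count_of_chg hw hc).2]

/-- Gaussian binomials are forced by a contracted square being proportional to a sorted vector. -/
theorem gb_of_mctr {N : ℕ} (hτ : τ ≠ 0) {x z : List Bool → K} {y : K} (hy : y ≠ 0)
    (hx : ∀ w, w.length = N + N → x w = if chg w = 0 then (-τ⁻¹) ^ inv w * y else 0)
    (hz : ∀ w, w.length = N + N → chg w = 0 → z w = (-τ⁻¹) ^ inv w *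
      z (List.replicate N true ++ List.replicate N false))
    (h : ∀ p s : List Bool, p.length = N → s.length = N →
      z (p ++ s) = ∑ u ∈ words N, kap τ u * (x (p ++ u) * x (bar u ++ s))) :
    ∀ i ≤ N, gb ((-τ⁻¹) ^ 2) N i * (-τ⁻¹) ^ (i * i) = τ ^ i := by
  have key : ∀ i ≤ N, (-τ⁻¹) ^ (i * i) * z (List.replicate N true ++ List.replicate N false) =
      τ⁻¹ ^ i * (-τ⁻¹) ^ (2 * (i * i)) * y ^ 2 * gb ((-τ⁻¹) ^ 2) N i := by
    intro i hi
    set p := List.replicate (N - i) true ++ List.replicate i false with hp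
    set s := List.replicate i true ++ List.replicate (N - i) false with hs
    have hpl : p.length = N := by simp [hp]; omega
    have hsl : s.length = N := by simp [hs]; omega
    have cp : p.count true = N - i ∧ p.count false = i := by
      simp [hp, List.count_replicate]
    have cs : s.count true = i ∧ s.count false = N - i := by
      simp [hs, List.count_replicate]
    have ip : inv p = 0 := by simp [hp, inv_append, inv_replicate, List.count_replicate]
    have is : inv s = 0 := by simp [hs, inv_append, inv_replicate, List.count_replicate]
    clear_value p s
    have h1 := hz (p ++ s) (by simp [hpl, hsl])
      (by simp only [chg, List.count_append, cp, cs]; omega)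
    rw [inv_append, ip, is, cp.2, cs.1, zero_add, zero_add] at h1
    rw [← h1, h p s hpl hsl, ← sum_inv, Finset.mul_sum]
    refine Finset.sum_congr rfl fun u hu => ?_
    have hul : u.length = N := mem_words.1 hu
    have hl : u.count true + u.count false = u.length := List.count_true_add_count_false u
    rw [hx _ (by simp [hpl, hul]), hx _ (by simp [hsl, hul])]
    by_cases hui : u.count true = i
    · have c1 : chg (p ++ u) = 0 := by
        simp only [chg, List.count_append, cp]; omega
      have c2 : chg (bar u ++ s) = 0 := by
        simp only [chg, List.count_append, cs, count_bar, Bool.not_true, Bool.not_false]; omega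
      rw [if_pos c1, if_pos c2, if_pos hui, inv_append, inv_append, inv_bar, ip, is, kap, hui,
        count_bar, Bool.not_false, hui, cp.2, cs.1]
      generalize -τ⁻¹ = σ
      ring
    · have c1 : chg (p ++ u) ≠ 0 := by
        simp only [chg, List.count_append, cp]; omega
      rw [if_neg c1, if_neg hui]
      simp
  have h0 := key 0 (Nat.zero_le _)
  simp only [gb_zero, mul_zero, pow_zero, one_mul, mul_one] at h0
  intro i hi
  have h1 := key i hi
  rw [h0] at h1
  have hσ : (-τ⁻¹) ^ (i * i) ≠ 0 := pow_ne_zero _ (neg_ne_zero.2 (inv_ne_zero hτ))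
  have hτi : τ ^ i * τ⁻¹ ^ i = 1 := by rw [← mul_pow, mul_inv_cancel₀ hτ, one_pow]
  have h2 : (-τ⁻¹) ^ (i * i) * y ^ 2 * 1 = (-τ⁻¹) ^ (i * i) * y ^ 2 *
      (τ⁻¹ ^ i * (gb ((-τ⁻¹) ^ 2) N i * (-τ⁻¹) ^ (i * i))) := by
    linear_combination h1
  have h3 := mul_left_cancel₀ (mul_ne_zero hσ (pow_ne_zero 2 hy)) h2
  linear_combination -τ ^ i * h3 - (gb ((-τ⁻¹) ^ 2) N i * (-τ⁻¹) ^ (i * i)) * hτi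

theorem lowest_degree [CharZero K] {n : ℕ} (hn : 0 < n) (hτn : τ ^ n = -1)
    (hω : IsPrimitiveRoot ((-τ⁻¹) ^ 2) n) (hd : τ + τ⁻¹ ≠ 0) (hJ : IsIdeal (τ + τ⁻¹) J)
    (h0 : ZeroAt τ J 0) {k : ℕ} (hz : ∀ m < k, ZeroAt τ J m) {x : List Bool → K}
    (hx : JL τ J k x) {w : List Bool} (hw : w.length = k) (hxw : x w ≠ 0) :
    ∃ N, N + 1 = n ∧ k = N + N ∧
      x (List.replicate N false ++ List.replicate N true) ≠ 0 := by
  have hτ : τ ≠ 0 := by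
    rintro rfl
    rw [zero_pow hn.ne'] at hτn
    simp at hτn
  have hc := hx.chg_eq_zero hw hxw
  obtain ⟨N, rfl⟩ : ∃ N, k = N + N := by
    refine ⟨w.count true, ?_⟩
    have hl : w.count true + w.count false = w.length := List.count_true_add_count_false w
    simp only [chg] at hc
    omega
  have hadj := hx.adj hτ hd hJ fun m hm => hz m (by omega)
  set y := x (List.replicate N true ++ List.replicate N false) with hy
  have hy0 : y ≠ 0 := by
    intro h
    rw [hadj.eq_base hw hc, ← hy, h, mul_zero] at hxw
    exact hxw rfl
  refine ⟨N, ?_, rfl, ?_⟩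
  · have hN : 1 ≤ N := by
      by_contra hN
      obtain rfl : N = 0 := by omega
      exact hxw (h0 x hx w hw)
    refine eq_of_gb hn hτn hω hN ?_
    have hzJ : JL τ J (N + N) (mctrF τ N N (juxtF (N + N) x x)) :=
      JL.mctr hτ hd hJ N N N ((hx.juxt_left hJ hx.to_full).cast (by omega))
    have zadj := hzJ.adj hτ hd hJ fun m hm => hz m (by omega)
    refine gb_of_mctr hτ hy0 (x := x) (fun v hv => ?_) (fun v hv hcv => zadj.eq_base hv hcv)
      fun p s hp hs => ?_
    · split_ifs with hcv
      · exact hadj.eq_base hv hcv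
      · by_contra hne
        exact hcv (hx.chg_eq_zero hv hne)
    · rw [mctrF_append _ _ hp]
      refine Finset.sum_congr rfl fun u hu => ?_
      rw [← List.append_assoc, juxtF_append _ _ _ (by simp [hp, mem_words.1 hu])]
  · rw [hadj.eq_base (by simp) (by simp [chg, List.count_replicate]), ← hy]
    exact mul_ne_zero (pow_ne_zero _ (neg_ne_zero.2 (inv_ne_zero hτ))) hy0

end Lowest

/-! ### Bending and partial traces -/

/-- The two-variable function `f` is the matrix of a morphism in `J m n`. -/
def ML (τ : K) (J : ∀ m n : ℕ, Set (Hom K m n)) (m n : ℕ) (f : List Bool → List Bool → K) : Prop :=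
  ∃ h ∈ J m n, ∀ u v, u.length = m → v.length = n → lm τ h u v = f u v

/-- Matrix of a tensor product. -/
def tenF (m n : ℕ) (f g : List Bool → List Bool → K) (u v : List Bool) : K :=
  f (u.take m) (v.take n) * g (u.drop m) (v.drop n)

theorem tenF_append {m n : ℕ} (f g : List Bool → List Bool → K) {u v : List Bool} (u' v')
    (hu : u.length = m) (hv : v.length = n) :
    tenF m n f g (u ++ u') (v ++ v') = f u v * g u' v' := by
  simp [tenF, ← hu, ← hv]

/-- Matrix of an identity morphism. -/
def idF (u v : List Bool) : K := if u = v then 1 else 0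

section Bending
variable {τ : K} {J : ∀ m n : ℕ, Set (Hom K m n)}

theorem ML.congr {m n : ℕ} {f g : List Bool → List Bool → K} (h : ML τ J m n f)
    (e : ∀ u v, u.length = m → v.length = n → f u v = g u v) : ML τ J m n g := by
  obtain ⟨x, hx, hxf⟩ := h
  exact ⟨x, hx, fun u v hu hv => (hxf u v hu hv).trans (e u v hu hv)⟩

theorem ML.cast {m n m' n' : ℕ} {f : List Bool → List Bool → K} (h : ML τ J m n f) (hm : m = m')
    (hn : n = n') : ML τ J m' n' f := by
  subst hm hn
  exact h

theorem ML.of_mem {m n : ℕ} {x : Hom K m n} (hx : x ∈ J m n) : ML τ J m n (lm τ x) :=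
  ⟨x, hx, fun _ _ _ _ => rfl⟩

theorem ML.idF (hτ : τ ≠ 0) (n : ℕ) : ML τ (full K) n n (idF (K := K)) :=
  ⟨idHom K n, Set.mem_univ _, fun _ _ hu hv => lm_id hτ hu hv⟩

theorem ML.chg_eq {m n : ℕ} {f : List Bool → List Bool → K} (h : ML τ J m n f) {u v : List Bool}
    (hu : u.length = m) (hv : v.length = n) (hne : f u v ≠ 0) : chg u = chg v := by
  obtain ⟨x, -, hxf⟩ := h
  rw [← hxf u v hu hv] at hne
  exact chg_eq_of_lm_ne_zero hu hv hne

theorem ML.comp_left [CharZero K] (hτ : τ ≠ 0) (hd : τ + τ⁻¹ ≠ 0) (hJ : IsIdeal (τ + τ⁻¹) J)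
    {l m n : ℕ} {f g : List Bool → List Bool → K} (hf : ML τ J l m f) (hg : ML τ (full K) m n g) :
    ML τ J l n fun u v => ∑ w ∈ words m, f u w * g w v := by
  obtain ⟨x, hx, hxf⟩ := hf
  obtain ⟨y, -, hyg⟩ := hg
  refine ⟨comp (τ + τ⁻¹) y x, hJ.comp_mem_left y x hx, fun u v hu hv => ?_⟩
  rw [lm_comp hτ hd]
  refine Finset.sum_congr rfl fun w hw => ?_
  rw [hxf u w hu (mem_words.1 hw), hyg w v (mem_words.1 hw) hv]

theorem ML.comp_right [CharZero K] (hτ : τ ≠ 0) (hd : τ + τ⁻¹ ≠ 0) (hJ : IsIdeal (τ + τ⁻¹) J)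
    {l m n : ℕ} {f g : List Bool → List Bool → K} (hf : ML τ (full K) l m f) (hg : ML τ J m n g) :
    ML τ J l n fun u v => ∑ w ∈ words m, f u w * g w v := by
  obtain ⟨x, -, hxf⟩ := hf
  obtain ⟨y, hy, hyg⟩ := hg
  refine ⟨comp (τ + τ⁻¹) y x, hJ.comp_mem_right y x hy, fun u v hu hv => ?_⟩
  rw [lm_comp hτ hd]
  refine Finset.sum_congr rfl fun w hw => ?_
  rw [hxf u w hu (mem_words.1 hw), hyg w v (mem_words.1 hw) hv]

theorem lm_tensor_eq {m n m' n' : ℕ} {f g : List Bool → List Bool → K} {x : Hom K m n}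
    {y : Hom K m' n'} (hx : ∀ u v, u.length = m → v.length = n → lm τ x u v = f u v)
    (hy : ∀ u v, u.length = m' → v.length = n' → lm τ y u v = g u v) {u v : List Bool}
    (hu : u.length = m + m') (hv : v.length = n + n') :
    lm τ (tensor x y) u v = tenF m n f g u v := by
  have h := lm_tensor τ x y (u := u.take m) (u' := u.drop m) (v := v.take n) (v' := v.drop n)
    (by simp [hu]) (by simp [hv])
  rw [List.take_append_drop, List.take_append_drop] at h
  rw [h, tenF, hx _ _ (by simp [hu]) (by simp [hv]), hy _ _ (by simp [hu]) (by simp [hv])]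

theorem ML.tensor_left {d : K} (hJ : IsIdeal d J) {m n m' n' : ℕ}
    {f g : List Bool → List Bool → K} (hf : ML τ J m n f) (hg : ML τ (full K) m' n' g) :
    ML τ J (m + m') (n + n') (tenF m n f g) := by
  obtain ⟨x, hx, hxf⟩ := hf
  obtain ⟨y, -, hyg⟩ := hg
  exact ⟨tensor x y, hJ.tensor_mem_left x y hx, fun u v hu hv => lm_tensor_eq hxf hyg hu hv⟩

theorem ML.tensor_right {d : K} (hJ : IsIdeal d J) {m n m' n' : ℕ}
    {f g : List Bool → List Bool → K} (hf : ML τ (full K) m n f) (hg : ML τ J m' n' g) :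
    ML τ J (m + m') (n + n') (tenF m n f g) := by
  obtain ⟨x, -, hxf⟩ := hf
  obtain ⟨y, hy, hyg⟩ := hg
  exact ⟨tensor x y, hJ.tensor_mem_right x y hy, fun u v hu hv => lm_tensor_eq hxf hyg hu hv⟩

theorem forall_concat {n : ℕ} {Q : List Bool → Prop}
    (h : ∀ (p : List Bool) (b : Bool), p.length = n → Q (p ++ [b])) (w : List Bool)
    (hw : w.length = n + 1) : Q w := by
  have := h (w.take n) (w[n]) (by simp [hw])
  have e : w.take n ++ [w[n]] = w := by
    rw [List.take_append_getElem]
    simp [← hw]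
  rwa [e] at this

theorem forall_cons {n : ℕ} {Q : List Bool → Prop}
    (h : ∀ (b : Bool) (p : List Bool), p.length = n → Q (b :: p)) (w : List Bool)
    (hw : w.length = n + 1) : Q w := by
  obtain _ | ⟨b, w⟩ := w
  · simp at hw
  · exact h b w (by simpa using hw)

/-- Bend the last top point down on the right. -/
def bendF (τ : K) (n : ℕ) (f : List Bool → List Bool → K) (u v : List Bool) : K :=
  capw τ (!(v.drop n).headD false) ((v.drop n).headD false) *
    f (u ++ [!(v.drop n).headD false]) (v.take n)

theorem bendF_append {n : ℕ} (f : List Bool → List Bool → K) (u) {v : List Bool} (b : Bool)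
    (hv : v.length = n) : bendF τ n f u (v ++ [b]) = capw τ (!b) b * f (u ++ [!b]) v := by
  simp [bendF, ← hv]

/-- Bend the first top point down on the left. -/
def lbendF (τ : K) (f : List Bool → List Bool → K) (u v : List Bool) : K :=
  capw τ (v.headD false) (!v.headD false) * f ((!v.headD false) :: u) v.tail

theorem exists_cap_right (hτ : τ ≠ 0) (m : ℕ) : ∃ g, ML τ (full K) m (m + 2) g ∧
    ∀ u p a b, u.length = m → p.length = m →
      g u (p ++ [a, b]) = (if u = p then 1 else 0) * capw τ a b := by
  obtain ⟨D, hD⟩ := exists_cap_op hτ m 0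
  refine ⟨lm τ D, ML.of_mem (Set.mem_univ _), fun u p a b hu hp => ?_⟩
  have := hD p a b [] u [] hp rfl hu rfl
  simpa using this

theorem exists_cap_left (hτ : τ ≠ 0) (m : ℕ) : ∃ g, ML τ (full K) m (2 + m) g ∧
    ∀ u p a b, u.length = m → p.length = m →
      g u ([a, b] ++ p) = (if u = p then 1 else 0) * capw τ a b := by
  obtain ⟨D, hD⟩ := exists_cap_op hτ 0 m
  refine ⟨lm τ D, (ML.of_mem (Set.mem_univ _)).cast (by omega) (by omega), fun u p a b hu hp => ?_⟩
  have := hD [] a b p [] u rfl hp rfl hu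
  rw [mul_comm] at this
  simpa [mul_comm] using this

theorem sum_delta_left {m : ℕ} {q : List Bool} (hq : q.length = m) (F : List Bool → K) :
    ∑ p ∈ words m, (if q = p then 1 else 0) * F p = F q := by
  rw [Finset.sum_eq_single q]
  · simp
  · intro b _ hb; simp [Ne.symm hb]
  · intro h; simp [hq] at h

theorem ML.bend [CharZero K] (hτ : τ ≠ 0) (hd : τ + τ⁻¹ ≠ 0) (hJ : IsIdeal (τ + τ⁻¹) J) {m n : ℕ}
    {f : List Bool → List Bool → K} (hf : ML τ J (m + 1) n f) :
    ML τ J m (n + 1) (bendF τ n f) := by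
  obtain ⟨g, hg, hgv⟩ := exists_cap_right hτ m
  refine (ML.comp_right hτ hd hJ hg (hf.tensor_left hJ (ML.idF hτ 1))).congr fun u v hu hv => ?_
  revert v
  refine forall_concat fun v b hv => ?_
  rw [bendF_append _ _ _ hv, sum_words_append,
    ← sum_delta_left hu fun p => capw τ (!b) b * f (p ++ [!b]) v]
  refine Finset.sum_congr rfl fun p hp => ?_
  have hp := mem_words.1 hp
  have e : ∀ a c, g u (p ++ [a, c]) * tenF (m + 1) n f TL.idF (p ++ [a, c]) (v ++ [b]) =
      (if u = p then 1 else 0) * (if a = c then 0 else if c = b then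
        capw τ (!b) b * f (p ++ [!b]) v else 0) := by
    intro a c
    rw [hgv u p a c hu hp, show p ++ [a, c] = (p ++ [a]) ++ [c] by simp,
      tenF_append f TL.idF [c] [b] (by simp [hp]) hv]
    cases a <;> cases c <;> cases b <;> simp [capw, TL.idF]
  rw [sum_words_two, e, e, e, e]
  cases b <;> simp

theorem ML.lbend [CharZero K] (hτ : τ ≠ 0) (hd : τ + τ⁻¹ ≠ 0) (hJ : IsIdeal (τ + τ⁻¹) J)
    {m n : ℕ} {f : List Bool → List Bool → K} (hf : ML τ J (m + 1) n f) :
    ML τ J m (n + 1) (lbendF τ f) := by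
  obtain ⟨g, hg, hgv⟩ := exists_cap_left hτ m
  refine (ML.comp_right hτ hd hJ hg (((ML.idF hτ 1).tensor_right hJ hf).cast
    (show 1 + (m + 1) = 2 + m by omega) (add_comm 1 n))).congr fun u v hu hv => ?_
  revert v
  refine forall_cons fun b v hv => ?_
  rw [show lbendF τ f u (b :: v) = capw τ b (!b) * f ((!b) :: u) v from rfl, sum_words_append,
    Finset.sum_comm, ← sum_delta_left hu fun p => capw τ b (!b) * f ((!b) :: p) v]
  refine Finset.sum_congr rfl fun p hp => ?_
  have hp := mem_words.1 hp
  have e : ∀ a c, g u ([a, c] ++ p) * tenF 1 1 TL.idF f ([a, c] ++ p) (b :: v) =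
      (if u = p then 1 else 0) * (if a = c then 0 else if a = b then
        capw τ b (!b) * f ((!b) :: p) v else 0) := by
    intro a c
    rw [hgv u p a c hu hp, show [a, c] ++ p = [a] ++ (c :: p) by simp,
      show b :: v = [b] ++ v by simp, tenF_append (m := 1) (n := 1) TL.idF f _ _ rfl rfl]
    cases a <;> cases c <;> cases b <;> simp [capw, TL.idF]
  rw [sum_words_two, e, e, e, e]
  cases b <;> simp

theorem ML.ctr [CharZero K] (hτ : τ ≠ 0) (hd : τ + τ⁻¹ ≠ 0) (hJ : IsIdeal (τ + τ⁻¹) J)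
    (m i j : ℕ) {f : List Bool → List Bool → K} (hf : ML τ J m (i + 2 + j) f) :
    ML τ J m (i + j) fun u => ctrF τ i (f u) := by
  obtain ⟨D, hD⟩ := exists_cup_op hτ i j
  refine (ML.comp_left hτ hd hJ hf (ML.of_mem (Set.mem_univ D))).congr fun u v hu hv => ?_
  revert v
  refine forall_append fun p s hp hs => ?_
  rw [ctrF_append _ s hp, ← sum_cup_op (f u) hp hs]
  intro p' b c s' hp' hs'
  exact hD p' b c s' p s hp' hs' hp hs

/-- The inverse of bending: bend the last bottom point up on the right. -/
theorem ML.unbend [CharZero K] (hτ : τ ≠ 0) (hd : τ + τ⁻¹ ≠ 0) (hJ : IsIdeal (τ + τ⁻¹) J)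
    {m n : ℕ} {f : List Bool → List Bool → K} (hf : ML τ J m (n + 1) (bendF τ n f)) :
    ML τ J (m + 1) n f := by
  refine (ML.ctr hτ hd hJ (m + 1) n 0 (hf.tensor_left hJ (ML.idF hτ 1))).congr fun u v hu hv => ?_
  have hv : v.length = n := hv
  revert u
  refine forall_concat fun u b hu => ?_
  have h := ctrF_append (τ := τ) (tenF m (n + 1) (bendF τ n f) TL.idF (u ++ [b])) [] hv
  rw [List.append_nil] at h
  have e : ∀ c c', tenF m (n + 1) (bendF τ n f) TL.idF (u ++ [b]) (v ++ [c, c']) =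
      capw τ (!c) c * f (u ++ [!c]) v * if b = c' then 1 else 0 := by
    intro c c'
    rw [show v ++ [c, c'] = (v ++ [c]) ++ [c'] by simp,
      tenF_append _ _ _ _ hu (by simp [hv]), bendF_append _ _ _ hv]
    simp [TL.idF]
  rw [h, e, e]
  cases b <;> simp [capw, hτ]

theorem ML.ptr_one [CharZero K] (hτ : τ ≠ 0) (hd : τ + τ⁻¹ ≠ 0) (hJ : IsIdeal (τ + τ⁻¹) J)
    {m n : ℕ} {f : List Bool → List Bool → K} (hf : ML τ J (m + 1) (n + 1) f) :
    ML τ J m n fun u v => τ⁻¹ * f (u ++ [true]) (v ++ [true]) +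
      τ * f (u ++ [false]) (v ++ [false]) := by
  refine (ML.ctr hτ hd hJ m n 0 (hf.bend hτ hd hJ)).congr fun u v hu hv => ?_
  have hv : v.length = n := hv
  have h := ctrF_append (τ := τ) (bendF τ (n + 1) f u) [] hv
  rw [List.append_nil] at h
  rw [h, show v ++ [false, true] = (v ++ [false]) ++ [true] by simp,
    show v ++ [true, false] = (v ++ [true]) ++ [false] by simp,
    bendF_append _ _ _ (by simp [hv]), bendF_append _ _ _ (by simp [hv])]
  simp only [capw, Bool.not_true, Bool.not_false]
  simp
  ring

theorem ML.lptr_one [CharZero K] (hτ : τ ≠ 0) (hd : τ + τ⁻¹ ≠ 0) (hJ : IsIdeal (τ + τ⁻¹) J)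
    {m n : ℕ} {f : List Bool → List Bool → K} (hf : ML τ J (m + 1) (n + 1) f) :
    ML τ J m n fun u v => τ * f (true :: u) (true :: v) + τ⁻¹ * f (false :: u) (false :: v) := by
  refine ((ML.ctr hτ hd hJ m 0 n ((hf.lbend hτ hd hJ).cast rfl (by omega))).cast rfl
    (zero_add n)).congr fun u v hu hv => ?_
  have h := ctrF_append (τ := τ) (i := 0) (lbendF τ f u) (p := []) v rfl
  simp only [List.nil_append] at h
  rw [h]
  simp [lbendF, capw]

theorem chg_append (u v : List Bool) : chg (u ++ v) = chg u + chg v := by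
  simp only [chg, List.count_append]
  push_cast
  ring

theorem chg_true : chg [true] = -1 := by simp [chg]

theorem chg_false : chg [false] = 1 := by simp [chg]

theorem ML.ptr [CharZero K] (hτ : τ ≠ 0) (hd : τ + τ⁻¹ ≠ 0) (hJ : IsIdeal (τ + τ⁻¹) J)
    {m n : ℕ} (p : ℕ) {f : List Bool → List Bool → K} (hf : ML τ J (m + p) (n + p) f) :
    ML τ J m n fun u v => ∑ w ∈ words p, τ ^ chg w * f (u ++ w) (v ++ w) := by
  induction p generalizing f with
  | zero =>
    refine ML.congr hf fun u v _ _ => ?_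
    rw [sum_words_zero]
    simp [chg]
  | succ p ih =>
    refine (ih (ML.ptr_one hτ hd hJ hf)).congr fun u v _ _ => ?_
    rw [sum_words_succ']
    refine Finset.sum_congr rfl fun w _ => ?_
    rw [chg_append, chg_append, zpow_add₀ hτ, zpow_add₀ hτ, chg_true, chg_false]
    simp only [List.append_assoc, zpow_neg_one, zpow_one]
    ring

end Bending

/-! ### Negligible morphisms form an ideal -/

section NeglIdeal
variable {τ : K}

/-- The function `f` has zero trace pairing with all morphisms. -/
def PairZero (τ : K) (m n : ℕ) (f : List Bool → List Bool → K) : Prop :=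
  ∀ g, ML τ (full K) n m g → ∑ w ∈ words m, ∑ v ∈ words n, τ ^ chg w * (f w v * g v w) = 0

theorem Tr_comp [CharZero K] (hτ : τ ≠ 0) (hd : τ + τ⁻¹ ≠ 0) {m n : ℕ} (b : Hom K n m)
    (x : Hom K m n) : Tr (τ + τ⁻¹) (comp (τ + τ⁻¹) b x) =
      ∑ w ∈ words m, ∑ v ∈ words n, τ ^ chg w * (lm τ x w v * lm τ b v w) := by
  rw [Tr_eq hτ hd]
  refine Finset.sum_congr rfl fun w _ => ?_
  rw [lm_comp hτ hd, Finset.mul_sum]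

theorem PairZero.congr {m n : ℕ} {f g : List Bool → List Bool → K} (h : PairZero τ m n f)
    (e : ∀ u v, u.length = m → v.length = n → f u v = g u v) : PairZero τ m n g := by
  intro k hk
  rw [← h k hk]
  refine Finset.sum_congr rfl fun w hw => Finset.sum_congr rfl fun v hv => ?_
  rw [e w v (mem_words.1 hw) (mem_words.1 hv)]

theorem PairZero.cast {m n m' n' : ℕ} {f : List Bool → List Bool → K} (h : PairZero τ m n f)
    (hm : m = m') (hn : n = n') : PairZero τ m' n' f := by
  subst hm hn
  exact h

theorem mem_Negl_iff [CharZero K] (hτ : τ ≠ 0) (hd : τ + τ⁻¹ ≠ 0) {m n : ℕ} {x : Hom K m n} :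
    x ∈ Negl (τ + τ⁻¹) m n ↔ PairZero τ m n (lm τ x) := by
  constructor
  · rintro h g ⟨b, -, hb⟩
    rw [← h b, Tr_comp hτ hd]
    refine Finset.sum_congr rfl fun w hw => Finset.sum_congr rfl fun v hv => ?_
    rw [hb v w (mem_words.1 hv) (mem_words.1 hw)]
  · intro h b
    rw [Tr_comp hτ hd]
    exact h _ (ML.of_mem (Set.mem_univ b))

theorem PairZero.comp_left [CharZero K] (hτ : τ ≠ 0) (hd : τ + τ⁻¹ ≠ 0)
    {l m n : ℕ} {f g : List Bool → List Bool → K} (hf : PairZero τ l m f)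
    (hg : ML τ (full K) m n g) : PairZero τ l n fun u v => ∑ w ∈ words m, f u w * g w v := by
  intro k hk
  rw [← hf _ (hg.comp_left hτ hd (isIdeal_full _) hk)]
  refine Finset.sum_congr rfl fun u _ => ?_
  simp only [Finset.mul_sum, Finset.sum_mul]
  rw [Finset.sum_comm]
  refine Finset.sum_congr rfl fun w _ => Finset.sum_congr rfl fun v _ => ?_
  ring

theorem PairZero.comp_right [CharZero K] (hτ : τ ≠ 0) (hd : τ + τ⁻¹ ≠ 0)
    {l m n : ℕ} {f g : List Bool → List Bool → K} (hf : ML τ (full K) l m f)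
    (hg : PairZero τ m n g) : PairZero τ l n fun u v => ∑ w ∈ words m, f u w * g w v := by
  intro k hk
  rw [← hg _ (hk.comp_left hτ hd (isIdeal_full _) hf)]
  simp only [Finset.mul_sum, Finset.sum_mul]
  have e : ∀ u ∈ words l, ∀ w ∈ words m, ∀ v, τ ^ chg u * (f u w * g w v * k v u) =
      τ ^ chg w * (g w v * (k v u * f u w)) := by
    intro u hu w hw v
    by_cases h : f u w = 0
    · simp [h]
    · rw [hf.chg_eq (mem_words.1 hu) (mem_words.1 hw) h]
      ring
  calc _ = ∑ u ∈ words l, ∑ v ∈ words n, ∑ w ∈ words m,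
        τ ^ chg w * (g w v * (k v u * f u w)) :=
        Finset.sum_congr rfl fun u hu => Finset.sum_congr rfl fun v _ =>
          Finset.sum_congr rfl fun w hw => e u hu w hw v
    _ = ∑ u ∈ words l, ∑ w ∈ words m, ∑ v ∈ words n,
        τ ^ chg w * (g w v * (k v u * f u w)) :=
        Finset.sum_congr rfl fun u _ => Finset.sum_comm
    _ = ∑ w ∈ words m, ∑ u ∈ words l, ∑ v ∈ words n,
        τ ^ chg w * (g w v * (k v u * f u w)) := Finset.sum_comm
    _ = _ := Finset.sum_congr rfl fun w _ => Finset.sum_comm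

theorem PairZero.strand_right [CharZero K] (hτ : τ ≠ 0) (hd : τ + τ⁻¹ ≠ 0) {m n : ℕ}
    {f F : List Bool → List Bool → K} (hf : PairZero τ m n f)
    (hF : ∀ u a v b, u.length = m → v.length = n →
      F (u ++ [a]) (v ++ [b]) = f u v * if a = b then 1 else 0) :
    PairZero τ (m + 1) (n + 1) F := by
  intro g hg
  rw [← hf _ (hg.ptr_one hτ hd (isIdeal_full _)), sum_words_succ']
  refine Finset.sum_congr rfl fun u hu => ?_
  rw [sum_words_succ', sum_words_succ', ← Finset.sum_add_distrib]
  refine Finset.sum_congr rfl fun v hv => ?_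
  have hu := mem_words.1 hu
  have hv := mem_words.1 hv
  rw [hF _ _ _ _ hu hv, hF _ _ _ _ hu hv, hF _ _ _ _ hu hv, hF _ _ _ _ hu hv, chg_append,
    chg_append, zpow_add₀ hτ, zpow_add₀ hτ, chg_true, chg_false]
  simp
  ring

theorem ML.one_one {J : ∀ m n : ℕ, Set (Hom K m n)} (hτ : τ ≠ 0) {f : List Bool → List Bool → K}
    (hf : ML τ J 1 1 f) : f [true] [true] = f [false] [false] := by
  obtain ⟨x, -, hx⟩ := hf
  have hp : ∀ p : Diagram 1 1, p = idD 1 := by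
    intro p
    refine Diagram.ext_pair ?_
    funext y
    have h1 := p.fixedPointFree y
    revert h1
    generalize p.pair y = z
    revert y z
    decide
  have : x = x (idD 1) • idHom K 1 := by
    funext p
    rw [hp p]
    simp [idHom]
  rw [← hx _ _ rfl rfl, ← hx _ _ rfl rfl, this, lm_smul, lm_smul, lm_id (n := 1) hτ rfl rfl,
    lm_id (n := 1) hτ rfl rfl]
  simp

theorem chg_cons (a : Bool) (w : List Bool) : chg (a :: w) = chg [a] + chg w :=
  chg_append [a] w

theorem PairZero.strand_left [CharZero K] (hτ : τ ≠ 0) (hd : τ + τ⁻¹ ≠ 0) {m n : ℕ}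
    {f F : List Bool → List Bool → K} (hf : PairZero τ m n f)
    (hFm : ML τ (full K) (m + 1) (n + 1) F)
    (hF : ∀ a u b v, u.length = m → v.length = n →
      F (a :: u) (b :: v) = (if a = b then 1 else 0) * f u v) :
    PairZero τ (m + 1) (n + 1) F := by
  intro g hg
  set S : Bool → K := fun a => ∑ w ∈ words m, ∑ v ∈ words n,
    τ ^ chg w * (f w v * g (a :: v) (a :: w)) with hS
  have hC := ML.ptr hτ hd (isIdeal_full _) m (((hFm.comp_left hτ hd (isIdeal_full _) hg).cast
    (add_comm m 1) (add_comm m 1)))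
  have hSt : S true = S false := by
    have h1 : ∀ a, (∑ w ∈ words m, τ ^ chg w * ∑ v ∈ words (n + 1),
        F ([a] ++ w) v * g v ([a] ++ w)) = S a := by
      intro a
      refine Finset.sum_congr rfl fun w hw => ?_
      rw [Finset.mul_sum, sum_words_succ, ← Finset.sum_add_distrib]
      refine Finset.sum_congr rfl fun v hv => ?_
      rw [show [a] ++ w = a :: w from rfl, hF _ _ _ _ (mem_words.1 hw) (mem_words.1 hv),
        hF _ _ _ _ (mem_words.1 hw) (mem_words.1 hv)]
      cases a <;> simp
    rw [← h1, ← h1]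
    exact hC.one_one hτ
  have h2 : τ * S true + τ⁻¹ * S false = 0 := by
    rw [← hf _ (hg.lptr_one hτ hd (isIdeal_full _))]
    simp only [hS, Finset.mul_sum]
    rw [← Finset.sum_add_distrib]
    refine Finset.sum_congr rfl fun w _ => ?_
    rw [← Finset.sum_add_distrib]
    refine Finset.sum_congr rfl fun v _ => ?_
    ring
  have h3 : ∑ w ∈ words (m + 1), ∑ v ∈ words (n + 1), τ ^ chg w * (F w v * g v w) =
      τ⁻¹ * S true + τ * S false := by
    rw [sum_words_succ]
    simp only [hS, Finset.mul_sum]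
    congr 1 <;>
    · refine Finset.sum_congr rfl fun w hw => ?_
      rw [sum_words_succ, ← Finset.sum_add_distrib]
      refine Finset.sum_congr rfl fun v hv => ?_
      rw [hF _ _ _ _ (mem_words.1 hw) (mem_words.1 hv),
        hF _ _ _ _ (mem_words.1 hw) (mem_words.1 hv), chg_cons,
        zpow_add₀ hτ]
      simp [chg_true, chg_false]
      ring
  rw [h3, hSt, ← h2, hSt]
  ring

theorem PairZero.strands_right [CharZero K] (hτ : τ ≠ 0) (hd : τ + τ⁻¹ ≠ 0) {m n : ℕ}
    {f : List Bool → List Bool → K} (hf : PairZero τ m n f) (p : ℕ) :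
    PairZero τ (m + p) (n + p) (tenF m n f idF) := by
  induction p with
  | zero =>
    refine PairZero.congr hf fun u v hu hv => ?_
    have hu : u.length = m := hu
    have hv : v.length = n := hv
    simp [tenF, idF, ← hu, ← hv]
  | succ p ih =>
    refine ih.strand_right hτ hd fun u a v b hu hv => ?_
    obtain ⟨u1, u2, rfl, h1, h2⟩ : ∃ u1 u2, u = u1 ++ u2 ∧ u1.length = m ∧ u2.length = p :=
      ⟨u.take m, u.drop m, by simp, by simp [hu], by simp [hu]⟩
    obtain ⟨v1, v2, rfl, h3, h4⟩ : ∃ v1 v2, v = v1 ++ v2 ∧ v1.length = n ∧ v2.length = p :=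
      ⟨v.take n, v.drop n, by simp, by simp [hv], by simp [hv]⟩
    rw [List.append_assoc, List.append_assoc, tenF_append _ _ _ _ h1 h3,
      tenF_append _ _ _ _ h1 h3, mul_assoc]
    congr 1
    rw [idF, idF, ite_zero_mul_ite_zero, mul_one]
    refine if_congr ?_ rfl rfl
    constructor
    · intro h
      have := List.append_inj h (by omega)
      simpa using this
    · rintro ⟨rfl, rfl⟩
      rfl

theorem PairZero.strands_left [CharZero K] (hτ : τ ≠ 0) (hd : τ + τ⁻¹ ≠ 0) {m n : ℕ}
    {f : List Bool → List Bool → K} (hfm : ML τ (full K) m n f) (hf : PairZero τ m n f) (p : ℕ) :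
    PairZero τ (p + m) (p + n) (tenF p p idF f) := by
  induction p with
  | zero =>
    refine (PairZero.congr hf fun u v _ _ => ?_).cast (zero_add m).symm (zero_add n).symm
    simp [tenF, idF]
  | succ p ih =>
    refine (ih.strand_left hτ hd (((ML.idF hτ (p + 1)).tensor_right (isIdeal_full 0) hfm).cast
      (by omega) (by omega)) fun a u b v hu hv => ?_).cast (by omega) (by omega)
    simp only [tenF, idF, List.take_succ_cons, List.drop_succ_cons, List.cons.injEq]
    rw [← mul_assoc, ite_zero_mul_ite_zero, mul_one]

theorem isIdeal_Negl [CharZero K] (hτ : τ ≠ 0) (hd : τ + τ⁻¹ ≠ 0) :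
    IsIdeal (τ + τ⁻¹) (Negl (τ + τ⁻¹)) where
  zero_mem m n := by
    rw [mem_Negl_iff hτ hd]
    intro g _
    simp [lm_zero]
  add_mem m n x hx y hy := by
    rw [mem_Negl_iff hτ hd] at *
    intro g hg
    simp only [lm_add, add_mul, mul_add, Finset.sum_add_distrib]
    rw [hx g hg, hy g hg, add_zero]
  smul_mem m n c x hx := by
    rw [mem_Negl_iff hτ hd] at *
    intro g hg
    rw [← mul_zero c, ← hx g hg]
    simp only [lm_smul, Finset.mul_sum]
    refine Finset.sum_congr rfl fun w _ => Finset.sum_congr rfl fun v _ => ?_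
    ring
  comp_mem_left b a ha := by
    rw [mem_Negl_iff hτ hd] at *
    refine (ha.comp_left hτ hd (ML.of_mem (Set.mem_univ b))).congr fun u v _ _ => ?_
    rw [lm_comp hτ hd]
  comp_mem_right b a hb := by
    rw [mem_Negl_iff hτ hd] at *
    refine (PairZero.comp_right hτ hd (ML.of_mem (Set.mem_univ a)) hb).congr fun u v _ _ => ?_
    rw [lm_comp hτ hd]
  tensor_mem_left {m n m' n'} x y hx := by
    rw [mem_Negl_iff hτ hd] at *
    refine ((hx.strands_right hτ hd m').comp_left hτ hd ((ML.idF hτ n).tensor_left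
      (isIdeal_full 0) (ML.of_mem (Set.mem_univ y)))).congr fun u v hu hv => ?_
    revert v
    refine forall_append fun v v' hv hv' => ?_
    revert u
    refine forall_append fun u u' hu hu' => ?_
    rw [lm_tensor τ x y hu hv, sum_words_append, ← sum_delta_right hv fun w =>
      lm τ x u w * lm τ y u' v']
    refine Finset.sum_congr rfl fun w hw => ?_
    rw [mul_right_comm, ← sum_delta_left hu' fun z => lm τ x u w * (if w = v then 1 else 0) * lm τ y z v']
    refine Finset.sum_congr rfl fun z _ => ?_
    rw [tenF_append _ _ _ _ hu (mem_words.1 hw), tenF_append _ _ _ _ (mem_words.1 hw) hv, idF, idF]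
    ring
  tensor_mem_right {m n m' n'} x y hy := by
    rw [mem_Negl_iff hτ hd] at *
    refine ((hy.strands_left hτ hd (ML.of_mem (Set.mem_univ y)) m).comp_left hτ hd ((ML.of_mem
      (Set.mem_univ x)).tensor_left (isIdeal_full 0) (ML.idF hτ n'))).congr fun u v hu hv => ?_
    revert v
    refine forall_append fun v v' hv hv' => ?_
    revert u
    refine forall_append fun u u' hu hu' => ?_
    rw [lm_tensor τ x y hu hv, sum_words_append, ← sum_delta_left hu fun w =>
      lm τ x w v * lm τ y u' v']
    refine Finset.sum_congr rfl fun w hw => ?_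
    rw [← mul_assoc, ← sum_delta_right hv' fun z => (if u = w then 1 else 0) * lm τ x w v * lm τ y u' z]
    refine Finset.sum_congr rfl fun z _ => ?_
    rw [tenF_append _ _ _ _ hu (mem_words.1 hw), tenF_append _ _ _ _ (mem_words.1 hw) hv, idF, idF]
    ring

end NeglIdeal

/-! ### Proper ideals consist of negligible morphisms, and are determined by `J 0 k` -/

section Reduction
variable {τ : K} {J J' : ∀ m n : ℕ, Set (Hom K m n)}

theorem ML.mem (hτ : τ ≠ 0) {m n : ℕ} {x : Hom K m n} (h : ML τ J m n (lm τ x)) : x ∈ J m n := by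
  obtain ⟨y, hy, e⟩ := h
  rwa [← lm_ext hτ e]

theorem JL.eq_univ (hτ : τ ≠ 0) (hJ : IsIdeal (τ + τ⁻¹) J) {x : List Bool → K} (hx : JL τ J 0 x)
    (h : x [] ≠ 0) (m n : ℕ) : J m n = Set.univ := by
  have h0 : ML τ J 0 0 fun _ _ => 1 := by
    refine (hx.smul hJ (x [])⁻¹).congr fun w hw => ?_
    rw [List.length_eq_zero_iff.1 hw, inv_mul_cancel₀ h]
  refine Set.eq_univ_of_forall fun y => ML.mem hτ ?_
  refine (ML.tensor_right hJ (ML.of_mem (Set.mem_univ y)) h0).congr fun u v hu hv => ?_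
  have hu : u.length = m := hu
  have hv : v.length = n := hv
  simp [tenF, ← hu, ← hv]

theorem zeroAt_zero (hτ : τ ≠ 0) (hJ : IsIdeal (τ + τ⁻¹) J) (hp : IdealProper J) :
    ZeroAt τ J 0 := by
  intro x hx w hw
  rw [List.length_eq_zero_iff.1 hw]
  by_contra h
  obtain ⟨m, n, hmn⟩ := hp
  exact hmn (hx.eq_univ hτ hJ h m n)

theorem subset_Negl [CharZero K] (hτ : τ ≠ 0) (hd : τ + τ⁻¹ ≠ 0) (hJ : IsIdeal (τ + τ⁻¹) J)
    (hp : IdealProper J) (m n : ℕ) : J m n ⊆ Negl (τ + τ⁻¹) m n := by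
  intro x hx
  rw [mem_Negl_iff hτ hd]
  intro g hg
  have h1 := ML.ptr hτ hd hJ m (((ML.of_mem hx).comp_left hτ hd hJ hg).cast (zero_add m).symm
    (zero_add m).symm)
  have h2 : JL τ J 0 fun _ => ∑ w ∈ words m, ∑ v ∈ words n, τ ^ chg w * (lm τ x w v * g v w) := by
    refine h1.congr fun u v hu hv => ?_
    rw [List.length_eq_zero_iff.1 hu, List.length_eq_zero_iff.1 hv]
    simp only [List.nil_append, Finset.mul_sum]
  exact zeroAt_zero hτ hJ hp _ h2 [] rfl

theorem ML.of_JL [CharZero K] (hτ : τ ≠ 0) (hd : τ + τ⁻¹ ≠ 0) (hJ : IsIdeal (τ + τ⁻¹) J)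
    (hJ' : IsIdeal (τ + τ⁻¹) J') (h : ∀ k x, JL τ J k x → JL τ J' k x) {m n : ℕ}
    {f : List Bool → List Bool → K} (hf : ML τ J m n f) : ML τ J' m n f := by
  induction m generalizing n f with
  | zero =>
    have e : ∀ u v : List Bool, u.length = 0 → v.length = n → f u v = f [] v := by
      intro u v hu _
      rw [List.length_eq_zero_iff.1 hu]
    exact ML.congr (h n (f []) (hf.congr e)) fun u v hu hv => (e u v hu hv).symm
  | succ m ih => exact ML.unbend hτ hd hJ' (ih (hf.bend hτ hd hJ))

theorem exists_JL_ne_zero [CharZero K] (hτ : τ ≠ 0) (hd : τ + τ⁻¹ ≠ 0)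
    (hJ : IsIdeal (τ + τ⁻¹) J) {m n : ℕ} {f : List Bool → List Bool → K} (hf : ML τ J m n f)
    {u v : List Bool} (hu : u.length = m) (hv : v.length = n) (h : f u v ≠ 0) :
    ∃ k x w, JL τ J k x ∧ w.length = k ∧ x w ≠ 0 := by
  induction m generalizing n f u v with
  | zero =>
    refine ⟨n, f [], v, hf.congr fun u' v' hu' _ => ?_, hv, ?_⟩
    · rw [List.length_eq_zero_iff.1 hu']
    · rwa [List.length_eq_zero_iff.1 hu] at h
  | succ m ih =>
    have hne : u ≠ [] := by
      rintro rfl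
      simp at hu
    obtain ⟨u, b, rfl⟩ : ∃ u' b, u = u' ++ [b] :=
      ⟨u.dropLast, u.getLast hne, (List.dropLast_append_getLast hne).symm⟩
    have hu : u.length = m := by simpa using hu
    refine ih (hf.bend hτ hd hJ) hu (v := v ++ [!b]) (by simp [hv]) ?_
    rw [bendF_append _ _ _ hv, Bool.not_not]
    refine mul_ne_zero ?_ h
    cases b <;> simp [capw, hτ]

theorem IdealNonzero.exists_JL [CharZero K] (hτ : τ ≠ 0) (hd : τ + τ⁻¹ ≠ 0)
    (hJ : IsIdeal (τ + τ⁻¹) J) (hn : IdealNonzero J) :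
    ∃ k x w, JL τ J k x ∧ w.length = k ∧ x w ≠ 0 := by
  obtain ⟨m, n, x, hx, hx0⟩ := hn
  by_contra! h
  refine hx0 (lm_ext hτ fun u v hu hv => ?_)
  rw [lm_zero]
  by_contra hne
  obtain ⟨k, y, w, hy, hw, hyw⟩ := exists_JL_ne_zero hτ hd hJ (ML.of_mem hx) hu hv hne
  exact hyw (h k y w hy hw)

end Reduction

/-! ### Diagrams without top points -/

section Rainbow

/-- The entry of the diagram with matching `q` in the vertex model. -/
noncomputable def Wq (τ : K) {k : ℕ} (q : Fin k → Fin k) (l : Fin k → Bool) : K :=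
  ∏ j, if q j < j then (if l j = l (q j) then 0 else if l j then τ else 1) else 1

theorem exists_partner (τ : K) {k : ℕ} (g : Diagram 0 k) :
    ∃ q : Fin k → Fin k, NCInv (fun j : Fin k => (j : ℕ)) q ∧
      ∀ u v, lm τ (single g) u v = Wq τ q (lab k v) := by
  have h : ∀ j : Fin k, ∃ j' : Fin k, g.pair (Sum.inr j) = Sum.inr j' := by
    intro j
    rcases hj : g.pair (Sum.inr j) with i | j'
    · exact i.elim0
    · exact ⟨j', rfl⟩
  choose q hq using h
  have hpos : ∀ i j : Fin k, bIdx 0 k (Sum.inr i) < bIdx 0 k (Sum.inr j) ↔ j < i := by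
    intro i j
    simp only [bIdx]
    have := i.isLt
    have := j.isLt
    rw [Fin.lt_def]
    omega
  have hinv : ∀ j, q (q j) = j := by
    intro j
    have := g.involutive (Sum.inr j)
    rw [hq, hq] at this
    exact Sum.inr_injective this
  refine ⟨q, ⟨hinv, fun j hj => g.fixedPointFree (Sum.inr j) (by rw [hq, hj]),
    fun x y hxy => ?_⟩, fun u v => ?_⟩
  · refine g.noncrossing (Sum.inr (q y)) (Sum.inr (q x)) ?_
    simp only [hq, hinv, hpos, Fin.lt_def]
    exact ⟨hxy.2.2, hxy.2.1, hxy.1⟩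
  · have e : lm τ (single g) u v = wt τ g (lab 0 u) (lab k v) := mat_single τ g _ _
    rw [e, wt, Wt, Fintype.prod_sum_type, fac, Finset.univ_eq_empty (α := Fin 0),
      Finset.prod_empty, Finset.prod_empty, one_mul, one_mul]
    refine Finset.prod_congr rfl fun j _ => ?_
    simp only [lw, hq, hpos, Sum.elim_inr]
    congr

theorem NCInv.exists_adjacent {k a : ℕ} {q : Fin k → Fin k}
    (hq : NCInv (fun j : Fin k => (j : ℕ)) q)
    (h : ∃ j : Fin k, a ≤ j ∧ a ≤ q j) : ∃ j : Fin k, a ≤ j ∧ (q j : ℕ) = j + 1 := by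
  have h' : ∃ l, ∃ j : Fin k, a ≤ j ∧ (q j : ℕ) = j + 1 + l := by
    obtain ⟨j, h1, h2⟩ := h
    have hne : (q j : ℕ) ≠ j := fun e => hq.ne j (Fin.ext e)
    rcases lt_or_gt_of_ne hne with h3 | h3
    · exact ⟨j - q j - 1, q j, h2, by rw [hq.invol]; omega⟩
    · exact ⟨q j - j - 1, j, h1, by omega⟩
  obtain ⟨j, h1, h2⟩ := Nat.find_spec h'
  by_cases hl : Nat.find h' = 0
  · exact ⟨j, h1, by omega⟩
  · exfalso
    have hlt : (j : ℕ) + 1 < k := by have := (q j).isLt; omega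
    set i : Fin k := ⟨j + 1, hlt⟩ with hi
    have hb := hq.between Fin.val_injective j i (by simp [hi]) (by simp [hi]; omega)
    have hne : (q i : ℕ) ≠ i := fun e => hq.ne i (Fin.ext e)
    have hiv : (i : ℕ) = j + 1 := rfl
    refine Nat.find_min h' (m := q i - i - 1) (by omega) ⟨i, by omega, by omega⟩

theorem NCInv.rainbow {a : ℕ} {q : Fin (a + a) → Fin (a + a)}
    (hq : NCInv (fun j : Fin (a + a) => (j : ℕ)) q)
    (h : ∀ j : Fin (a + a), a ≤ j → (q j : ℕ) < a) (j : Fin (a + a)) :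
    (q j : ℕ) = a + a - 1 - j := by
  set f : Fin a → Fin a := fun i => Fin.rev ⟨q (Fin.natAdd a i), h _ (by simp)⟩ with hf
  have hmono : StrictMono f := by
    intro i i' hii
    rw [hf, Fin.rev_lt_rev, Fin.lt_def]
    simp only
    by_contra hle
    have hne : (q (Fin.natAdd a i) : ℕ) ≠ q (Fin.natAdd a i') := by
      intro e
      have := congrArg q (Fin.ext e)
      rw [hq.invol, hq.invol] at this
      have := congrArg Fin.val this
      simp only [Fin.natAdd] at this
      rw [Fin.lt_def] at hii
      omega
    refine hq.nc (q (Fin.natAdd a i)) (q (Fin.natAdd a i')) ?_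
    rw [hq.invol, hq.invol]
    have := h (Fin.natAdd a i') (by simp)
    rw [Fin.lt_def] at hii
    simp only [Fin.val_natAdd]
    omega
  have hid : f = id := (hmono.range_inj strictMono_id).1 (by
    rw [(Finite.injective_iff_surjective.1 hmono.injective).range_eq, Set.range_id])
  have h1 : ∀ i : Fin a, (q (Fin.natAdd a i) : ℕ) = a - 1 - i := by
    intro i
    have := congrArg Fin.val (congrFun hid i)
    simp only [hf, Fin.val_rev, id] at this
    have := h (Fin.natAdd a i) (by simp)
    omega
  refine Fin.addCases (fun i => ?_) (fun i => ?_) j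
  · have h2 := h1 (Fin.rev i)
    have h3 : q (Fin.natAdd a (Fin.rev i)) = Fin.castAdd a i := by
      apply Fin.ext
      rw [h2]
      simp only [Fin.val_rev, Fin.val_castAdd]
      omega
    rw [← h3, hq.invol, h3]
    simp only [Fin.val_natAdd, Fin.val_rev, Fin.val_castAdd]
    omega
  · rw [h1]
    simp only [Fin.val_natAdd]
    omega

end Rainbow

section Split

theorem prod_lab {a : ℕ} {s : List Bool} (hs : s.length = a) (τ : K) :
    ∏ i : Fin a, (if lab a s i then τ else 1) = τ ^ s.count true := by
  subst hs
  induction s with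
  | nil => simp
  | cons b s ih =>
    rw [List.length_cons, Fin.prod_univ_succ]
    simp only [lab, Fin.val_zero, Fin.val_succ, List.getD_cons_zero, List.getD_cons_succ] at ih ⊢
    refine (congrArg _ (Eq.trans (Finset.prod_congr rfl fun i _ => ?_) ih)).trans
      (b := (if b = true then τ else 1) * τ ^ s.count true) ?_
    · congr
    cases b <;> simp [pow_succ, mul_comm]

theorem lab_bar {a : ℕ} {p : List Bool} (hp : p.length = a) (i : Fin a) :
    lab a (bar p) i = !lab a p (Fin.rev i) := by
  subst hp
  have h : p.length - 1 - (i : ℕ) < p.length := by have := i.isLt; omega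
  have e : p.length - (i + 1) = p.length - 1 - (i : ℕ) := by omega
  simp [lab, bar, Fin.val_rev, e, h]

theorem Wq_rainbow {a : ℕ} {q : Fin (a + a) → Fin (a + a)} (hq : ∀ j, (q j : ℕ) = a + a - 1 - j)
    (τ : K) {p s : List Bool} (hp : p.length = a) (hs : s.length = a) :
    Wq τ q (lab (a + a) (p ++ s)) = if s = bar p then τ ^ s.count true else 0 := by
  have h1 : ∀ i : Fin a, q (Fin.natAdd a i) = Fin.castAdd a (Fin.rev i) := by
    intro i
    apply Fin.ext
    rw [hq]
    simp only [Fin.val_natAdd, Fin.val_castAdd, Fin.val_rev]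
    omega
  have h2 : ∀ i : Fin a, ¬ q (Fin.castAdd a i) < Fin.castAdd a i := by
    intro i
    rw [Fin.lt_def, hq]
    simp only [Fin.val_castAdd]
    omega
  have h3 : ∀ i : Fin a, Fin.castAdd a (Fin.rev i) < Fin.natAdd a i := by
    intro i
    rw [Fin.lt_def]
    simp only [Fin.val_natAdd, Fin.val_castAdd]
    omega
  rw [Wq, Fin.prod_univ_add, Finset.prod_eq_one fun i _ => if_neg (h2 i), one_mul, lab_append hp]
  simp only [h1, h3, if_true, Fin.append_left, Fin.append_right]
  split_ifs with h
  · rw [← prod_lab hs τ]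
    refine Finset.prod_congr rfl fun i _ => if_neg ?_
    rw [h, lab_bar hp]
    simp
  · have : ∃ i, lab a s i ≠ lab a (bar p) i := by
      by_contra! h'
      exact h ((lab_injOn hs (by simp [bar_length, hp])).1 (funext h'))
    obtain ⟨i, hi⟩ := this
    refine Finset.prod_eq_zero (Finset.mem_univ i) (if_pos ?_)
    rw [lab_bar hp] at hi
    revert hi
    cases lab a s i <;> cases lab a p (Fin.rev i) <;> simp

theorem lab_middle {k : ℕ} {P S : List Bool} (b c b' c' : Bool) {x : Fin k} (h1 : (x : ℕ) ≠ P.length)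
    (h2 : (x : ℕ) ≠ P.length + 1) :
    lab k (P ++ b :: c :: S) x = lab k (P ++ b' :: c' :: S) x := by
  simp only [lab]
  rcases lt_or_ge (x : ℕ) P.length with h | h
  · rw [List.getD_append _ _ _ _ h, List.getD_append _ _ _ _ h]
  · obtain ⟨y, hy⟩ : ∃ y, (x : ℕ) - P.length = y + 2 := ⟨x - P.length - 2, by omega⟩
    rw [List.getD_append_right _ _ _ _ h, List.getD_append_right _ _ _ _ h, hy]
    rfl

theorem Wq_adjacent {k : ℕ} {q : Fin k → Fin k} (hq : NCInv (fun j : Fin k => (j : ℕ)) q)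
    {j : Fin k} (hj : (q j : ℕ) = j + 1) (τ : K) {P : List Bool} (S : List Bool)
    (hP : P.length = j) : ∃ R, ∀ b c, Wq τ q (lab k (P ++ b :: c :: S)) = capw τ b c * R := by
  refine ⟨∏ x ∈ (Finset.univ.erase j).erase (q j),
    if q x < x then (if lab k (P ++ false :: false :: S) x =
      lab k (P ++ false :: false :: S) (q x) then 0
      else if lab k (P ++ false :: false :: S) x then τ else 1) else 1, fun b c => ?_⟩
  have hjq : q j ∈ Finset.univ.erase j := by simp [hq.ne j]
  have hb : lab k (P ++ b :: c :: S) j = b := by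
    rw [lab, List.getD_append_right _ _ _ _ hP.le, hP, Nat.sub_self]
    rfl
  have hc : lab k (P ++ b :: c :: S) (q j) = c := by
    rw [lab, List.getD_append_right _ _ _ _ (by omega), show (q j : ℕ) - P.length = 1 by omega]
    rfl
  have hlt : j < q j := by rw [Fin.lt_def]; omega
  rw [Wq, ← Finset.mul_prod_erase _ _ (Finset.mem_univ j), if_neg hlt.not_gt, one_mul,
    ← Finset.mul_prod_erase _ _ hjq, hq.invol, if_pos hlt, hb, hc]
  congr 1
  · cases b <;> cases c <;> simp [capw]
  · refine Finset.prod_congr rfl fun x hx => ?_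
    have hx1 : x ≠ q j := by simp at hx; tauto
    have hx2 : x ≠ j := by simp at hx; tauto
    have hx3 : q x ≠ q j := fun e => hx2 (by rw [← hq.invol x, e, hq.invol])
    have hx4 : q x ≠ j := fun e => hx1 (by rw [← e, hq.invol])
    have v : ∀ y : Fin k, y ≠ q j → y ≠ j → (y : ℕ) ≠ P.length ∧ (y : ℕ) ≠ P.length + 1 := by
      intro y h1 h2
      rw [hP, ← hj]
      exact ⟨fun e => h2 (Fin.ext e), fun e => h1 (Fin.ext e)⟩
    rw [lab_middle b c false false (v x hx1 hx2).1 (v x hx1 hx2).2,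
      lab_middle b c false false (v _ hx3 hx4).1 (v _ hx3 hx4).2]

/-- A diagram with `a + a` bottom points is either the rainbow, or it has an arc joining
adjacent points in the right half. -/
theorem diagram_split [CharZero K] {τ : K} (hτ : τ ≠ 0) (hd : τ + τ⁻¹ ≠ 0) {a : ℕ}
    (g : Diagram 0 (a + a)) :
    (∀ p s : List Bool, p.length = a → s.length = a →
      lm τ (single g) [] (p ++ s) = if s = bar p then τ ^ s.count true else 0) ∨
    ∃ i j h, i + j + 2 = a ∧ JL τ (full K) (a + (i + j)) h ∧ ∀ (p s : List Bool) b c s',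
      p.length = a → s.length = i → s'.length = j →
      lm τ (single g) [] (p ++ (s ++ b :: c :: s')) = capw τ b c * h (p ++ (s ++ s')) := by
  obtain ⟨q, hq, hW⟩ := exists_partner τ g
  by_cases hr : ∃ j : Fin (a + a), a ≤ j ∧ a ≤ q j
  · right
    obtain ⟨j, haj, hj⟩ := hq.exists_adjacent hr
    have hlt := (q j).isLt
    have hV : JL τ (full K) (a + a) (lm τ (single g) []) :=
      ⟨single g, Set.mem_univ _, fun u v hu _ => by rw [List.length_eq_zero_iff.1 hu]⟩
    refine ⟨j - a, a + a - 2 - j, _, by omega, ((JL.ctr hτ hd (isIdeal_full _) j (a + a - 2 - j)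
      (hV.cast (by omega))).smul (isIdeal_full 0) (τ + τ⁻¹)⁻¹).cast (by omega),
      fun p s b c s' hp hs hs' => ?_⟩
    obtain ⟨R, hR⟩ := Wq_adjacent hq hj τ (P := p ++ s) s' (by simp [hp, hs]; omega)
    rw [← List.append_assoc p s s', ctrF_append _ _ (by simp [hp, hs]; omega), hW, hW, hW,
      ← List.append_assoc, hR, hR, hR]
    have e : capw τ false true * R + τ⁻¹ * (capw τ true false * R) = (τ + τ⁻¹) * R := by
      simp [capw]
      ring
    rw [e, inv_mul_cancel_left₀ hd]
  · left
    push Not at hr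
    intro p s hp hs
    rw [hW, Wq_rainbow (hq.rainbow hr) τ hp hs]

end Split

section Pairing
variable {τ : K} {a : ℕ}

theorem kap_append (u v : List Bool) : kap τ (u ++ v) = kap τ u * kap τ v := by
  simp [kap, pow_add]

theorem bar_append (u v : List Bool) : bar (u ++ v) = bar v ++ bar u := by simp [bar]

theorem sum_rainbow (hτ : τ ≠ 0) {p : List Bool} (hp : p.length = a) (F : List Bool → K) :
    ∑ u ∈ words a, kap τ u * ((if u = bar p then τ ^ u.count true else 0) * F (bar u)) = F p := by
  rw [Finset.sum_eq_single (bar p)]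
  · rw [if_pos rfl, bar_bar, ← mul_assoc, kap, ← mul_pow, inv_mul_cancel₀ hτ, one_pow, one_mul]
  · intro u _ hu
    rw [if_neg hu, zero_mul, mul_zero]
  · intro h
    exact absurd (mem_words.2 (by rw [bar_length, hp])) h

theorem sum_words_insert {M : Type} [AddCommMonoid M] (i j : ℕ) (F : List Bool → M) :
    ∑ u ∈ words (i + 2 + j), F u = ∑ s ∈ words i, ∑ s' ∈ words j, ∑ w ∈ words 2, F (s ++ (w ++ s')) := by
  rw [add_assoc, sum_words_append]
  refine Finset.sum_congr rfl fun s _ => ?_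
  rw [sum_words_append, Finset.sum_comm]

theorem sum_capw (hτ : τ ≠ 0) {i j : ℕ} (G H x : List Bool → K) (s : List Bool)
    (hG : ∀ (u : List Bool) b c u', u.length = i → u'.length = j →
      G (u ++ b :: c :: u') = capw τ b c * H (u ++ u')) :
    ∑ u ∈ words (i + 2 + j), kap τ u * (G u * x (bar u ++ s)) =
      ∑ u ∈ words (i + j), kap τ u * (H u * ctrF τ j x (bar u ++ s)) := by
  rw [sum_words_insert, sum_words_append]
  refine Finset.sum_congr rfl fun u hu => Finset.sum_congr rfl fun u' hu' => ?_
  rw [mem_words] at hu hu'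
  rw [sum_words_two]
  simp only [List.cons_append, List.nil_append, hG u _ _ u' hu hu', kap_append, bar_append,
    bar_cons, List.append_assoc]
  rw [ctrF_append _ _ (by rw [bar_length, hu'])]
  simp only [kap, capw, List.count_cons]
  simp [pow_succ]
  field_simp
  ring

/-- Gluing a vector to the right half of `v` multiplies by a constant, up to terms which
factor through a contraction. -/
theorem JL.split_pairing [CharZero K] (hτ : τ ≠ 0) (hd : τ + τ⁻¹ ≠ 0) {v : List Bool → K}
    (hv : JL τ (full K) (a + a) v) :
    ∃ (C : K) (S : Finset (Diagram 0 (a + a))) (i j : Diagram 0 (a + a) → ℕ)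
      (h : Diagram 0 (a + a) → List Bool → K),
      (∀ g ∈ S, i g + j g + 2 = a ∧ JL τ (full K) (a + (i g + j g)) (h g)) ∧
      (∀ (x : List Bool → K) (p s : List Bool), p.length = a →
        ∑ u ∈ words a, kap τ u * (v (p ++ u) * x (bar u ++ s)) = C * x (p ++ s) +
          ∑ g ∈ S, ∑ u ∈ words (i g + j g),
            kap τ u * (h g (p ++ u) * ctrF τ (j g) x (bar u ++ s))) ∧
      v (List.replicate a false ++ List.replicate a true) = C * τ ^ a := by
  obtain ⟨y, -, hy⟩ := hv
  let R : Diagram 0 (a + a) → Prop := fun g => ∀ p s : List Bool, p.length = a → s.length = a →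
      lm τ (single g) [] (p ++ s) = if s = bar p then τ ^ s.count true else 0
  have hII : ∀ g, ∃ i j h, ¬ R g → i + j + 2 = a ∧ JL τ (full K) (a + (i + j)) h ∧
      ∀ (p s : List Bool) b c s', p.length = a → s.length = i → s'.length = j →
      lm τ (single g) [] (p ++ (s ++ b :: c :: s')) = capw τ b c * h (p ++ (s ++ s')) := by
    intro g
    rcases diagram_split hτ hd g with h | ⟨i, j, h, h'⟩
    · exact ⟨0, 0, fun _ => 0, fun h' => absurd h h'⟩
    · exact ⟨i, j, h, fun _ => h'⟩
  choose i j h hII using hII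
  have hexp : ∀ p s : List Bool, p.length = a → s.length = a →
      v (p ++ s) = ∑ g, y g * lm τ (single g) [] (p ++ s) := by
    intro p s hp hs
    rw [← hy [] _ rfl (by simp [hp, hs]), lm, mat]
    exact Finset.sum_congr rfl fun g _ => by rw [lm, mat_single]
  refine ⟨∑ g with R g, y g, Finset.univ.filter fun g => ¬ R g, i, j, fun g w => y g * h g w,
    fun g hg => ?_, fun x p s hp => ?_, ?_⟩
  · obtain ⟨h1, h2, -⟩ := hII g (Finset.mem_filter.1 hg).2
    exact ⟨h1, h2.smul (isIdeal_full 0) _⟩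
  · have e : ∑ u ∈ words a, kap τ u * (v (p ++ u) * x (bar u ++ s)) =
        ∑ g, y g * ∑ u ∈ words a, kap τ u * (lm τ (single g) [] (p ++ u) * x (bar u ++ s)) := by
      simp_rw [Finset.mul_sum]
      rw [Finset.sum_comm]
      refine Finset.sum_congr rfl fun u hu => ?_
      rw [hexp p u hp (mem_words.1 hu), Finset.sum_mul, Finset.mul_sum]
      exact Finset.sum_congr rfl fun g _ => by ring
    rw [e, ← Finset.sum_filter_add_sum_filter_not _ R, Finset.sum_mul]
    congr 1
    · refine Finset.sum_congr rfl fun g hg => ?_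
      congr 1
      refine Eq.trans (Finset.sum_congr rfl fun u hu => ?_) (sum_rainbow hτ hp fun w => x (w ++ s))
      rw [(Finset.mem_filter.1 hg).2 p u hp (mem_words.1 hu)]
    · refine Finset.sum_congr rfl fun g hg => ?_
      obtain ⟨h1, -, h3⟩ := hII g (Finset.mem_filter.1 hg).2
      have ha : words a = words (i g + 2 + j g) := by congr 1; omega
      rw [ha, sum_capw hτ _ (fun u => h g (p ++ u)) x s fun u b c u' hu hu' => h3 p u b c u' hp hu hu',
        Finset.mul_sum]
      exact Finset.sum_congr rfl fun u _ => by ring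
  · rw [hexp _ _ (by simp) (by simp), ← Finset.sum_filter_add_sum_filter_not _ R, Finset.sum_mul,
      Finset.sum_eq_zero (s := Finset.univ.filter fun g => ¬ R g), add_zero]
    · refine Finset.sum_congr rfl fun g hg => ?_
      rw [(Finset.mem_filter.1 hg).2 _ _ (by simp) (by simp), if_pos (by simp [bar]),
        List.count_replicate_self]
    · intro g hg
      obtain ⟨h1, -, h3⟩ := hII g (Finset.mem_filter.1 hg).2
      have : List.replicate a true = List.replicate (i g) true ++ true :: true ::
          List.replicate (j g) true := by
        rw [← h1, add_right_comm, show i g + 2 + j g = i g + (2 + j g) by ring,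
          List.replicate_add, List.replicate_add]
        rfl
      rw [this, h3 _ _ _ _ _ (by simp) (by simp) (by simp)]
      simp [capw]

/-- The vectors of an ideal `J` exhaust those of `J'` once `J` contains, in the lowest degree
where `J'` may be nonzero, a vector with nonzero extreme coordinate. -/
theorem JL.of_lowest [CharZero K] (hτ : τ ≠ 0) (hd : τ + τ⁻¹ ≠ 0)
    {J J' : ∀ m n : ℕ, Set (Hom K m n)} (hJ : IsIdeal (τ + τ⁻¹) J) (hJ' : IsIdeal (τ + τ⁻¹) J')
    {v : List Bool → K} (hv : JL τ J (a + a) v)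
    (hv0 : v (List.replicate a false ++ List.replicate a true) ≠ 0)
    (hz : ∀ k < a + a, ZeroAt τ J' k) : ∀ k x, JL τ J' k x → JL τ J k x := by
  obtain ⟨C, S, i, j, h, hS, hpair, hC⟩ := hv.to_full.split_pairing hτ hd
  have hC0 : C ≠ 0 := fun e => hv0 (by rw [hC, e, zero_mul])
  intro k
  induction k using Nat.strong_induction_on with
  | _ k ih =>
    intro x hx
    rcases lt_or_ge k (a + a) with hk | hk
    · exact (JL.zero hJ k).congr fun w hw => (hz k hk x hx w hw).symm
    obtain ⟨l, rfl⟩ : ∃ l, k = a + l := ⟨k - a, by omega⟩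
    have h1 : JL τ J (a + l) (mctrF τ a a (juxtF (a + a) v x)) :=
      JL.mctr hτ hd hJ a a l ((hv.juxt_left hJ hx.to_full).cast (by ring))
    have h2 : JL τ J (a + l) fun w => ∑ g ∈ S,
        mctrF τ (i g + j g) a (juxtF (a + (i g + j g)) (h g) (ctrF τ (j g) x)) w := by
      refine JL.sum hJ S fun g hg => ?_
      obtain ⟨e, hg⟩ := hS g hg
      have hc : JL τ J' (j g + (a + l - 2 - j g)) (ctrF τ (j g) x) :=
        JL.ctr hτ hd hJ' _ _ (hx.cast (by omega))
      refine JL.mctr hτ hd hJ (i g + j g) a l ((hg.juxt_right hJ (ih _ ?_ _ hc)).cast ?_) <;> omega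
    refine ((h1.add hJ (h2.smul hJ (-1))).smul hJ C⁻¹).congr ?_
    refine forall_append fun p s hp hs => ?_
    have e1 : mctrF τ a a (juxtF (a + a) v x) (p ++ s) =
        ∑ u ∈ words a, kap τ u * (v (p ++ u) * x (bar u ++ s)) := by
      rw [mctrF_append _ _ hp]
      refine Finset.sum_congr rfl fun u hu => ?_
      rw [← List.append_assoc p, juxtF_append _ _ _ (by simp [hp, mem_words.1 hu])]
    have e2 : ∀ g, mctrF τ (i g + j g) a (juxtF (a + (i g + j g)) (h g) (ctrF τ (j g) x)) (p ++ s) =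
        ∑ u ∈ words (i g + j g), kap τ u * (h g (p ++ u) * ctrF τ (j g) x (bar u ++ s)) := by
      intro g
      rw [mctrF_append _ _ hp]
      refine Finset.sum_congr rfl fun u hu => ?_
      rw [← List.append_assoc p, juxtF_append _ _ _ (by simp [hp, mem_words.1 hu])]
    simp only [e1, e2, hpair x p s hp]
    rw [neg_one_mul, add_neg_cancel_right, inv_mul_cancel_left₀ hC0]

end Pairing

section GaussRatio
variable {ω : K} {n : ℕ}

theorem gb_absorb (ω : K) (M j : ℕ) :
    (1 - ω ^ (j + 1)) * gb ω (M + 1) (j + 1) = (1 - ω ^ (M + 1)) * gb ω M j := by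
  rw [gb]
  linear_combination ω * gb_step ω M j

theorem gb_ne_zero (hω : IsPrimitiveRoot ω n) {M i : ℕ} (hM : M < n) (hi : i ≤ M) : gb ω M i ≠ 0 := by
  induction M generalizing i with
  | zero =>
    obtain rfl : i = 0 := by omega
    simp [gb]
  | succ M ih =>
    cases i with
    | zero => rw [gb_zero]; exact one_ne_zero
    | succ i =>
      intro h
      have h1 := gb_absorb ω M i
      rw [h, mul_zero] at h1
      refine mul_ne_zero ?_ (ih (by omega) (by omega : i ≤ M)) h1.symm
      exact sub_ne_zero.2 (hω.pow_ne_one_of_pos_of_lt (by omega) hM).symm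

theorem gb_cross (hω : IsPrimitiveRoot ω n) {k : ℕ} (hk : k + 2 < n) (j : ℕ) :
    gb ω (k + 1) 1 * (gb ω k j * gb ω (k + 2) (j + 1)) =
      gb ω (k + 2) 1 * (gb ω (k + 1) j * gb ω (k + 1) (j + 1)) := by
  rcases lt_or_ge k j with h | h
  · rw [gb_eq_zero ω h, gb_eq_zero ω (show k + 1 < j + 1 by omega)]
    ring
  have hne : ∀ i, i + 1 < n → 1 - ω ^ (i + 1) ≠ 0 := fun i hi =>
    sub_ne_zero.2 (hω.pow_ne_one_of_pos_of_lt (by omega) hi).symm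
  refine mul_left_cancel₀ (mul_ne_zero (hne j (by omega)) (hne 0 (by omega))) ?_
  have a1 := gb_absorb ω (k + 1) j
  have a2 := gb_absorb ω k j
  have a3 := gb_absorb ω k 0
  have a4 := gb_absorb ω (k + 1) 0
  simp only [gb_zero, mul_one, zero_add] at a3 a4 ⊢
  linear_combination (1 - ω ^ 1) * gb ω (k + 1) 1 * gb ω k j * a1 + (1 - ω ^ (k + 2)) * gb ω k j * gb ω (k + 1) j * a3
    - (1 - ω ^ 1) * gb ω (k + 2) 1 * gb ω (k + 1) j * a2 - (1 - ω ^ (k + 1)) * gb ω k j * gb ω (k + 1) j * a4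

end GaussRatio

section JonesWenzl
variable {τ : K}

/-- The coordinates of the Jones–Wenzl projector on `m` strands, bent to a vector with `2 * m`
bottom points. -/
noncomputable def jw (τ : K) (m : ℕ) (w : List Bool) : K :=
  if (w.take m).count true + (w.drop m).count true = m then
    (-τ⁻¹) ^ (inv (w.take m) + inv (w.drop m)) * τ ^ (w.drop m).count true /
      gb ((-τ⁻¹) ^ 2) m ((w.drop m).count true)
  else 0

theorem jw_append {m : ℕ} {p : List Bool} (s : List Bool) (hp : p.length = m) :
    jw τ m (p ++ s) = if p.count true + s.count true = m then
      (-τ⁻¹) ^ (inv p + inv s) * τ ^ s.count true / gb ((-τ⁻¹) ^ 2) m (s.count true) else 0 := by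
  subst hp
  simp [jw]

theorem count_true_cons (a : Bool) (u : List Bool) : (a :: u).count true = a.toNat + u.count true := by
  cases a <;> simp [add_comm]

theorem inv_cons (a : Bool) (u : List Bool) : inv (a :: u) = (!a).toNat * u.count true + inv u := by
  cases a <;> simp [inv]

theorem inv_concat (u : List Bool) (b : Bool) : inv (u ++ [b]) = inv u + b.toNat * u.count false := by
  cases b <;> simp [inv_append, inv]

theorem sum_jw_jw (hτ : τ ≠ 0) {k : ℕ} {p s : List Bool} (a b : Bool) (hp : p.length = k + 1) {j : ℕ}
    (hj : p.count true + a.toNat + j = k + 1) (hb : j + 1 = b.toNat + s.count true) :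
    ∑ u ∈ words k, kap τ u * (jw τ (k + 1) (p ++ a :: u) * jw τ (k + 1) ((bar u ++ [b]) ++ s)) =
      (-τ⁻¹) ^ (inv p + inv s + (!a).toNat * j + b.toNat * j) * τ ^ (a.toNat + s.count true) *
        gb ((-τ⁻¹) ^ 2) k j / (gb ((-τ⁻¹) ^ 2) (k + 1) (a.toNat + j) *
          gb ((-τ⁻¹) ^ 2) (k + 1) (s.count true)) := by
  rw [← sum_inv, Finset.mul_sum, Finset.sum_div]
  refine Finset.sum_congr rfl fun u hu => ?_
  rw [mem_words] at hu
  have hc := List.count_add_count_not u true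
  rw [jw_append _ hp, jw_append _ (by simp [hu]), List.count_append, count_bar, inv_concat, inv_bar,
    count_bar, count_true_cons, count_true_cons, inv_cons]
  simp only [List.count_nil, Bool.not_true, Bool.not_false] at hc ⊢
  by_cases h : u.count true = j
  · rw [if_pos (by omega), if_pos (by omega), if_pos h, kap, h]
    have e : τ⁻¹ ^ j * τ ^ j = 1 := by rw [← mul_pow, inv_mul_cancel₀ hτ, one_pow]
    generalize gb ((-τ⁻¹) ^ 2) (k + 1) (a.toNat + j) = A
    generalize gb ((-τ⁻¹) ^ 2) (k + 1) (s.count true) = B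
    rw [← pow_mul]
    generalize -τ⁻¹ = σ
    rw [pow_add τ a.toNat j]
    linear_combination (σ ^ (inv p + ((!a).toNat * j + inv u)) * τ ^ a.toNat / A *
      (σ ^ (inv u + b.toNat * j + inv s) * τ ^ s.count true / B)) * e
  · rw [if_neg (by omega), if_neg h]
    ring

theorem jw_succ (hτ : τ ≠ 0) {n : ℕ} (hω : IsPrimitiveRoot ((-τ⁻¹) ^ 2) n) {k : ℕ} (hk : k + 2 < n)
    {p s : List Bool} (a b : Bool) (hp : p.length = k + 1) (hs : s.length = k + 1) :
    jw τ (k + 2) (p ++ a :: b :: s) = capw τ a b * jw τ (k + 1) (p ++ s) +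
      -τ⁻¹ * gb ((-τ⁻¹) ^ 2) (k + 1) 1 / gb ((-τ⁻¹) ^ 2) (k + 2) 1 *
      ∑ u ∈ words k, kap τ u * (jw τ (k + 1) (p ++ a :: u) *
        jw τ (k + 1) ((bar u ++ [b]) ++ s)) := by
  have hps := List.count_le_length (a := true) (l := p)
  have hss := List.count_le_length (a := true) (l := s)
  have hpc := List.count_add_count_not p true
  simp only [Bool.not_true] at hpc
  have hL : jw τ (k + 2) (p ++ a :: b :: s) = jw τ (k + 2) ((p ++ [a]) ++ b :: s) := by simp
  rw [hL, jw_append _ (by simp [hp]), jw_append _ hp, List.count_append, count_true_cons,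
    count_true_cons, inv_concat, inv_cons]
  simp only [List.count_nil, add_zero]
  by_cases hbal : p.count true + a.toNat + (b.toNat + s.count true) = k + 2
  swap
  · rw [if_neg hbal, Finset.sum_eq_zero, mul_zero, add_zero]
    · cases a <;> cases b <;> simp [capw] at hbal ⊢ <;> intro h <;> omega
    · intro u hu
      rw [mem_words] at hu
      have hc := List.count_add_count_not u true
      rw [jw_append _ hp, jw_append _ (by simp [hu]), List.count_append, count_bar, count_true_cons,
        count_true_cons]
      simp only [List.count_nil, Bool.not_true] at hc ⊢
      split_ifs with h1 h2
      · omega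
      all_goals ring
  rw [if_pos hbal]
  have hX := gb_cross hω hk
  have hg1 := gb_ne_zero hω hk (show 1 ≤ k + 2 by omega)
  by_cases hj : ∃ j, j + 1 = b.toNat + s.count true
  · obtain ⟨j, hj⟩ := hj
    rw [sum_jw_jw hτ a b hp (by omega) hj]
    have hX := hX j
    have hg2 := gb_ne_zero hω hk (show j + 1 ≤ k + 2 by omega)
    have hrec : gb ((-τ⁻¹) ^ 2) (k + 2) (j + 1) = gb ((-τ⁻¹) ^ 2) (k + 1) j +
      ((-τ⁻¹) ^ 2) ^ (j + 1) * gb ((-τ⁻¹) ^ 2) (k + 1) (j + 1) := rfl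
    have hA := gb_ne_zero hω (show k + 1 < n by omega) (show j ≤ k + 1 by omega)
    have hB : j ≤ k → gb ((-τ⁻¹) ^ 2) (k + 1) (j + 1) ≠ 0 := fun h =>
      gb_ne_zero hω (show k + 1 < n by omega) (by omega)
    have hστ : -τ⁻¹ * τ = -1 := by rw [neg_mul, inv_mul_cancel₀ hτ]
    have hκ : ∀ c M : K, -τ⁻¹ * gb ((-τ⁻¹) ^ 2) (k + 1) 1 / gb ((-τ⁻¹) ^ 2) (k + 2) 1 *
        (c * gb ((-τ⁻¹) ^ 2) k j / M) = -τ⁻¹ * c / M * (gb ((-τ⁻¹) ^ 2) (k + 1) j *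
          gb ((-τ⁻¹) ^ 2) (k + 1) (j + 1) / gb ((-τ⁻¹) ^ 2) (k + 2) (j + 1)) := by
      intro c M
      rw [show -τ⁻¹ * gb ((-τ⁻¹) ^ 2) (k + 1) 1 / gb ((-τ⁻¹) ^ 2) (k + 2) 1 *
        (c * gb ((-τ⁻¹) ^ 2) k j / M) = -τ⁻¹ * c / M * (gb ((-τ⁻¹) ^ 2) (k + 1) 1 *
          gb ((-τ⁻¹) ^ 2) k j / gb ((-τ⁻¹) ^ 2) (k + 2) 1) by ring]
      congr 1
      rw [div_eq_div_iff hg1 hg2]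
      linear_combination hX
    rw [hκ]
    generalize -τ⁻¹ = σ at *
    cases a <;> cases b <;> simp only [Bool.toNat_false, Bool.toNat_true, Bool.not_false,
      Bool.not_true, zero_add, zero_mul, one_mul, add_zero] at hj hbal ⊢
    · rw [← hj]
      have hB := hB (by omega)
      simp only [capw, if_true, zero_mul, zero_add]
      field_simp
      ring
    · rw [if_pos (by omega), show s.count true = j by omega, add_comm 1 j, hrec]
      rw [hrec] at hg2
      simp only [capw, Bool.false_eq_true, if_false]
      field_simp
      linear_combination -(τ ^ j * σ ^ (inv p + inv s) * σ ^ (2 * j + 1) * gb (σ ^ 2) (k + 1) (j + 1)) * hστ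
    · have hB := hB (by omega)
      rw [if_pos (by omega), ← hj, show p.count false = j + 1 by omega, add_comm 1 j, hrec]
      rw [hrec] at hg2
      simp only [capw, reduceCtorEq, if_false, if_true]
      field_simp
      linear_combination -(σ ^ (inv p + inv s) * τ ^ (j + 1) * gb (σ ^ 2) (k + 1) j) * hστ
    · have hB := hB (by omega)
      rw [show s.count true = j by omega, show p.count false = j + 1 by omega, add_comm 1 j]
      simp only [capw, if_true, zero_mul, zero_add]
      field_simp
      ring
  · have hb : b = false := by
      cases b
      · rfl
      · exact absurd ⟨s.count true, add_comm _ _⟩ hj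
    subst hb
    have hs0 : s.count true = 0 := by
      by_contra h
      exact hj ⟨s.count true - 1, by simp; omega⟩
    cases a
    · simp [hs0] at hbal
      omega
    simp only [hs0, Bool.toNat_false, Bool.toNat_true] at hbal ⊢
    rw [Finset.sum_eq_zero, if_pos (by omega), show p.count false = 0 by omega]
    · simp [gb_zero, capw]
    · intro u hu
      rw [jw_append _ hp, count_true_cons, if_neg (by simp; omega)]
      ring

end JonesWenzl

section Negligible
variable {τ : K}

theorem JL.jw [CharZero K] (hτ : τ ≠ 0) (hd : τ + τ⁻¹ ≠ 0) {n : ℕ}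
    (hω : IsPrimitiveRoot ((-τ⁻¹) ^ 2) n) {m : ℕ} (hm : m < n) : JL τ (full K) (m + m) (TL.jw τ m) := by
  have h0 : JL τ (full K) 0 (TL.jw τ 0) := by
    refine ⟨idHom K 0, Set.mem_univ _, fun u v hu hv => ?_⟩
    rw [lm_id hτ hu hv, List.length_eq_zero_iff.1 hu, List.length_eq_zero_iff.1 hv]
    simp [TL.jw, inv, gb]
  induction m with
  | zero => exact h0
  | succ m ih =>
    cases m with
    | zero =>
      refine (JL.ins hτ hd (isIdeal_full _) 0 0 h0).congr fun w hw => ?_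
      obtain ⟨a, b, rfl⟩ := List.length_eq_two.1 hw
      refine (insF_append (τ := τ) (TL.jw τ 0) (p := []) a b [] rfl).trans ?_
      cases a <;> cases b <;> simp [TL.jw, inv, gb, capw]
    | succ k =>
      have hk := ih (by omega)
      have h1 := JL.ins hτ hd (isIdeal_full _) (k + 1) (k + 1) hk
      have h2 := JL.mctr hτ hd (isIdeal_full _) k (k + 2) (k + 2)
        ((hk.juxt_left (isIdeal_full 0) hk).cast (by ring))
      refine ((h1.cast (by ring)).add (isIdeal_full 0) ((h2.smul (isIdeal_full 0)
        (-τ⁻¹ * gb ((-τ⁻¹) ^ 2) (k + 1) 1 / gb ((-τ⁻¹) ^ 2) (k + 2) 1)).cast (by ring))).congr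
        fun w hw => ?_
      replace hw : w.length = k + 1 + 2 + (k + 1) := by omega
      revert w
      refine forall_append_two fun p a b s hp hs => ?_
      rw [insF_append _ _ _ _ hp, jw_succ hτ hω hm a b hp hs, ← List.singleton_append,
        ← List.append_assoc, mctrF_append _ _ (by simp [hp])]
      congr 2
      refine Finset.sum_congr rfl fun u hu => ?_
      rw [mem_words] at hu
      rw [show p ++ [a] ++ (u ++ (bar u ++ b :: s)) = (p ++ a :: u) ++ ((bar u ++ [b]) ++ s) by simp,
        juxtF_append _ _ _ (by simp [hp, hu])]

theorem JL.of_ML [CharZero K] (hτ : τ ≠ 0) (hd : τ + τ⁻¹ ≠ 0) {J : ∀ m n : ℕ, Set (Hom K m n)}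
    (hJ : IsIdeal (τ + τ⁻¹) J) {m n : ℕ} {f : List Bool → List Bool → K} (hf : ML τ J m n f) :
    JL τ J (n + m) fun w => τ ^ (w.drop n).count true * f (bar (w.drop n)) (w.take n) := by
  induction m generalizing n f with
  | zero =>
    refine JL.congr (x := f []) (ML.congr hf fun u v hu _ => by rw [List.length_eq_zero_iff.1 hu]) ?_
    intro w hw
    simp [bar, ← show w.length = n from hw]
  | succ m ih =>
    refine ((ih (hf.bend hτ hd hJ)).cast (by ring)).congr ?_
    refine forall_append fun v t hv ht => ?_
    obtain ⟨b, t, rfl⟩ := List.exists_cons_of_length_eq_add_one ht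
    rw [List.drop_left' hv, List.take_left' hv, ← List.singleton_append, ← List.append_assoc,
      List.drop_left' (by simp [hv]), List.take_left' (by simp [hv]), bendF_append _ _ _ hv,
      List.singleton_append, bar_cons]
    cases b <;> simp [capw, pow_succ, mul_assoc]

theorem sum_words_bar {M : Type} [AddCommMonoid M] (m : ℕ) (F : List Bool → M) :
    ∑ u ∈ words m, F (bar u) = ∑ u ∈ words m, F u :=
  Finset.sum_bij' (fun u _ => bar u) (fun u _ => bar u) (by simp) (by simp) (by simp) (by simp) (by simp)

theorem ctrF_jw {m j : ℕ} {p q s : List Bool} (hp : p.length = j)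
    (hq : j + 2 + q.length = m) : ctrF τ j (jw τ m) (p ++ (q ++ s)) = 0 := by
  rw [ctrF_append _ _ hp]
  have e : ∀ a b : Bool, p ++ a :: b :: (q ++ s) = (p ++ a :: b :: q) ++ s := by simp
  rw [e, e, jw_append _ (by simp; omega), jw_append _ (by simp; omega)]
  simp only [List.count_append, List.count_cons, inv_append, inv, List.count_append]
  simp
  split_ifs
  · ring
  · ring

theorem sum_pow_eq_zero {n N : ℕ} (hn : N + 1 = n) (hN : 0 < N) {ω : K} (hω : IsPrimitiveRoot ω n) :
    ∑ i ∈ Finset.range (N + 1), ω ^ i = 0 := by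
  rw [hn]
  exact hω.geom_sum_eq_zero (by omega)

theorem sum_words_count {N : ℕ} (F : List Bool → K) :
    ∑ u ∈ words N, F u = ∑ i ∈ Finset.range (N + 1), ∑ u ∈ words N, if u.count true = i then F u else 0 := by
  rw [Finset.sum_comm]
  refine Finset.sum_congr rfl fun u hu => ?_
  have := List.count_le_length (a := true) (l := u)
  rw [mem_words] at hu
  rw [Finset.sum_ite_eq, if_pos (by simp; omega)]

theorem markov_jw (hτ : τ ≠ 0) {n N : ℕ} (hω : IsPrimitiveRoot ((-τ⁻¹) ^ 2) n) (hn : N + 1 = n)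
    (hN : 0 < N) : ∑ p ∈ words N, kap τ p * jw τ N (p ++ bar p) = 0 := by
  rw [← sum_words_bar, sum_words_count]
  have h2 : ∑ i ∈ Finset.range (N + 1), (τ ^ 2) ^ i = 0 :=
    sum_pow_eq_zero hn hN (by simpa using hω.inv)
  have e : ∀ i ∈ Finset.range (N + 1), (∑ u ∈ words N, if u.count true = i then
      kap τ (bar u) * jw τ N (bar u ++ bar (bar u)) else 0) = τ⁻¹ ^ N * (τ ^ 2) ^ i := by
    intro i hi
    rw [Finset.mem_range] at hi
    have hg := gb_ne_zero hω (show N < n by omega) (show i ≤ N by omega)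
    have : ∀ u ∈ words N, (if u.count true = i then
      kap τ (bar u) * jw τ N (bar u ++ bar (bar u)) else 0) = (τ⁻¹ ^ N * (τ ^ 2) ^ i /
        gb ((-τ⁻¹) ^ 2) N i) * if u.count true = i then ((-τ⁻¹) ^ 2) ^ inv u else 0 := by
      intro u hu
      rw [mem_words] at hu
      split_ifs with h
      · have hc := List.count_add_count_not u true
        simp only [Bool.not_true] at hc
        rw [jw_append _ (by simp [hu]), bar_bar, count_bar, inv_bar, kap, count_bar, Bool.not_true,
          if_pos (by omega), h, ← two_mul]
        have : τ⁻¹ ^ N * (τ ^ 2) ^ i = τ⁻¹ ^ u.count false * τ ^ i := by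
          rw [show N = u.count false + i by omega, pow_add, mul_assoc, ← mul_pow]
          congr 2
          rw [pow_two, inv_mul_cancel_left₀ hτ]
        rw [div_mul_eq_mul_div, this, ← pow_mul]
        ring
      · ring
    rw [Finset.sum_congr rfl this, ← Finset.mul_sum, sum_inv, div_mul_cancel₀ _ hg]
  rw [Finset.sum_congr rfl e, ← Finset.mul_sum, h2, mul_zero]

theorem pairZero_jw [CharZero K] (hτ : τ ≠ 0) (hd : τ + τ⁻¹ ≠ 0) {n N : ℕ}
    (hω : IsPrimitiveRoot ((-τ⁻¹) ^ 2) n) (hn : N + 1 = n) (hN : 0 < N) :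
    PairZero τ 0 (N + N) fun _ => jw τ N := by
  intro g hg
  have hz := JL.of_ML hτ hd (isIdeal_full _) hg
  obtain ⟨C, S, i, j, h, hS, hpair, -⟩ := (hz.cast (zero_add _)).split_pairing hτ hd
  rw [sum_words_zero, ← sum_words_bar, sum_words_append]
  have e : ∀ p ∈ words N, ∑ u ∈ words N, τ ^ chg [] * (jw τ N (bar (p ++ u)) * g (bar (p ++ u)) []) =
      C * (kap τ p * jw τ N (p ++ bar p)) := by
    intro p hp
    rw [mem_words] at hp
    have := hpair (jw τ N) p (bar p) hp
    rw [Finset.sum_eq_zero (s := S), add_zero] at this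
    · rw [mul_left_comm, ← this, Finset.mul_sum]
      refine Finset.sum_congr rfl fun u _ => ?_
      simp only [List.drop_zero, List.take_zero, chg, bar_append]
      have e2 : kap τ p * kap τ u * τ ^ (p ++ u).count true = 1 := by
        rw [← kap_append, kap, ← mul_pow, inv_mul_cancel₀ hτ, one_pow]
      rw [List.count_append] at e2 ⊢
      simp
      linear_combination -(jw τ N (bar u ++ bar p) * g (bar u ++ bar p) []) * e2
    · intro g' hg'
      refine Finset.sum_eq_zero fun u hu => ?_
      revert u
      simp only [mem_words]
      refine forall_append fun v w hv hw => ?_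
      have h2 := (hS g' hg').1
      rw [bar_append, List.append_assoc,
        ctrF_jw (by rw [bar_length, hw]) (by rw [bar_length, hv]; omega), mul_zero, mul_zero]
  rw [Finset.sum_congr rfl e, ← Finset.mul_sum, markov_jw hτ hω hn hN, mul_zero]

theorem idealNonzero_Negl [CharZero K] (hτ : τ ≠ 0) (hd : τ + τ⁻¹ ≠ 0) {n N : ℕ}
    (hω : IsPrimitiveRoot ((-τ⁻¹) ^ 2) n) (hn : N + 1 = n) (hN : 0 < N) :
    IdealNonzero (Negl (K := K) (τ + τ⁻¹)) := by
  obtain ⟨y, -, hy⟩ := JL.jw hτ hd hω (show N < n by omega)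
  refine ⟨0, N + N, y, (mem_Negl_iff hτ hd).2 fun g hg => ?_, ?_⟩
  · rw [← pairZero_jw hτ hd hω hn hN g hg]
    refine Finset.sum_congr rfl fun w hw => Finset.sum_congr rfl fun v hv => ?_
    rw [hy w v (mem_words.1 hw) (mem_words.1 hv)]
  · rintro rfl
    have h := hy [] (List.replicate N false ++ List.replicate N true) rfl (by simp)
    rw [lm_zero, jw_append _ (by simp), if_pos (by simp [List.count_replicate])] at h
    simp [inv_replicate, gb_self] at h
    exact pow_ne_zero _ hτ h.symm

end Negligible

section Main
variable {τ : K}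

theorem exists_lowest [CharZero K] {n : ℕ} (hn : 0 < n) (hτn : τ ^ n = -1)
    (hω : IsPrimitiveRoot ((-τ⁻¹) ^ 2) n) (hτ : τ ≠ 0) (hd : τ + τ⁻¹ ≠ 0)
    {J : ∀ m n : ℕ, Set (Hom K m n)} (hJ : IsIdeal (τ + τ⁻¹) J) (hJn : IdealNonzero J)
    (hJp : IdealProper J) : ∃ N x, N + 1 = n ∧ JL τ J (N + N) x ∧
      x (List.replicate N false ++ List.replicate N true) ≠ 0 ∧ ∀ k < N + N, ZeroAt τ J k := by
  have hex : ∃ k, ¬ ZeroAt τ J k := by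
    obtain ⟨k, x, w, hx, hw, hxw⟩ := hJn.exists_JL hτ hd hJ
    exact ⟨k, fun h => hxw (h x hx w hw)⟩
  have hmin : ∀ m < Nat.find hex, ZeroAt τ J m := fun m hm => not_not.1 (Nat.find_min hex hm)
  have hk := Nat.find_spec hex
  generalize Nat.find hex = k at hmin hk
  unfold ZeroAt at hk
  push Not at hk
  obtain ⟨x, hx, w, hw, hxw⟩ := hk
  obtain ⟨N, hN, rfl, h⟩ := lowest_degree hn hτn hω hd hJ (zeroAt_zero hτ hJ hJp) hmin hx hw hxw
  exact ⟨N, x, hN, hx, h, hmin⟩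

theorem idealProper_Negl [CharZero K] (hτ : τ ≠ 0) (hd : τ + τ⁻¹ ≠ 0) :
    IdealProper (Negl (K := K) (τ + τ⁻¹)) := by
  refine ⟨0, 0, fun h => ?_⟩
  have h1 : idHom K 0 ∈ Negl (τ + τ⁻¹) 0 0 := h ▸ Set.mem_univ _
  have h2 := (mem_Negl_iff hτ hd).1 h1 _ (ML.idF hτ 0)
  rw [sum_words_zero, sum_words_zero, lm_id hτ (n := 0) (u := []) (v := []) rfl rfl] at h2
  simp [chg, idF] at h2

theorem eq_Negl [CharZero K] {n : ℕ} (hn : 1 < n) (hτn : τ ^ n = -1)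
    (hω : IsPrimitiveRoot ((-τ⁻¹) ^ 2) n) (hτ : τ ≠ 0) (hd : τ + τ⁻¹ ≠ 0)
    {J : ∀ m n : ℕ, Set (Hom K m n)} (hJ : IsIdeal (τ + τ⁻¹) J) (hJn : IdealNonzero J)
    (hJp : IdealProper J) (m m' : ℕ) : J m m' = Negl (τ + τ⁻¹) m m' := by
  have hN := isIdeal_Negl hτ hd
  have hNn : IdealNonzero (Negl (K := K) (τ + τ⁻¹)) :=
    idealNonzero_Negl hτ hd hω (Nat.sub_add_cancel hn.le) (by omega)
  obtain ⟨N, x, rfl, hx, hx0, -⟩ := exists_lowest (by omega) hτn hω hτ hd hJ hJn hJp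
  obtain ⟨N', -, hN', -, -, hz⟩ := exists_lowest (by omega) hτn hω hτ hd hN hNn
    (idealProper_Negl hτ hd)
  obtain rfl : N' = N := by omega
  refine (subset_Negl hτ hd hJ hJp m m').antisymm fun y hy => ML.mem hτ ?_
  exact ML.of_JL hτ hd hN hJ (JL.of_lowest hτ hd hJ hN hx hx0 hz) (ML.of_mem hy)

end Main

/-- Let `n ≥ 3` be an integer and let `τ = e^{iπ/n}`, so that
`d = τ + τ⁻¹ = 2cos(π/n)`.  Then the Temperley–Lieb category `TL(τ)` has
exactly one nonzero proper ideal, namely the ideal `Negl` of negligible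
morphisms. -/
theorem stmt4 (n : ℕ) (hn : 3 ≤ n) (τ : ℂ)
    (hτ : τ = Complex.exp (Real.pi * Complex.I / n)) :
    τ + τ⁻¹ = ((2 * Real.cos (Real.pi / n) : ℝ) : ℂ) ∧
    (IsIdeal (τ + τ⁻¹) (Negl (τ + τ⁻¹)) ∧
      IdealNonzero (Negl (τ + τ⁻¹)) ∧ IdealProper (Negl (τ + τ⁻¹))) ∧
    (∀ J : ∀ m n' : ℕ, Set (Hom ℂ m n'), IsIdeal (τ + τ⁻¹) J →
      IdealNonzero J → IdealProper J →
      ∀ m n' : ℕ, J m n' = Negl (τ + τ⁻¹) m n') := by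
  have hn0 : (n : ℂ) ≠ 0 := Nat.cast_ne_zero.2 (by omega)
  have h0 : τ ≠ 0 := hτ ▸ Complex.exp_ne_zero _
  have hcos : τ + τ⁻¹ = ((2 * Real.cos (Real.pi / n) : ℝ) : ℂ) := by
    rw [hτ, ← Complex.exp_neg]
    push_cast
    rw [Complex.two_cos]
    congr 2 <;> ring
  have hd : τ + τ⁻¹ ≠ 0 := by
    rw [hcos, Complex.ofReal_ne_zero]
    have h3 : (3 : ℝ) ≤ n := by exact_mod_cast hn
    have hlt : Real.pi / n < Real.pi / 2 :=
      div_lt_div_of_pos_left Real.pi_pos two_pos (by linarith)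
    have := Real.cos_pos_of_mem_Ioo
      ⟨(neg_neg_of_pos (half_pos Real.pi_pos)).trans (by positivity), hlt⟩
    positivity
  have hτn : τ ^ n = -1 := by
    rw [hτ, ← Complex.exp_nat_mul, mul_div_cancel₀ _ hn0, Complex.exp_pi_mul_I]
  have hω : IsPrimitiveRoot ((-τ⁻¹) ^ 2) n := by
    have h := (Complex.isPrimitiveRoot_exp n (by omega)).inv
    have e : (-τ⁻¹) ^ 2 = (Complex.exp (2 * Real.pi * Complex.I / n))⁻¹ := by
      rw [neg_sq, inv_pow, hτ, ← Complex.exp_nat_mul]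
      congr 2
      push_cast
      ring
    rwa [e]
  exact ⟨hcos, ⟨isIdeal_Negl h0 hd,
    idealNonzero_Negl h0 hd hω (Nat.sub_add_cancel (by omega : 1 ≤ n)) (by omega),
    idealProper_Negl h0 hd⟩, fun J hJ hJn hJp => eq_Negl (by omega) hτn hω h0 hd hJ hJn hJp⟩

end TL
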